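/- Fix ν ∈ (0,1). There exist a sequence (a_n)_{n≥1} of real numbers with 0 ≤ a_n ≤ 2 satisfying condition R(ν) and real constants ξ_1, ξ_2, ξ_3, … with ξ_k > 1 for every k, such that for every integer k ≥ 1 one has T_k(x) → ξ_k as x → ∞. -/

import Mathlib

open Finset Filter

/-- The generalized von Mangoldt function `Λ_k(n) = ∑_{d ∣ n} μ(d) (log (n/d))^k`. -/
noncomputable def Lambdak (k : ℕ) (n : ℕ) : ℝ :=
  ∑ d ∈ n.divisors, (ArithmeticFunction.moebius d : ℝ) * (Real.log ((n : ℝ) / (d : ℝ))) ^ k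

/-- `S_k(x) = ∑_{n ≤ x} a_n Λ_k(n)`. -/
noncomputable def Ssum (a : ℕ → ℝ) (k : ℕ) (x : ℝ) : ℝ :=
  ∑ n ∈ Finset.Icc 1 ⌊x⌋₊, a n * Lambdak k n

/-- `T_k(x) = S_k(x)/(k x (log x)^{k−1})`. -/
noncomputable def Tquot (a : ℕ → ℝ) (k : ℕ) (x : ℝ) : ℝ :=
  Ssum a k x / (k * x * Real.log x ^ (k - 1))

/-- Condition `R(ν)`: for every `B > 0` there is `C_B` with
`∑_{d ≤ x^ν} |∑_{n ≤ x, d ∣ n} a_n − x/d| ≤ C_B · x (log x)^{−B}` for all `x ≥ 2`. -/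
noncomputable def Rcond (ν : ℝ) (a : ℕ → ℝ) : Prop :=
  ∀ B : ℝ, 0 < B → ∃ C : ℝ, ∀ x : ℝ, 2 ≤ x →
    ∑ d ∈ Finset.Icc 1 ⌊x ^ ν⌋₊,
      |(∑ n ∈ (Finset.Icc 1 ⌊x⌋₊).filter (fun n => d ∣ n), a n) - x / d|
      ≤ C * x * Real.log x ^ (-B)

/-- subpolynomial growth on the strip `1 < re s < 3` -/
def TB (f : ℂ → ℂ) : Prop := ∀ ε : ℝ, 0 < ε → ∃ K : ℝ, 0 ≤ K ∧ ∀ s : ℂ, 1 < s.re → s.re < 3 →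
  ‖f s‖ ≤ K * (1 + |s.im|) ^ ε

def TBn : ℕ → (ℂ → ℂ) → Prop
  | 0, f => TB f
  | k + 1, f => TB f ∧ ∃ f' : ℂ → ℂ, (∀ s : ℂ, 1 < s.re → s.re < 3 → HasDerivAt f (f' s) s) ∧
      TBn k f'

lemma TB.add {f g : ℂ → ℂ} (hf : TB f) (hg : TB g) : TB (fun s => f s + g s) := by
  intro ε hε
  obtain ⟨K, hK, h1⟩ := hf ε hε
  obtain ⟨L, hL, h2⟩ := hg ε hε
  refine ⟨K + L, by positivity, fun s hs hs' => ?_⟩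
  calc ‖f s + g s‖ ≤ ‖f s‖ + ‖g s‖ := norm_add_le _ _
    _ ≤ _ := by have := h1 s hs hs'; have := h2 s hs hs'; linarith

lemma TB.neg {f : ℂ → ℂ} (hf : TB f) : TB (fun s => - f s) := by
  intro ε hε
  obtain ⟨K, hK, h1⟩ := hf ε hε
  exact ⟨K, hK, fun s hs hs' => by rw [norm_neg]; exact h1 s hs hs'⟩

lemma TB.mul {f g : ℂ → ℂ} (hf : TB f) (hg : TB g) : TB (fun s => f s * g s) := by
  intro ε hε
  obtain ⟨K, hK, h1⟩ := hf (ε / 2) (by positivity)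
  obtain ⟨L, hL, h2⟩ := hg (ε / 2) (by positivity)
  refine ⟨K * L, by positivity, fun s hs hs' => ?_⟩
  have h0 : (0 : ℝ) < 1 + |s.im| := by positivity
  calc ‖f s * g s‖ = ‖f s‖ * ‖g s‖ := norm_mul _ _
    _ ≤ (K * (1 + |s.im|) ^ (ε / 2)) * (L * (1 + |s.im|) ^ (ε / 2)) := by
        have := h1 s hs hs'; have := h2 s hs hs'; gcongr
    _ = K * L * ((1 + |s.im|) ^ (ε / 2) * (1 + |s.im|) ^ (ε / 2)) := by ring
    _ = _ := by rw [← Real.rpow_add h0]; congr 2; ring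

lemma TB.of_bdd {f : ℂ → ℂ} (K : ℝ) (h : ∀ s : ℂ, 1 < s.re → s.re < 3 → ‖f s‖ ≤ K) : TB f := by
  intro ε hε
  refine ⟨|K|, abs_nonneg _, fun s hs hs' => ?_⟩
  have h1 : (1 : ℝ) ≤ (1 + |s.im|) ^ ε :=
    Real.one_le_rpow (by linarith [abs_nonneg s.im]) hε.le
  calc ‖f s‖ ≤ K := h s hs hs'
    _ ≤ |K| * 1 := by rw [mul_one]; exact le_abs_self K
    _ ≤ _ := by gcongr

lemma TBn.tb {k : ℕ} {f : ℂ → ℂ} (hf : TBn k f) : TB f := by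
  cases k with
  | zero => exact hf
  | succ k => exact hf.1

lemma TBn.down {k : ℕ} {f : ℂ → ℂ} (hf : TBn (k + 1) f) : TBn k f := by
  induction k generalizing f with
  | zero => exact hf.1
  | succ k ih =>
    obtain ⟨h, f', h1, h2⟩ := hf
    exact ⟨h, f', h1, ih h2⟩

lemma TBn.add {k : ℕ} {f g : ℂ → ℂ} (hf : TBn k f) (hg : TBn k g) :
    TBn k (fun s => f s + g s) := by
  induction k generalizing f g with
  | zero => exact TB.add hf hg
  | succ k ih =>
    obtain ⟨h, f', h1, h2⟩ := hf
    obtain ⟨q, g', q1, q2⟩ := hg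
    exact ⟨h.add q, fun s => f' s + g' s, fun s hs hs' => (h1 s hs hs').add (q1 s hs hs'), ih h2 q2⟩

lemma TBn.neg {k : ℕ} {f : ℂ → ℂ} (hf : TBn k f) : TBn k (fun s => - f s) := by
  induction k generalizing f with
  | zero => exact TB.neg hf
  | succ k ih =>
    obtain ⟨h, f', h1, h2⟩ := hf
    exact ⟨h.neg, fun s => - f' s, fun s hs hs' => (h1 s hs hs').neg, ih h2⟩

lemma TBn.mul {k : ℕ} {f g : ℂ → ℂ} (hf : TBn k f) (hg : TBn k g) :
    TBn k (fun s => f s * g s) := by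
  induction k generalizing f g with
  | zero => exact TB.mul hf hg
  | succ k ih =>
    have hfd := hf.down
    have hgd := hg.down
    obtain ⟨h, f', h1, h2⟩ := hf
    obtain ⟨q, g', q1, q2⟩ := hg
    exact ⟨h.mul q, fun s => f' s * g s + f s * g' s,
      fun s hs hs' => (h1 s hs hs').mul (q1 s hs hs'), (ih h2 hgd).add (ih hfd q2)⟩

lemma TBn.inv {k : ℕ} {f : ℂ → ℂ} (hf : TBn k f) (h0 : ∀ s : ℂ, 1 < s.re → s.re < 3 → f s ≠ 0)
    (hi : TB (fun s => (f s)⁻¹)) : TBn k (fun s => (f s)⁻¹) := by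
  induction k with
  | zero => exact hi
  | succ k ih =>
    have hd := ih hf.down
    obtain ⟨h, f', h1, h2⟩ := hf
    refine ⟨hi, fun s => -(f' s * ((f s)⁻¹ * (f s)⁻¹)), fun s hs hs' => ?_,
      (h2.mul (hd.mul hd)).neg⟩
    have := (h1 s hs hs').inv (h0 s hs hs')
    rw [neg_div, div_eq_mul_inv, pow_two, mul_inv] at this
    exact this

/-- larger class: holomorphic on `re s > 0`, subpolynomial just to the left of `re s = 1`. -/
def WB (f : ℂ → ℂ) : Prop := DifferentiableOn ℂ f {s | 0 < s.re} ∧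
  ∀ ε : ℝ, 0 < ε → ∃ r : ℝ, 0 < r ∧ r < 1 ∧ ∃ K : ℝ, 0 ≤ K ∧ ∀ s : ℂ, 1 - r < s.re → s.re < 3 + r →
  ‖f s‖ ≤ K * (1 + |s.im|) ^ ε

lemma WB.tb {f : ℂ → ℂ} (hf : WB f) : TB f := by
  intro ε hε
  obtain ⟨r, hr, _, K, hK, h⟩ := hf.2 ε hε
  exact ⟨K, hK, fun s hs hs' => h s (by linarith) (by linarith)⟩

lemma isOpen_re_pos : IsOpen {s : ℂ | 0 < s.re} := isOpen_lt continuous_const Complex.continuous_re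

lemma WB.deriv {f : ℂ → ℂ} (hf : WB f) : WB (deriv f) := by
  refine ⟨hf.1.deriv isOpen_re_pos, fun ε hε => ?_⟩
  obtain ⟨r, hr, hr1, K, hK, h⟩ := hf.2 ε hε
  refine ⟨r / 2, by positivity, by linarith, K * 2 ^ ε / (r / 3), by positivity, fun s hs hs' => ?_⟩
  have hsub : ∀ z ∈ Metric.closedBall s (r / 3), |z.re - s.re| ≤ r / 3 ∧ |z.im - s.im| ≤ r / 3 := by
    intro z hz
    rw [Metric.mem_closedBall, dist_eq_norm] at hz
    have h1 := Complex.abs_re_le_norm (z - s)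
    have h2 := Complex.abs_im_le_norm (z - s)
    simp only [Complex.sub_re, Complex.sub_im] at h1 h2
    exact ⟨h1.trans hz, h2.trans hz⟩
  have hb : ∀ z ∈ Metric.sphere s (r / 3), ‖f z‖ ≤ K * 2 ^ ε * (1 + |s.im|) ^ ε := by
    intro z hz
    obtain ⟨h1, h2⟩ := hsub z (Metric.sphere_subset_closedBall hz)
    have h1' := abs_le.1 h1
    have h3 : |z.im| ≤ |s.im| + 1 := by
      have := abs_add_le (z.im - s.im) s.im
      simp only [sub_add_cancel] at this
      linarith
    have h4 : 1 + |z.im| ≤ 2 * (1 + |s.im|) := by linarith [abs_nonneg s.im]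
    calc ‖f z‖ ≤ K * (1 + |z.im|) ^ ε := h z (by linarith) (by linarith)
      _ ≤ K * (2 * (1 + |s.im|)) ^ ε := by gcongr
      _ = _ := by rw [Real.mul_rpow (by norm_num) (by positivity)]; ring
  have hd : DiffContOnCl ℂ f (Metric.ball s (r / 3)) := by
    apply DifferentiableOn.diffContOnCl
    rw [closure_ball _ (by positivity)]
    refine hf.1.mono fun z hz => ?_
    have h1 := abs_le.1 (hsub z hz).1
    simp only [Set.mem_ofPred_eq]
    linarith
  have := Complex.norm_deriv_le_of_forall_mem_sphere_norm_le (by positivity) hd hb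
  calc _ ≤ _ := this
    _ = _ := by ring

lemma WB.tbn {f : ℂ → ℂ} (hf : WB f) (k : ℕ) : TBn k f := by
  induction k generalizing f with
  | zero => exact hf.tb
  | succ k ih =>
    refine ⟨hf.tb, _root_.deriv f, fun s hs _ => ?_, ih hf.deriv⟩
    exact (hf.1.differentiableAt (isOpen_re_pos.mem_nhds (by simp only [Set.mem_ofPred_eq]; linarith))).hasDerivAt

lemma TBn.lseries {k : ℕ} {F : ℂ → ℂ} {c : ℕ → ℂ} (hF : TBn k F)
    (hc : LSeries.abscissaOfAbsConv c ≤ 1)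
    (heq : ∀ s : ℂ, 1 < s.re → s.re < 3 → F s = LSeries c s) :
    TB (LSeries (LSeries.logMul^[k] c)) := by
  induction k generalizing F c with
  | zero =>
    intro ε hε
    obtain ⟨K, hK, h⟩ := hF ε hε
    exact ⟨K, hK, fun s hs hs' => by simpa [← heq s hs hs'] using h s hs hs'⟩
  | succ k ih =>
    obtain ⟨h, f', h1, h2⟩ := hF
    rw [Function.iterate_succ_apply]
    refine ih h2.neg ?_ fun s hs hs' => ?_
    · have := LSeries.absicssaOfAbsConv_logPowMul (f := c) (m := 1)
      simp only [Function.iterate_one] at this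
      rw [this]; exact hc
    · have e1 := h1 s hs hs'
      have hlt : LSeries.abscissaOfAbsConv c < (s.re : EReal) :=
        lt_of_le_of_lt hc (by exact_mod_cast hs)
      have e2 := LSeries_hasDerivAt hlt
      have e3 : F =ᶠ[nhds s] LSeries c := by
        have ho : IsOpen {z : ℂ | 1 < z.re ∧ z.re < 3} :=
          (isOpen_lt continuous_const Complex.continuous_re).inter
            (isOpen_lt Complex.continuous_re continuous_const)
        filter_upwards [ho.mem_nhds ⟨hs, hs'⟩] with z hz using heq z hz.1 hz.2
      have := e1.unique (e2.congr_of_eventuallyEq e3)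
      rw [this, neg_neg]

noncomputable def wz (n : ℕ) (s : ℂ) : ℂ :=
  (s - 1) * ((n : ℂ) + 1) ^ (-s) + ((n : ℂ) + 2) ^ (1 - s) - ((n : ℂ) + 1) ^ (1 - s)

lemma wz_one (n : ℕ) : wz n 1 = 0 := by simp [wz]

lemma wz_eq (n : ℕ) (s : ℂ) (hs : s ≠ 1) :
    wz n s = (s - 1) * ∫ u in ((n : ℝ) + 1)..((n : ℝ) + 2), (((n : ℂ) + 1) ^ (-s) - (u : ℂ) ^ (-s)) := by
  have h0 : (0 : ℝ) ∉ Set.uIcc ((n : ℝ) + 1) ((n : ℝ) + 2) := by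
    rw [Set.uIcc_of_le (by linarith)]
    simp only [Set.mem_Icc, not_and]
    intro h; exfalso; have : (0 : ℝ) ≤ n := by positivity
    linarith
  have h1 : -s ≠ -1 := fun h => hs (neg_injective h)
  have h3 : s - 1 ≠ 0 := sub_ne_zero.2 hs
  have h4 : -s + 1 ≠ 0 := fun h => h3 (by linear_combination -h)
  rw [intervalIntegral.integral_sub (by simp) (intervalIntegral.intervalIntegrable_cpow (Or.inr h0)),
    integral_cpow (Or.inr ⟨h1, h0⟩)]
  simp only [intervalIntegral.integral_const, wz]
  push_cast
  have : (1 - s) = -s + 1 := by ring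
  rw [this]
  have e : s - 1 = -(-s + 1) := by ring
  rw [e]
  simp only [add_sub_add_left_eq_sub, Complex.real_smul]
  push_cast
  field_simp
  ring

lemma wz_int_bound1 (n : ℕ) (s : ℂ) (hs : 0 < s.re) :
    ‖∫ u in ((n : ℝ) + 1)..((n : ℝ) + 2), (((n : ℂ) + 1) ^ (-s) - (u : ℂ) ^ (-s))‖
      ≤ 2 * ((n : ℝ) + 1) ^ (-s.re) := by
  have hn : (0 : ℝ) < (n : ℝ) + 1 := by positivity
  have : ∀ u ∈ Set.uIoc ((n : ℝ) + 1) ((n : ℝ) + 2), ‖((n : ℂ) + 1) ^ (-s) - (u : ℂ) ^ (-s)‖ ≤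
      2 * ((n : ℝ) + 1) ^ (-s.re) := by
    intro u hu
    rw [Set.uIoc_of_le (by linarith)] at hu
    have hu0 : 0 < u := hn.trans hu.1
    have e1 : ‖((n : ℂ) + 1) ^ (-s)‖ = ((n : ℝ) + 1) ^ (-s.re) := by
      have := Complex.norm_cpow_eq_rpow_re_of_pos hn (-s)
      simpa using this
    have e2 : ‖(u : ℂ) ^ (-s)‖ = u ^ (-s.re) := by
      have := Complex.norm_cpow_eq_rpow_re_of_pos hu0 (-s)
      simpa using this
    have e3 : u ^ (-s.re) ≤ ((n : ℝ) + 1) ^ (-s.re) :=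
      Real.rpow_le_rpow_of_nonpos hn hu.1.le (by linarith)
    calc _ ≤ _ := norm_sub_le _ _
      _ ≤ _ := by rw [e1, e2]; linarith
  have h := intervalIntegral.norm_integral_le_of_norm_le_const this
  have e : |(n : ℝ) + 2 - (n + 1)| = 1 := by norm_num
  rwa [e, mul_one] at h

lemma wz_int_bound2 (n : ℕ) (s : ℂ) (hs : 0 < s.re) :
    ‖∫ u in ((n : ℝ) + 1)..((n : ℝ) + 2), (((n : ℂ) + 1) ^ (-s) - (u : ℂ) ^ (-s))‖
      ≤ ‖s‖ * ((n : ℝ) + 1) ^ (-s.re - 1) := by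
  have hn : (0 : ℝ) < (n : ℝ) + 1 := by positivity
  have : ∀ u ∈ Set.uIoc ((n : ℝ) + 1) ((n : ℝ) + 2), ‖((n : ℂ) + 1) ^ (-s) - (u : ℂ) ^ (-s)‖ ≤
      ‖s‖ * ((n : ℝ) + 1) ^ (-s.re - 1) := by
    intro u hu
    rw [Set.uIoc_of_le (by linarith)] at hu
    have hs0 : -s ≠ 0 := by
      intro h; have : s = 0 := by simpa using h
      simp [this] at hs
    have hd : ∀ x ∈ Set.Icc ((n : ℝ) + 1) ((n : ℝ) + 2), HasDerivWithinAt (fun y : ℝ => (y : ℂ) ^ (-s))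
        ((-s) * (x : ℂ) ^ (-s - 1)) (Set.Icc ((n : ℝ) + 1) ((n : ℝ) + 2)) x := by
      intro x hx
      exact (hasDerivAt_ofReal_cpow_const (x := x) (by linarith [hx.1]) hs0).hasDerivWithinAt
    have hb : ∀ x ∈ Set.Icc ((n : ℝ) + 1) ((n : ℝ) + 2), ‖(-s) * (x : ℂ) ^ (-s - 1)‖ ≤
        ‖s‖ * ((n : ℝ) + 1) ^ (-s.re - 1) := by
      intro x hx
      have hx0 : 0 < x := by linarith [hx.1]
      have := Complex.norm_cpow_eq_rpow_re_of_pos hx0 (-s - 1)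
      rw [norm_mul, norm_neg, this]
      simp only [Complex.sub_re, Complex.neg_re, Complex.one_re]
      exact mul_le_mul_of_nonneg_left (Real.rpow_le_rpow_of_nonpos hn hx.1 (by linarith)) (norm_nonneg _)
    have := (convex_Icc ((n : ℝ) + 1) ((n : ℝ) + 2)).norm_image_sub_le_of_norm_hasDerivWithin_le hd hb
      (x := u) (y := (n : ℝ) + 1) ⟨hu.1.le, hu.2⟩ ⟨le_refl _, by linarith⟩
    push_cast at this
    have e : ‖(n : ℝ) + 1 - u‖ ≤ 1 := by
      rw [Real.norm_eq_abs, abs_le]; constructor <;> linarith [hu.1, hu.2]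
    calc _ ≤ _ := this
      _ ≤ ‖s‖ * ((n : ℝ) + 1) ^ (-s.re - 1) * 1 := by gcongr
      _ = _ := by ring
  have h := intervalIntegral.norm_integral_le_of_norm_le_const this
  have e : |(n : ℝ) + 2 - (n + 1)| = 1 := by norm_num
  rwa [e, mul_one] at h

lemma wz_bound (n : ℕ) (s : ℂ) (hs : 0 < s.re) {θ : ℝ} (h0 : 0 ≤ θ) (h1 : θ ≤ 1) :
    ‖wz n s‖ ≤ ‖s - 1‖ * (2 * ‖s‖ ^ θ * ((n : ℝ) + 1) ^ (-s.re - θ)) := by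
  by_cases hs1 : s = 1
  · simp [hs1, wz_one]
  rw [wz_eq n s hs1, norm_mul]
  refine mul_le_mul_of_nonneg_left ?_ (norm_nonneg _)
  set I := ‖∫ u in ((n : ℝ) + 1)..((n : ℝ) + 2), (((n : ℂ) + 1) ^ (-s) - (u : ℂ) ^ (-s))‖ with hI
  have hn : (0 : ℝ) < (n : ℝ) + 1 := by positivity
  have b1 := wz_int_bound1 n s hs
  have b2 := wz_int_bound2 n s hs
  rw [← hI] at b1 b2
  have hI0 : 0 ≤ I := norm_nonneg _
  calc I = I ^ θ * I ^ (1 - θ) := by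
        rcases hI0.eq_or_lt with h | h
        · rw [← h]
          rcases h0.eq_or_lt with h' | h'
          · simp [← h']
          · rw [Real.zero_rpow h'.ne']; simp
        · rw [← Real.rpow_add h]; simp
    _ ≤ (‖s‖ * ((n : ℝ) + 1) ^ (-s.re - 1)) ^ θ * (2 * ((n : ℝ) + 1) ^ (-s.re)) ^ (1 - θ) := by
        gcongr
    _ = 2 ^ (1 - θ) * ‖s‖ ^ θ * ((((n : ℝ) + 1) ^ (-s.re - 1)) ^ θ * (((n : ℝ) + 1) ^ (-s.re)) ^ (1 - θ)) := by
        rw [Real.mul_rpow (by positivity) (by positivity), Real.mul_rpow (by positivity) (by positivity)]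
        ring
    _ = 2 ^ (1 - θ) * ‖s‖ ^ θ * ((n : ℝ) + 1) ^ (-s.re - θ) := by
        rw [← Real.rpow_mul hn.le, ← Real.rpow_mul hn.le, ← Real.rpow_add hn]
        congr 2; ring
    _ ≤ 2 ^ (1 : ℝ) * ‖s‖ ^ θ * ((n : ℝ) + 1) ^ (-s.re - θ) := by
        gcongr
        · norm_num
        · linarith
    _ = _ := by rw [Real.rpow_one]

lemma summable_nat_add_one_rpow {p : ℝ} (hp : p < -1) : Summable (fun n : ℕ => ((n : ℝ) + 1) ^ p) := by
  have := (Real.summable_nat_rpow (p := p)).2 hp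
  have := (summable_nat_add_iff 1).2 this
  simpa using this

noncomputable def gz (s : ℂ) : ℂ := 1 + ∑' n : ℕ, wz n s

lemma gz_one : gz 1 = 1 := by simp [gz, wz_one]

lemma gz_differentiableOn : DifferentiableOn ℂ gz {s | 0 < s.re} := by
  intro s hs
  have hs : 0 < s.re := hs
  refine DifferentiableAt.differentiableWithinAt ?_
  unfold gz
  refine (differentiableAt_const _).add ?_
  set U : Set ℂ := {z | s.re / 2 < z.re} ∩ {z | ‖z‖ < ‖s‖ + 1}
  have hU : IsOpen U := (isOpen_lt continuous_const Complex.continuous_re).inter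
    (isOpen_lt continuous_norm continuous_const)
  have hsU : s ∈ U := ⟨by change s.re / 2 < s.re; linarith, by change ‖s‖ < ‖s‖ + 1; linarith⟩
  refine DifferentiableOn.differentiableAt (s := U) ?_ (hU.mem_nhds hsU)
  refine Complex.differentiableOn_tsum_of_summable_norm
    (u := fun n : ℕ => (‖s‖ + 2) * (2 * (‖s‖ + 1) * ((n : ℝ) + 1) ^ (- (s.re / 2) - 1))) ?_ ?_ hU ?_
  · exact ((summable_nat_add_one_rpow (by linarith)).mul_left _).mul_left _
  · intro n
    have h1 : ((n : ℂ) + 1) ≠ 0 := by exact_mod_cast Nat.succ_ne_zero n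
    have h2 : ((n : ℂ) + 2) ≠ 0 := by exact_mod_cast Nat.succ_ne_zero (n + 1)
    unfold wz
    intro z _
    refine DifferentiableAt.differentiableWithinAt ?_
    refine DifferentiableAt.sub (DifferentiableAt.add (DifferentiableAt.mul (by fun_prop) ?_) ?_) ?_
    · exact DifferentiableAt.const_cpow (by fun_prop) (Or.inl h1)
    · exact DifferentiableAt.const_cpow (by fun_prop) (Or.inl h2)
    · exact DifferentiableAt.const_cpow (by fun_prop) (Or.inl h1)
  · intro n z hz
    have hz1 : s.re / 2 < z.re := hz.1
    have hz2 : ‖z‖ < ‖s‖ + 1 := hz.2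
    have hb := wz_bound n z (by linarith) (θ := 1) (by norm_num) le_rfl
    rw [Real.rpow_one] at hb
    refine hb.trans ?_
    have : ‖z - 1‖ ≤ ‖s‖ + 2 := by
      have := norm_sub_le z 1
      rw [norm_one] at this; linarith
    have h1 : (1 : ℝ) ≤ (n : ℝ) + 1 := by linarith [(Nat.cast_nonneg n : (0 : ℝ) ≤ n)]
    gcongr

lemma gz_eq (s : ℂ) (hs : 1 < s.re) : gz s = (s - 1) * riemannZeta s := by
  have hz : HasSum (fun n : ℕ => ((n : ℂ) + 1) ^ (-s)) (riemannZeta s) := by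
    rw [zeta_eq_tsum_one_div_nat_add_one_cpow hs]
    have : (fun n : ℕ => ((n : ℂ) + 1) ^ (-s)) = fun n : ℕ => 1 / ((n : ℂ) + 1) ^ s := by
      ext n; rw [Complex.cpow_neg, one_div]
    rw [this]
    refine Summable.hasSum ?_
    have := (summable_nat_add_iff 1).2 (Complex.summable_one_div_nat_cpow.2 hs)
    simpa using this
  have ht : Tendsto (fun n : ℕ => ((n : ℂ) + 1) ^ (1 - s)) atTop (nhds 0) := by
    rw [tendsto_zero_iff_norm_tendsto_zero]
    have : (fun n : ℕ => ‖((n : ℂ) + 1) ^ (1 - s)‖) = fun n : ℕ => ((n : ℝ) + 1) ^ (-(s.re - 1)) := by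
      ext n
      have := Complex.norm_cpow_eq_rpow_re_of_pos (by positivity : (0 : ℝ) < (n : ℝ) + 1) (1 - s)
      push_cast at this
      rw [this]; simp
    rw [this]
    exact (tendsto_rpow_neg_atTop (by linarith)).comp
      (tendsto_atTop_add_const_right _ _ tendsto_natCast_atTop_atTop)
  have hsum : HasSum (fun n : ℕ => wz n s) ((s - 1) * riemannZeta s - 1) := by
    have hs' : Summable (fun n : ℕ => wz n s) := by
      refine Summable.of_norm_bounded
        (g := fun n : ℕ => ‖s - 1‖ * (2 * ‖s‖ ^ (0 : ℝ) * ((n : ℝ) + 1) ^ (-s.re - 0))) ?_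
        (fun n => wz_bound n s (by linarith) le_rfl (by norm_num))
      exact ((summable_nat_add_one_rpow (by linarith)).mul_left _).mul_left _
    have h2 : Tendsto (fun N => ∑ n ∈ range N, wz n s) atTop (nhds ((s - 1) * riemannZeta s - 1)) := by
      have e : ∀ N, ∑ n ∈ range N, wz n s = (s - 1) * ∑ n ∈ range N, ((n : ℂ) + 1) ^ (-s) +
          (((N : ℂ) + 1) ^ (1 - s) - 1) := by
        intro N
        induction N with
        | zero => simp
        | succ N ih =>
          rw [Finset.sum_range_succ, Finset.sum_range_succ, ih, wz]
          push_cast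
          have : (N : ℂ) + 1 + 1 = N + 2 := by ring
          rw [this]; ring
      simp_rw [e]
      have := (hz.tendsto_sum_nat.const_mul (s - 1)).add (ht.sub_const 1)
      simpa [sub_eq_add_neg] using this
    have h3 := hs'.hasSum.tendsto_sum_nat
    rw [← tendsto_nhds_unique h3 h2]
    exact hs'.hasSum
  rw [gz, hsum.tsum_eq]; ring

noncomputable def Ez : ℂ → ℂ := dslope gz 1

lemma Ez_eq (s : ℂ) (hs : s ≠ 1) : Ez s = (gz s - 1) / (s - 1) := by
  rw [Ez, dslope_of_ne _ hs, slope_def_field, gz_one]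

lemma zeta_eq_Ez (s : ℂ) (hs : 1 < s.re) : riemannZeta s = 1 / (s - 1) + Ez s := by
  have h1 : s ≠ 1 := fun h => by simp [h] at hs
  have := sub_ne_zero.2 h1
  rw [Ez_eq s h1, gz_eq s hs]
  field_simp; ring

lemma Ez_WB : WB Ez := by
  refine ⟨(Complex.differentiableOn_dslope (isOpen_re_pos.mem_nhds (by simp))).2 gz_differentiableOn,
    fun ε hε => ?_⟩
  set θ := min ε 1 with hθ
  have hθ0 : 0 < θ := lt_min hε one_pos
  have hθ1 : θ ≤ 1 := min_le_right _ _
  set Z := ∑' n : ℕ, ((n : ℝ) + 1) ^ (-1 - θ / 2) with hZ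
  have hZs := summable_nat_add_one_rpow (p := -1 - θ / 2) (by linarith)
  have hZ0 : 0 ≤ Z := tsum_nonneg fun n => by positivity
  refine ⟨θ / 2, by positivity, by linarith, 8 * Z + ‖Ez 1‖, by positivity, fun s hs hs' => ?_⟩
  have hT : (1 : ℝ) ≤ 1 + |s.im| := by linarith [abs_nonneg s.im]
  have hT1 : (1 : ℝ) ≤ (1 + |s.im|) ^ ε := Real.one_le_rpow hT hε.le
  by_cases h1 : s = 1
  · subst h1
    calc ‖Ez 1‖ ≤ (8 * Z + ‖Ez 1‖) * 1 := by linarith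
      _ ≤ _ := by gcongr
  have hb : ‖gz s - 1‖ ≤ ‖s - 1‖ * (2 * ‖s‖ ^ θ * Z) := by
    have e : gz s - 1 = ∑' n : ℕ, wz n s := by rw [gz]; ring
    rw [e]
    refine tsum_of_norm_bounded (g := fun n : ℕ => ‖s - 1‖ * (2 * ‖s‖ ^ θ * ((n : ℝ) + 1) ^ (-1 - θ / 2))) ?_ ?_
    · exact (hZs.hasSum.mul_left _).mul_left _
    · intro n
      refine (wz_bound n s (by linarith) hθ0.le hθ1).trans ?_
      have h1 : (1 : ℝ) ≤ (n : ℝ) + 1 := by linarith [(Nat.cast_nonneg n : (0 : ℝ) ≤ n)]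
      gcongr ?_ * (_ * ?_)
      exact Real.rpow_le_rpow_of_exponent_le h1 (by linarith)
  have hs1 : 0 < ‖s - 1‖ := norm_pos_iff.2 (sub_ne_zero.2 h1)
  have hns : ‖s‖ ≤ 4 * (1 + |s.im|) := by
    have := Complex.norm_le_abs_re_add_abs_im s
    rw [abs_of_pos (by linarith : 0 < s.re)] at this
    linarith [abs_nonneg s.im]
  rw [Ez_eq s h1, norm_div, div_le_iff₀ hs1]
  calc _ ≤ _ := hb
    _ ≤ ‖s - 1‖ * (2 * (4 * (1 + |s.im|) ^ ε) * Z) := by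
        gcongr
        calc ‖s‖ ^ θ ≤ (4 * (1 + |s.im|)) ^ θ := by gcongr
          _ = 4 ^ θ * (1 + |s.im|) ^ θ := Real.mul_rpow (by norm_num) (by positivity)
          _ ≤ 4 ^ (1 : ℝ) * (1 + |s.im|) ^ ε := by
            gcongr
            · norm_num
            · exact min_le_left _ _
          _ = _ := by rw [Real.rpow_one]
    _ = (8 * Z) * (1 + |s.im|) ^ ε * ‖s - 1‖ := by ring
    _ ≤ _ := by gcongr; linarith [norm_nonneg (Ez 1)]

lemma TBn.const (k : ℕ) (c : ℂ) : TBn k (fun _ => c) := by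
  refine WB.tbn ⟨differentiableOn_const _, fun ε hε => ⟨1 / 2, by norm_num, by norm_num, ‖c‖,
    norm_nonneg _, fun s _ _ => ?_⟩⟩ k
  have h1 : (1 : ℝ) ≤ (1 + |s.im|) ^ ε :=
    Real.one_le_rpow (by linarith [abs_nonneg s.im]) hε.le
  nlinarith [norm_nonneg c]

lemma TBn.inv_id (k : ℕ) : TBn k (fun s => s⁻¹) := by
  refine WB.tbn ⟨?_, fun ε hε => ⟨1 / 2, by norm_num, by norm_num, 2,
    by norm_num, fun s hs _ => ?_⟩⟩ k
  · intro s hs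
    have : s ≠ 0 := fun h => by simp [h] at hs
    exact (differentiableAt_inv this).differentiableWithinAt
  · have h1 : (1 : ℝ) ≤ (1 + |s.im|) ^ ε :=
      Real.one_le_rpow (by linarith [abs_nonneg s.im]) hε.le
    have h2 : 1 / 2 ≤ ‖s‖ := by
      have := Complex.abs_re_le_norm s
      have := le_abs_self s.re
      linarith
    rw [norm_inv]
    calc ‖s‖⁻¹ ≤ (1 / 2)⁻¹ := inv_anti₀ (by norm_num) h2
      _ = 2 * 1 := by norm_num
      _ ≤ _ := by gcongr

noncomputable def fz (s : ℂ) : ℂ := s⁻¹ + (1 + -s⁻¹) * Ez s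

lemma fz_TBn (k : ℕ) : TBn k fz :=
  (TBn.inv_id k).add (((TBn.const k 1).add (TBn.inv_id k).neg).mul (Ez_WB.tbn k))

lemma fz_eq (s : ℂ) (hs : 1 < s.re) : fz s = (s - 1) / s * riemannZeta s := by
  have h1 : s ≠ 1 := fun h => by simp [h] at hs
  have h2 := sub_ne_zero.2 h1
  have h0 : s ≠ 0 := fun h => by simp [h] at hs; linarith
  rw [zeta_eq_Ez s hs, fz]
  field_simp
  ring

lemma fz_contOn : ContinuousOn fz {s | 0 < s.re} := by
  unfold fz
  have h : ContinuousOn (fun s : ℂ => s⁻¹) {s | 0 < s.re} := by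
    intro s hs
    have : s ≠ 0 := fun h => by simp [h] at hs
    exact (continuousAt_inv₀ this).continuousWithinAt
  exact h.add ((continuousOn_const.add h.neg).mul Ez_WB.1.continuousOn)

lemma fz_ne_zero (s : ℂ) (hs : 1 ≤ s.re) : fz s ≠ 0 := by
  by_cases h1 : s = 1
  · subst h1; simp [fz]
  have h0 : s ≠ 0 := fun h => by simp [h] at hs; linarith
  have h2 := sub_ne_zero.2 h1
  have e : fz s = (s - 1) / s * riemannZeta s := by
    have t0 : Tendsto (fun δ : ℝ => s + δ) (nhdsWithin 0 (Set.Ioi 0)) (nhds s) := by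
      have : Tendsto (fun δ : ℝ => s + δ) (nhds 0) (nhds (s + (0 : ℝ))) := by
        apply Continuous.tendsto; fun_prop
      simp only [Complex.ofReal_zero, add_zero] at this
      exact this.mono_left nhdsWithin_le_nhds
    have c1 : ContinuousAt fz s := fz_contOn.continuousAt
      (isOpen_re_pos.mem_nhds (show 0 < s.re by linarith))
    have c2 : ContinuousAt (fun z : ℂ => (z - 1) / z * riemannZeta z) s := by
      refine ContinuousAt.mul ?_ (differentiableAt_riemannZeta h1).continuousAt
      exact ContinuousAt.div (by fun_prop) (by fun_prop) h0
    have t1 := c1.tendsto.comp t0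
    have t2 := c2.tendsto.comp t0
    refine tendsto_nhds_unique_of_eventuallyEq t1 t2 ?_
    filter_upwards [self_mem_nhdsWithin] with δ hδ
    have hδ : 0 < δ := hδ
    exact fz_eq _ (by simp; linarith)
  rw [e]
  exact mul_ne_zero (div_ne_zero h2 h0) (riemannZeta_ne_zero_of_one_le_re hs)

lemma fz_inv_small : ∃ K : ℝ, ∀ s : ℂ, 1 ≤ s.re → s.re ≤ 3 → |s.im| ≤ 1 → ‖(fz s)⁻¹‖ ≤ K := by
  have hc : IsCompact (Set.Icc (1 : ℝ) 3 ×ℂ Set.Icc (-1 : ℝ) 1) := isCompact_Icc.reProdIm isCompact_Icc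
  have hcont : ContinuousOn (fun s => (fz s)⁻¹) (Set.Icc (1 : ℝ) 3 ×ℂ Set.Icc (-1 : ℝ) 1) := by
    refine ContinuousOn.inv₀ (fz_contOn.mono fun s hs => ?_) fun s hs => fz_ne_zero s ?_
    · rw [Complex.mem_reProdIm] at hs
      exact lt_of_lt_of_le one_pos hs.1.1
    · rw [Complex.mem_reProdIm] at hs
      exact hs.1.1
  obtain ⟨K, hK⟩ := hc.exists_bound_of_continuousOn hcont
  refine ⟨K, fun s h1 h2 h3 => hK s ?_⟩
  rw [Complex.mem_reProdIm]
  exact ⟨⟨h1, h2⟩, abs_le.1 h3⟩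

lemma three_four_one (σ t : ℝ) (hσ : 1 < σ) :
    1 ≤ ‖riemannZeta σ‖ ^ 3 * ‖riemannZeta (σ + t * Complex.I)‖ ^ 4 *
      ‖riemannZeta (σ + (2 * t : ℝ) * Complex.I)‖ := by
  have := DirichletCharacter.norm_LFunction_product_ge_one (1 : DirichletCharacter ℂ 1)
    (x := σ - 1) (by linarith) t
  rw [DirichletCharacter.LFunctionTrivChar, DirichletCharacter.LFunction_modOne_eq,
    DirichletCharacter.LFunction_modOne_eq] at this
  rw [norm_mul, norm_mul, norm_pow, norm_pow] at this
  have e1 : (1 : ℂ) + ((σ - 1 : ℝ) : ℂ) = σ := by push_cast; ring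
  have e2 : (1 : ℂ) + ((σ - 1 : ℝ) : ℂ) + Complex.I * t = σ + t * Complex.I := by push_cast; ring
  have e3 : (1 : ℂ) + ((σ - 1 : ℝ) : ℂ) + 2 * Complex.I * t = σ + (2 * t : ℝ) * Complex.I := by
    push_cast; ring
  rw [e2, e3, e1] at this
  exact this

lemma zeta_deriv_eq (s : ℂ) (hs : 1 < s.re) :
    HasDerivAt riemannZeta (-1 / (s - 1) ^ 2 + deriv Ez s) s := by
  have h1 : s ≠ 1 := fun h => by simp [h] at hs
  have h2 := sub_ne_zero.2 h1
  have e : riemannZeta =ᶠ[nhds s] fun z => (z - 1)⁻¹ + Ez z := by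
    have ho : IsOpen {z : ℂ | 1 < z.re} := isOpen_lt continuous_const Complex.continuous_re
    filter_upwards [ho.mem_nhds hs] with z hz
    rw [zeta_eq_Ez z hz, one_div]
  refine HasDerivAt.congr_of_eventuallyEq ?_ e
  have d1 : HasDerivAt (fun z : ℂ => (z - 1)⁻¹) (-1 / (s - 1) ^ 2) s :=
    ((hasDerivAt_id s).sub_const 1).inv h2
  have d2 : HasDerivAt Ez (deriv Ez s) s :=
    (Ez_WB.1.differentiableAt (isOpen_re_pos.mem_nhds (show 0 < s.re by linarith))).hasDerivAt
  exact d1.add d2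

lemma norm_sub_one_ge (s : ℂ) (ht : 1 ≤ |s.im|) : 1 ≤ ‖s - 1‖ := by
  have := Complex.abs_im_le_norm (s - 1)
  simp at this
  linarith

lemma fz_inv_TB : TB (fun s => (fz s)⁻¹) := by
  intro ε hε
  set η := ε / 4 with hη
  have hη0 : 0 < η := by positivity
  obtain ⟨K0, hK0⟩ := fz_inv_small
  obtain ⟨K, hK, hE⟩ := Ez_WB.tb η hη0
  obtain ⟨K', hK', hE'⟩ := Ez_WB.deriv.tb η hη0
  set K1 := 1 + K with hK1
  set K2 := 1 + K' with hK2
  set K3 := 1 + 2 * K with hK3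
  have hT1 : ∀ t : ℝ, (1 : ℝ) ≤ (1 + |t|) ^ η := fun t =>
    Real.one_le_rpow (by linarith [abs_nonneg t]) hη0.le
  have hz : ∀ s : ℂ, 1 < s.re → s.re < 3 → 1 ≤ |s.im| → ‖riemannZeta s‖ ≤ K1 * (1 + |s.im|) ^ η := by
    intro s h1 h3 ht
    have hn := norm_sub_one_ge s ht
    rw [zeta_eq_Ez s h1]
    have a1 : ‖1 / (s - 1)‖ ≤ 1 := by
      rw [norm_div, norm_one]; exact (div_le_one (by linarith)).2 hn
    have := norm_add_le (1 / (s - 1)) (Ez s)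
    have := hE s h1 h3
    have := hT1 s.im
    rw [hK1]; linarith
  have hz' : ∀ s : ℂ, 1 < s.re → s.re < 3 → 1 ≤ |s.im| →
      ‖-1 / (s - 1) ^ 2 + deriv Ez s‖ ≤ K2 * (1 + |s.im|) ^ η := by
    intro s h1 h3 ht
    have hn := norm_sub_one_ge s ht
    have a1 : ‖-1 / (s - 1) ^ 2‖ ≤ 1 := by
      rw [norm_div, norm_neg, norm_one, norm_pow]
      exact (div_le_one (by positivity)).2 (one_le_pow₀ hn)
    have := norm_add_le (-1 / (s - 1) ^ 2) (deriv Ez s)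
    have := hE' s h1 h3
    have := hT1 s.im
    rw [hK2]; linarith
  have hzr : ∀ σ : ℝ, 1 < σ → σ < 3 → ‖riemannZeta σ‖ ≤ K3 / (σ - 1) := by
    intro σ h1 h3
    rw [zeta_eq_Ez σ (by simpa using h1)]
    have a0 := hE σ (by simpa using h1) (by simpa using h3)
    simp at a0
    have a1 : ‖1 / ((σ : ℂ) - 1)‖ = 1 / (σ - 1) := by
      rw [norm_div, norm_one]
      have : ((σ : ℂ) - 1) = ((σ - 1 : ℝ) : ℂ) := by push_cast; ring
      rw [this, Complex.norm_real, Real.norm_of_nonneg (by linarith)]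
    have := norm_add_le (1 / ((σ : ℂ) - 1)) (Ez σ)
    have h4 : K ≤ 2 * K / (σ - 1) := by
      rw [le_div_iff₀ (by linarith)]; nlinarith
    have : K3 / (σ - 1) = 1 / (σ - 1) + 2 * K / (σ - 1) := by rw [hK3]; ring
    linarith
  -- lower bound from 3-4-1
  set c : ℝ := 1 / (K3 ^ 3 * (K1 * 2 ^ η)) with hc
  have hc0 : 0 < c := by positivity
  have hlow : ∀ s : ℂ, 1 < s.re → s.re < 3 → 1 ≤ |s.im| →
      c * (s.re - 1) ^ 3 ≤ ‖riemannZeta s‖ ^ 4 * (1 + |s.im|) ^ η := by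
    intro s h1 h3 ht
    have h := three_four_one s.re s.im h1
    rw [Complex.re_add_im] at h
    have b1 := hzr s.re h1 h3
    have b2 := hz (s.re + (2 * s.im : ℝ) * Complex.I) (by simpa using h1) (by simpa using h3)
      (by simp [abs_mul]; linarith)
    have b3 : (1 + |((s.re : ℂ) + (2 * s.im : ℝ) * Complex.I).im|) ^ η ≤ 2 ^ η * (1 + |s.im|) ^ η := by
      rw [← Real.mul_rpow (by norm_num) (by positivity)]
      gcongr
      simp [abs_mul]; linarith
    have hs1 : 0 < s.re - 1 := by linarith
    have : 1 ≤ (K3 / (s.re - 1)) ^ 3 * ‖riemannZeta s‖ ^ 4 * (K1 * (2 ^ η * (1 + |s.im|) ^ η)) := by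
      refine h.trans ?_
      gcongr
      exact b2.trans (by gcongr)
    rw [hc, div_mul_eq_mul_div, one_mul, div_le_iff₀ (by positivity)]
    calc (s.re - 1) ^ 3 = (s.re - 1) ^ 3 * 1 := by ring
      _ ≤ (s.re - 1) ^ 3 * ((K3 / (s.re - 1)) ^ 3 * ‖riemannZeta s‖ ^ 4 *
            (K1 * (2 ^ η * (1 + |s.im|) ^ η))) := mul_le_mul_of_nonneg_left this (by positivity)
      _ = _ := by field_simp
  set a : ℝ := min 1 (c / (16 * K2 ^ 4)) with ha
  have hK2p : 0 < K2 := by positivity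
  have ha0 : 0 < a := lt_min one_pos (by positivity)
  have ha1 : a ≤ 1 := min_le_left _ _
  have hac : 16 * K2 ^ 4 * a ≤ c := by
    have : a ≤ c / (16 * K2 ^ 4) := min_le_right _ _
    rw [le_div_iff₀ (by positivity)] at this
    linarith
  -- conclusion for zeta
  have hfin : ∀ s : ℂ, 1 < s.re → s.re < 3 → 1 ≤ |s.im| →
      a * K2 * (1 + |s.im|) ^ (-ε) ≤ ‖riemannZeta s‖ := by
    intro s h1 h3 ht
    set T := 1 + |s.im| with hT
    have hTp : 0 < T := by positivity
    have hTge : 1 ≤ T := by linarith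
    set y := T ^ (-η) with hy
    have hy0 : 0 < y := by positivity
    have hy1 : y ≤ 1 := Real.rpow_le_one_of_one_le_of_nonpos hTge (by linarith)
    have hyT : y * T ^ η = 1 := by rw [hy, ← Real.rpow_add hTp]; simp
    have hye : T ^ (-ε) = y ^ 4 := by
      rw [hy, ← Real.rpow_natCast, ← Real.rpow_mul hTp.le]; congr 1; rw [hη]; push_cast; ring
    rw [hye]
    -- bound at points right of σ0
    have key : ∀ z : ℂ, 1 + a * y ^ 5 ≤ z.re → z.re < 3 → z.im = s.im →
        2 * (a * K2 * y ^ 4) ≤ ‖riemannZeta z‖ := by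
      intro z hz1 hz3 hzi
      have hp : 0 < a * y ^ 5 := by positivity
      have h := hlow z (by linarith) hz3 (by rw [hzi]; exact ht)
      rw [hzi, ← hT] at h
      have h' : (2 * (a * K2 * y ^ 4)) ^ 4 ≤ ‖riemannZeta z‖ ^ 4 := by
        calc (2 * (a * K2 * y ^ 4)) ^ 4 = (16 * K2 ^ 4 * a) * (a ^ 3 * y ^ 16) := by ring
          _ ≤ c * (a ^ 3 * y ^ 16) := by gcongr
          _ = (c * (a * y ^ 5) ^ 3) * y := by ring
          _ ≤ (c * (z.re - 1) ^ 3) * y := by gcongr; linarith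
          _ ≤ (‖riemannZeta z‖ ^ 4 * T ^ η) * y := by gcongr
          _ = ‖riemannZeta z‖ ^ 4 := by rw [mul_assoc, mul_comm (T ^ η), hyT, mul_one]
      exact le_of_pow_le_pow_left₀ (by norm_num) (norm_nonneg _) h'
    have hpos : 0 ≤ a * K2 * y ^ 4 := by positivity
    by_cases hcase : 1 + a * y ^ 5 ≤ s.re
    · have := key s hcase h3 rfl
      linarith
    · push Not at hcase
      set z : ℂ := ⟨1 + a * y ^ 5, s.im⟩ with hz
      have hay : a * y ^ 5 ≤ 1 := by
        calc a * y ^ 5 ≤ 1 * 1 ^ 5 := by gcongr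
          _ = 1 := by norm_num
      have k1 := key z le_rfl (by simp [hz]; linarith) rfl
      have hseg : segment ℝ s z ⊆ {w : ℂ | (1 < w.re ∧ w.re < 3) ∧ w.im = s.im} := by
        have hconv : Convex ℝ {w : ℂ | (1 < w.re ∧ w.re < 3) ∧ w.im = s.im} := by
          exact ((convex_halfSpace_re_gt 1).inter (convex_halfSpace_re_lt 3)).inter
            ((convex_halfSpace_im_le s.im).inter (convex_halfSpace_im_ge s.im)) |> fun h => by
              convert h using 1
              ext w
              simp only [Set.mem_inter_iff, Set.mem_ofPred_eq]
              constructor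
              · rintro ⟨h, h'⟩; exact ⟨h, h'.le, h'.ge⟩
              · rintro ⟨h, h'⟩; exact ⟨h, le_antisymm h'.1 h'.2⟩
        refine hconv.segment_subset ⟨⟨h1, h3⟩, rfl⟩ ⟨⟨?_, ?_⟩, rfl⟩
        · simp [hz]; positivity
        · simp [hz]; linarith
      have hmv := (convex_segment s z).norm_image_sub_le_of_norm_hasDerivWithin_le
        (f := riemannZeta) (f' := fun w => -1 / (w - 1) ^ 2 + deriv Ez w) (C := K2 * T ^ η)
        (fun w hw => (zeta_deriv_eq w (hseg hw).1.1).hasDerivWithinAt)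
        (fun w hw => by
          have := hz' w (hseg hw).1.1 (hseg hw).1.2 (by rw [(hseg hw).2]; exact ht)
          rwa [(hseg hw).2] at this) (left_mem_segment ℝ s z) (right_mem_segment ℝ s z)
      have hd : ‖z - s‖ ≤ a * y ^ 5 := by
        have e : z - s = ((1 + a * y ^ 5 - s.re : ℝ) : ℂ) := by
          apply Complex.ext
          · rw [Complex.sub_re, Complex.ofReal_re]
          · rw [Complex.sub_im, Complex.ofReal_im]; exact sub_self _
        rw [e, Complex.norm_real, Real.norm_of_nonneg (by linarith)]
        linarith
      have hmv' : ‖riemannZeta z - riemannZeta s‖ ≤ a * K2 * y ^ 4 := by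
        calc _ ≤ _ := hmv
          _ ≤ K2 * T ^ η * (a * y ^ 5) := by gcongr
          _ = a * K2 * y ^ 4 * (y * T ^ η) := by ring
          _ = _ := by rw [hyT, mul_one]
      have := norm_sub_norm_le (riemannZeta z) (riemannZeta s)
      linarith
  refine ⟨max |K0| (2 / (a * K2)), by positivity, fun s h1 h3 => ?_⟩
  have hTε : (1 : ℝ) ≤ (1 + |s.im|) ^ ε := Real.one_le_rpow (by linarith [abs_nonneg s.im]) hε.le
  by_cases ht : |s.im| ≤ 1
  · calc _ ≤ K0 := hK0 s h1.le h3.le ht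
      _ ≤ max |K0| (2 / (a * K2)) * 1 := by
        rw [mul_one]; exact (le_abs_self _).trans (le_max_left _ _)
      _ ≤ _ := by gcongr
  · push Not at ht
    have h0 : s ≠ 0 := fun h => by simp [h] at h1; linarith
    have hn := norm_sub_one_ge s ht.le
    have hf := hfin s h1 h3 ht.le
    have hTp : 0 < 1 + |s.im| := by positivity
    have hzp : 0 < a * K2 * (1 + |s.im|) ^ (-ε) := by positivity
    show ‖(fz s)⁻¹‖ ≤ _
    rw [fz_eq s h1, mul_inv, inv_div, norm_mul, norm_div, norm_inv]
    have b1 : ‖s‖ / ‖s - 1‖ ≤ 2 := by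
      rw [div_le_iff₀ (by linarith)]
      have : ‖s‖ ≤ ‖s - 1‖ + ‖(1 : ℂ)‖ := by
        have := norm_add_le (s - 1) 1
        simpa using this
      rw [norm_one] at this
      linarith
    calc _ ≤ 2 * (a * K2 * (1 + |s.im|) ^ (-ε))⁻¹ := by gcongr
      _ = 2 / (a * K2) * (1 + |s.im|) ^ ε := by
        rw [Real.rpow_neg hTp.le, mul_inv, inv_inv]; ring
      _ ≤ _ := by gcongr; exact le_max_right _ _

/-- `1/ζ` -/
lemma inv_zeta_TBn (k : ℕ) : TBn k (fun s => (1 + -s⁻¹) * (fz s)⁻¹) :=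
  ((TBn.const k 1).add (TBn.inv_id k).neg).mul
    ((fz_TBn k).inv (fun s h _ => fz_ne_zero s h.le) fz_inv_TB)

lemma inv_zeta_eq (s : ℂ) (hs : 1 < s.re) :
    (1 + -s⁻¹) * (fz s)⁻¹ = (riemannZeta s)⁻¹ := by
  have h1 : s ≠ 1 := fun h => by simp [h] at hs
  have h2 := sub_ne_zero.2 h1
  have h0 : s ≠ 0 := fun h => by simp [h] at hs; linarith
  have hz := riemannZeta_ne_zero_of_one_le_re hs.le
  rw [fz_eq s hs]
  field_simp
  ring

noncomputable def fz' (s : ℂ) : ℂ := - (s⁻¹ * s⁻¹) + ((s⁻¹ * s⁻¹) * Ez s + (1 + -s⁻¹) * deriv Ez s)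

lemma fz'_TBn (k : ℕ) : TBn k fz' :=
  ((TBn.inv_id k).mul (TBn.inv_id k)).neg.add ((((TBn.inv_id k).mul (TBn.inv_id k)).mul (Ez_WB.tbn k)).add
   (((TBn.const k 1).add (TBn.inv_id k).neg).mul (Ez_WB.deriv.tbn k)))

/-- `-ζ'/ζ - ζ` -/
lemma psi_TBn (k : ℕ) : TBn k (fun s => -s⁻¹ + (-(fz' s * (fz s)⁻¹) + - Ez s)) :=
  (TBn.inv_id k).neg.add
    (((fz'_TBn k).mul ((fz_TBn k).inv (fun s h _ => fz_ne_zero s h.le) fz_inv_TB)).neg.add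
      (Ez_WB.tbn k).neg)

lemma psi_eq (s : ℂ) (hs : 1 < s.re) :
    -s⁻¹ + (-(fz' s * (fz s)⁻¹) + - Ez s) = -deriv riemannZeta s / riemannZeta s - riemannZeta s := by
  have h1 : s ≠ 1 := fun h => by simp [h] at hs
  have h2 := sub_ne_zero.2 h1
  have h0 : s ≠ 0 := fun h => by simp [h] at hs; linarith
  have hz := riemannZeta_ne_zero_of_one_le_re hs.le
  rw [(zeta_deriv_eq s hs).deriv, fz_eq s hs]
  have hE : Ez s = riemannZeta s - 1 / (s - 1) := by rw [zeta_eq_Ez s hs]; ring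
  rw [fz', hE]
  field_simp
  ring

open MeasureTheory in
lemma ker_intOn (σ : ℝ) (hσ : 0 < σ) :
    IntegrableOn (fun x : ℝ => x * Real.exp (-σ * x)) (Set.Ioi 0) := by
  have := integrableOn_rpow_mul_exp_neg_mul_rpow (p := 1) (s := 1) (b := σ) (by norm_num) one_pos hσ
  simpa using this

noncomputable def sp (σ ξ : ℝ) : ℂ := (σ : ℂ) + (2 * Real.pi * ξ : ℝ) * Complex.I

lemma sp_re (σ ξ : ℝ) : (sp σ ξ).re = σ := by simp [sp]
lemma sp_im (σ ξ : ℝ) : (sp σ ξ).im = 2 * Real.pi * ξ := by simp [sp]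
lemma sp_ne (σ ξ : ℝ) (h : 0 < σ) : sp σ ξ ≠ 0 := fun h0 => by
  have := sp_re σ ξ; rw [h0] at this; simp at this; linarith

lemma sp_cont (σ : ℝ) : Continuous (sp σ) := by unfold sp; fun_prop

open MeasureTheory in
lemma ker_int (σ : ℝ) (hσ : 0 < σ) (r : ℂ) (hr : r.re = σ) :
    ∫ t in Set.Ioi (0:ℝ), (t : ℂ) * Complex.exp (-r * t) = 1 / r ^ 2 := by
  have hr0 : r ≠ 0 := fun h => by rw [h] at hr; simp at hr; linarith
  have hd : ∀ x ∈ Set.Ici (0:ℝ), HasDerivAt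
      (fun t : ℝ => -((t : ℂ) / r + 1 / r ^ 2) * Complex.exp (-r * t))
      ((x : ℂ) * Complex.exp (-r * x)) x := by
    intro x _
    have h1 : HasDerivAt (fun t : ℝ => (t : ℂ)) 1 x := Complex.ofRealCLM.hasDerivAt
    have h2 : HasDerivAt (fun t : ℝ => -r * (t:ℂ)) (-r * 1) x := h1.const_mul (-r)
    have h3 := h2.cexp
    have h4 := (((h1.div_const r).add_const (1 / r ^ 2)).neg).mul h3
    refine h4.congr_deriv ?_
    simp only [Pi.neg_apply]
    field_simp
    ring
  have hn : ∀ x : ℝ, ‖Complex.exp (-r * x)‖ = Real.exp (-σ * x) := by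
    intro x; rw [Complex.norm_exp]; simp [hr]
  have hint : IntegrableOn (fun x : ℝ => (x : ℂ) * Complex.exp (-r * x)) (Set.Ioi 0) := by
    refine (ker_intOn σ hσ).mono' (by fun_prop) ?_
    filter_upwards [ae_restrict_mem measurableSet_Ioi] with x hx
    rw [norm_mul, hn, Complex.norm_real, Real.norm_of_nonneg (le_of_lt hx)]
  have hlim : Tendsto (fun t : ℝ => -((t : ℂ) / r + 1 / r ^ 2) * Complex.exp (-r * t)) atTop (nhds 0) := by
    rw [tendsto_zero_iff_norm_tendsto_zero]
    have e1 := tendsto_rpow_mul_exp_neg_mul_atTop_nhds_zero 1 σ hσ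
    have e2 := tendsto_rpow_mul_exp_neg_mul_atTop_nhds_zero 0 σ hσ
    have e3 := (e1.const_mul (‖r‖⁻¹)).add (e2.const_mul (‖1 / r ^ 2‖))
    simp only [mul_zero, add_zero] at e3
    refine squeeze_zero' (Eventually.of_forall fun _ => norm_nonneg _) ?_ e3
    filter_upwards [eventually_ge_atTop (0:ℝ)] with t ht
    rw [norm_mul, hn, norm_neg]
    have : ‖(t : ℂ) / r + 1 / r ^ 2‖ ≤ t * ‖r‖⁻¹ + ‖1 / r ^ 2‖ := by
      refine (norm_add_le _ _).trans ?_
      rw [norm_div, Complex.norm_real, Real.norm_of_nonneg ht, div_eq_mul_inv]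
    calc _ ≤ (t * ‖r‖⁻¹ + ‖1 / r ^ 2‖) * Real.exp (-σ * t) := by gcongr
      _ = _ := by rw [Real.rpow_one, Real.rpow_zero]; ring
  rw [integral_Ioi_of_hasDerivAt_of_tendsto' hd hint hlim]
  simp

lemma sp_norm_sq (σ ξ : ℝ) (hσ : 1 ≤ σ) : (1 + |ξ|) ^ 2 ≤ 2 * ‖sp σ ξ‖ ^ 2 := by
  rw [Complex.sq_norm, Complex.normSq_apply, sp_re, sp_im]
  have hp := Real.pi_gt_three
  have h1 : |ξ| ^ 2 = ξ ^ 2 := sq_abs ξ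
  have h2 : ξ ^ 2 ≤ (2 * Real.pi * ξ) * (2 * Real.pi * ξ) := by
    have : 1 ≤ (2 * Real.pi) ^ 2 := by nlinarith
    nlinarith [sq_nonneg ξ]
  nlinarith [sq_nonneg (1 - |ξ|)]

lemma sp_im_le (σ ξ : ℝ) : 1 + |(sp σ ξ).im| ≤ 7 * (1 + |ξ|) := by
  rw [sp_im, abs_mul, abs_of_nonneg (by positivity)]
  have hp := Real.pi_lt_d2
  nlinarith [abs_nonneg ξ]

open MeasureTheory in
lemma sp_inv_integrable (σ : ℝ) (hσ : 1 ≤ σ) : Integrable (fun ξ => 1 / (sp σ ξ) ^ 2) := by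
  have h := integrable_one_add_norm (E := ℝ) (μ := volume) (r := 2) (by simp)
  refine (h.const_mul 2).mono' ?_ ?_
  · exact (Continuous.div continuous_const ((sp_cont σ).pow 2)
      (fun ξ => pow_ne_zero _ (sp_ne σ ξ (by linarith)))).aestronglyMeasurable
  · refine Eventually.of_forall fun ξ => ?_
    have h1 := sp_norm_sq σ ξ hσ
    have h0 : 0 < ‖sp σ ξ‖ := norm_pos_iff.2 (sp_ne σ ξ (by linarith))
    have hp : 0 < 1 + |ξ| := by positivity
    rw [norm_div, norm_one, norm_pow, Real.norm_eq_abs, Real.rpow_neg hp.le]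
    rw [show ((1 + |ξ|) ^ (2:ℝ)) = (1 + |ξ|) ^ 2 by norm_cast]
    rw [← div_eq_mul_inv, div_le_div_iff₀ (by positivity) (by positivity)]
    linarith

open MeasureTheory FourierTransform in
lemma perron_ker (σ y : ℝ) (hσ : 1 ≤ σ) :
    ∫ ξ : ℝ, Complex.exp (sp σ ξ * y) * (1 / (sp σ ξ) ^ 2) = ((max y 0 : ℝ) : ℂ) := by
  have hσ0 : 0 < σ := by linarith
  set f : ℝ → ℂ := fun t => ((max t 0 : ℝ) : ℂ) * Complex.exp (-σ * t) with hf
  have hfc : Continuous f := by rw [hf]; fun_prop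
  have hfi : f = Set.indicator (Set.Ioi 0) (fun t : ℝ => (t : ℂ) * Complex.exp (-σ * t)) := by
    ext t
    by_cases ht : 0 < t
    · rw [Set.indicator_of_mem (by exact ht)]; simp [hf, max_eq_left ht.le]
    · rw [Set.indicator_of_notMem (by exact ht)]; simp [hf, max_eq_right (not_lt.1 ht)]
  have hint : Integrable f := by
    rw [hfi, integrable_indicator_iff measurableSet_Ioi]
    refine (ker_intOn σ hσ0).mono' (by fun_prop) ?_
    filter_upwards [ae_restrict_mem measurableSet_Ioi] with x hx
    rw [norm_mul, Complex.norm_exp, Complex.norm_real, Real.norm_of_nonneg (le_of_lt hx)]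
    simp
  have hF : 𝓕 f = fun ξ => 1 / (sp σ ξ) ^ 2 := by
    ext ξ
    rw [Real.fourier_real_eq_integral_exp_smul, ← ker_int σ hσ0 (sp σ ξ) (sp_re σ ξ),
      ← integral_indicator measurableSet_Ioi]
    congr 1
    ext t
    rw [hfi]
    by_cases ht : t ∈ Set.Ioi (0:ℝ)
    · rw [Set.indicator_of_mem ht, Set.indicator_of_mem ht, smul_eq_mul, mul_left_comm, ← Complex.exp_add]
      congr 2
      simp only [sp]; push_cast; ring
    · rw [Set.indicator_of_notMem ht, Set.indicator_of_notMem ht, smul_zero]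
  have hinv := hfc.fourierInv_fourier_eq hint (by rw [hF]; exact sp_inv_integrable σ hσ)
  have h1 := congrFun hinv y
  rw [Real.fourierInv_eq', hF] at h1
  have h2 : ∀ ξ : ℝ, Complex.exp (sp σ ξ * y) * (1 / (sp σ ξ) ^ 2) =
      Complex.exp (σ * y) * (Complex.exp ((2 * Real.pi * inner ℝ ξ y : ℝ) * Complex.I) • (1 / (sp σ ξ) ^ 2)) := by
    intro ξ
    rw [smul_eq_mul, ← mul_assoc, ← Complex.exp_add]
    congr 2
    simp only [sp, RCLike.inner_apply, conj_trivial]; push_cast; ring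
  simp_rw [h2]
  rw [integral_const_mul, h1, hf]
  simp only
  rw [mul_left_comm, ← Complex.exp_add]
  simp

open MeasureTheory in
lemma perron_eq (b : ℕ → ℂ) (hb : LSeries.abscissaOfAbsConv b ≤ 1) (x σ : ℝ) (hx : 1 ≤ x) (hσ : 1 < σ) :
    ∫ ξ : ℝ, LSeries b (sp σ ξ) * (Complex.exp (sp σ ξ * Real.log x) * (1 / (sp σ ξ) ^ 2)) =
      ∑ n ∈ Icc 1 ⌊x⌋₊, b n * (Real.log (x / n) : ℂ) := by
  have hx0 : 0 < x := by linarith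
  set F : ℕ → ℝ → ℂ := fun n ξ => LSeries.term b (sp σ ξ) n *
    (Complex.exp (sp σ ξ * Real.log x) * (1 / (sp σ ξ) ^ 2)) with hF
  have hnorm : ∀ n ξ, ‖F n ξ‖ = ‖LSeries.term b σ n‖ * (Real.exp (σ * Real.log x)) * ‖1 / (sp σ ξ) ^ 2‖ := by
    intro n ξ
    simp only [hF]
    rw [norm_mul, norm_mul, LSeries.norm_term_eq, LSeries.norm_term_eq, sp_re, Complex.ofReal_re,
      Complex.norm_exp, ← mul_assoc]
    congr 3
    rw [Complex.re_mul_ofReal, sp_re]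
  have hFe : ∀ n : ℕ, n ≠ 0 → ∀ ξ, F n ξ =
      b n * (Complex.exp (sp σ ξ * (Real.log x - Real.log n : ℝ)) * (1 / (sp σ ξ) ^ 2)) := by
    intro n hn ξ
    simp only [hF]
    rw [LSeries.term_of_ne_zero hn, Complex.cpow_def_of_ne_zero (by exact_mod_cast hn), div_eq_mul_inv,
      ← Complex.exp_neg, mul_assoc, ← mul_assoc (Complex.exp _) (Complex.exp _), ← Complex.exp_add,
      ← Complex.natCast_log]
    congr 3
    push_cast
    ring_nf
  have hF0 : ∀ ξ, F 0 ξ = 0 := by intro ξ; simp [hF]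
  have hint : ∀ n, Integrable (F n) := by
    intro n
    have hm : AEStronglyMeasurable (F n) volume := by
      apply Continuous.aestronglyMeasurable
      rcases eq_or_ne n 0 with rfl | hn
      · rw [show F 0 = fun _ => 0 from funext hF0]; exact continuous_const
      · rw [show F n = _ from funext (hFe n hn)]
        have := sp_cont σ
        exact continuous_const.mul ((Complex.continuous_exp.comp (this.mul continuous_const)).mul
          (Continuous.div continuous_const (this.pow 2)
            (fun ξ => pow_ne_zero _ (sp_ne σ ξ (by linarith)))))
    refine ((sp_inv_integrable σ hσ.le).norm.const_mul
      (‖LSeries.term b σ n‖ * (Real.exp (σ * Real.log x)))).mono' hm ?_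
    exact Eventually.of_forall fun ξ => (hnorm n ξ).le
  have hsum0 : LSeriesSummable b σ := LSeriesSummable_of_abscissaOfAbsConv_lt_re
    (lt_of_le_of_lt hb (by simpa using (by exact_mod_cast hσ : ((1:ℝ):EReal) < (σ : EReal))))
  have hsum : Summable fun n => ∫ ξ, ‖F n ξ‖ := by
    simp_rw [hnorm]
    simp_rw [integral_const_mul]
    exact ((hsum0.norm).mul_right _).mul_right _
  have H := hasSum_integral_of_summable_integral_norm hint hsum
  have e1 : ∀ ξ, ∑' n, F n ξ = LSeries b (sp σ ξ) * (Complex.exp (sp σ ξ * Real.log x) * (1 / (sp σ ξ) ^ 2)) := by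
    intro ξ
    simp only [hF]
    rw [tsum_mul_right]; rfl
  simp_rw [e1] at H
  rw [← H.tsum_eq]
  have e2 : ∀ n : ℕ, n ≠ 0 → ∫ ξ, F n ξ = b n * ((max (Real.log x - Real.log n) 0 : ℝ) : ℂ) := by
    intro n hn
    simp_rw [hFe n hn]
    rw [integral_const_mul, perron_ker σ _ hσ.le]
  rw [tsum_eq_sum (s := Icc 1 ⌊x⌋₊)]
  · refine sum_congr rfl fun n hn => ?_
    rw [mem_Icc] at hn
    have hn0 : (0:ℝ) < n := by exact_mod_cast hn.1
    have hnx : (n : ℝ) ≤ x := (Nat.le_floor_iff hx0.le).1 hn.2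
    rw [e2 n (by omega), Real.log_div (by linarith) (by linarith), max_eq_left]
    have := Real.log_le_log hn0 hnx
    linarith
  · intro n hn
    rcases eq_or_ne n 0 with rfl | hn0
    · simp [hF0]
    · rw [e2 n hn0, max_eq_right]
      · simp
      · have : ¬ (n ≤ ⌊x⌋₊) := fun h => hn (mem_Icc.2 ⟨by omega, h⟩)
        have h2 : x < n := by
          rw [Nat.le_floor_iff hx0.le] at this; exact not_le.1 this
        have := Real.log_le_log hx0 h2.le
        linarith

open MeasureTheory in
lemma perron_bound (b : ℕ → ℂ) (hb : LSeries.abscissaOfAbsConv b ≤ 1) (hT : TB (LSeries b)) :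
    ∃ C : ℝ, 0 ≤ C ∧ ∀ x : ℝ, 1 ≤ x → ‖∑ n ∈ Icc 1 ⌊x⌋₊, b n * (Real.log (x / n) : ℂ)‖ ≤ C * x := by
  obtain ⟨K, hK, h⟩ := hT (1/2) (by norm_num)
  have hI := integrable_one_add_norm (E := ℝ) (μ := volume) (r := 3/2) (by norm_num)
  have hI0 : 0 ≤ ∫ ξ : ℝ, (1 + ‖ξ‖) ^ (-(3/2) : ℝ) := integral_nonneg fun ξ => by positivity
  refine ⟨(K * 7 ^ (1/2:ℝ) * 2 * Real.exp 1) * ∫ ξ : ℝ, (1 + ‖ξ‖) ^ (-(3/2) : ℝ), by positivity, fun x hx => ?_⟩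
  have hlx : 0 ≤ Real.log x := Real.log_nonneg hx
  set σ := 1 + 1 / (1 + Real.log x) with hσ
  have hσ1 : 1 < σ := by rw [hσ]; have : 0 < 1 / (1 + Real.log x) := by positivity
                         linarith
  have hσ3 : σ < 3 := by
    rw [hσ]
    have : 1 / (1 + Real.log x) ≤ 1 := by rw [div_le_one (by positivity)]; linarith
    linarith
  have hxσ : Real.exp (σ * Real.log x) ≤ Real.exp 1 * x := by
    rw [show Real.exp 1 * x = Real.exp (1 + Real.log x) by rw [Real.exp_add, Real.exp_log (by linarith)]]
    apply Real.exp_le_exp.2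
    have : 1 / (1 + Real.log x) * Real.log x ≤ 1 := by
      rw [div_mul_eq_mul_div, one_mul, div_le_one (by positivity)]; linarith
    rw [hσ]; linarith
  rw [← perron_eq b hb x σ hx hσ1]
  have key : ∀ ξ : ℝ, ‖LSeries b (sp σ ξ) * (Complex.exp (sp σ ξ * Real.log x) * (1 / (sp σ ξ) ^ 2))‖ ≤
      (K * 7 ^ (1/2:ℝ) * 2 * Real.exp 1 * x) * (1 + ‖ξ‖) ^ (-(3/2) : ℝ) := by
    intro ξ
    have h1 := h (sp σ ξ) (by rwa [sp_re]) (by rwa [sp_re])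
    have h2 : (1 + |(sp σ ξ).im|) ^ (1/2:ℝ) ≤ 7 ^ (1/2:ℝ) * (1 + |ξ|) ^ (1/2:ℝ) := by
      rw [← Real.mul_rpow (by norm_num) (by positivity)]
      exact Real.rpow_le_rpow (by positivity) (sp_im_le σ ξ) (by norm_num)
    have h3 := sp_norm_sq σ ξ hσ1.le
    have h0 : 0 < ‖sp σ ξ‖ := norm_pos_iff.2 (sp_ne σ ξ (by linarith))
    have hp : 0 < 1 + |ξ| := by positivity
    have h4 : ‖1 / (sp σ ξ) ^ 2‖ ≤ 2 * (1 + |ξ|) ^ (-2 : ℝ) := by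
      rw [norm_div, norm_one, norm_pow, Real.rpow_neg hp.le,
        show ((1 + |ξ|) ^ (2:ℝ)) = (1 + |ξ|) ^ 2 by norm_cast,
        ← div_eq_mul_inv, div_le_div_iff₀ (by positivity) (by positivity)]
      linarith
    have h5 : ‖Complex.exp (sp σ ξ * Real.log x)‖ ≤ Real.exp 1 * x := by
      rw [Complex.norm_exp, Complex.re_mul_ofReal, sp_re]; exact hxσ
    rw [norm_mul, norm_mul]
    calc _ ≤ (K * (7 ^ (1/2:ℝ) * (1 + |ξ|) ^ (1/2:ℝ))) * ((Real.exp 1 * x) * (2 * (1 + |ξ|) ^ (-2 : ℝ))) := by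
          gcongr
          exact h1.trans (by gcongr)
      _ = (K * 7 ^ (1/2:ℝ) * 2 * Real.exp 1 * x) * ((1 + |ξ|) ^ (1/2:ℝ) * (1 + |ξ|) ^ (-2 : ℝ)) := by ring
      _ = _ := by rw [← Real.rpow_add hp, Real.norm_eq_abs]; norm_num
  calc _ ≤ ∫ ξ : ℝ, (K * 7 ^ (1/2:ℝ) * 2 * Real.exp 1 * x) * (1 + ‖ξ‖) ^ (-(3/2) : ℝ) :=
        norm_integral_le_of_norm_le (hI.const_mul _) (Eventually.of_forall key)
    _ = _ := by rw [integral_const_mul]; ring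

lemma abel_var (w d : ℕ → ℝ) (P : ℝ) (a b : ℕ) (hab : a ≤ b)
    (h : ∀ m, a ≤ m → m ≤ b → |∑ n ∈ Icc a m, d n| ≤ P) :
    |∑ n ∈ Icc a b, w n * d n - w b * ∑ n ∈ Icc a b, d n| ≤ P * ∑ n ∈ Ico a b, |w (n + 1) - w n| := by
  induction b, hab using Nat.le_induction with
  | base => simp
  | succ b hab ih =>
    have ih' := ih (fun m h1 h2 => h m h1 (by omega))
    have hb := h b hab (by omega)
    rw [sum_Icc_succ_top (by omega), sum_Icc_succ_top (by omega), sum_Ico_succ_top hab]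
    have e : ∑ n ∈ Icc a b, w n * d n + w (b + 1) * d (b + 1) - w (b + 1) * (∑ n ∈ Icc a b, d n + d (b + 1))
      = (∑ n ∈ Icc a b, w n * d n - w b * ∑ n ∈ Icc a b, d n) - (w (b + 1) - w b) * ∑ n ∈ Icc a b, d n := by ring
    rw [e, mul_add]
    refine (abs_sub _ _).trans ?_
    rw [abs_mul]
    have := mul_le_mul_of_nonneg_left hb (abs_nonneg (w (b + 1) - w b))
    linarith

lemma abel_anti (w d : ℕ → ℝ) (P : ℝ) (a b : ℕ) (hab : a ≤ b)
    (h : ∀ m, a ≤ m → m ≤ b → |∑ n ∈ Icc a m, d n| ≤ P)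
    (hw : ∀ n, a ≤ n → n < b → w (n + 1) ≤ w n) (hb : 0 ≤ w b) :
    |∑ n ∈ Icc a b, w n * d n| ≤ w a * P := by
  have h1 := abel_var w d P a b hab h
  have h2 : ∑ n ∈ Ico a b, |w (n + 1) - w n| = w a - w b := by
    have : ∑ n ∈ Ico a b, |w (n + 1) - w n| = ∑ n ∈ Ico a b, -(w (n + 1) - w n) := by
      refine sum_congr rfl fun n hn => ?_
      rw [mem_Ico] at hn
      rw [abs_of_nonpos]; linarith [hw n hn.1 hn.2]
    rw [this, sum_neg_distrib, sum_Ico_sub _ hab]; ring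
  rw [h2] at h1
  have h3 := abs_sub_abs_le_abs_sub (∑ n ∈ Icc a b, w n * d n) (w b * ∑ n ∈ Icc a b, d n)
  rw [abs_mul, abs_of_nonneg hb] at h3
  have := mul_le_mul_of_nonneg_left (h b hab le_rfl) hb
  nlinarith

lemma abel_mono (w d : ℕ → ℝ) (P : ℝ) (a b : ℕ) (hab : a ≤ b)
    (h : ∀ m, a ≤ m → m ≤ b → |∑ n ∈ Icc a m, d n| ≤ P)
    (hw : ∀ n, a ≤ n → n < b → w n ≤ w (n + 1)) (ha : 0 ≤ w a) :
    |∑ n ∈ Icc a b, w n * d n| ≤ 2 * w b * P := by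
  have h1 := abel_var w d P a b hab h
  have h2 : ∑ n ∈ Ico a b, |w (n + 1) - w n| = w b - w a := by
    have : ∑ n ∈ Ico a b, |w (n + 1) - w n| = ∑ n ∈ Ico a b, (w (n + 1) - w n) := by
      refine sum_congr rfl fun n hn => ?_
      rw [mem_Ico] at hn
      rw [abs_of_nonneg]; linarith [hw n hn.1 hn.2]
    rw [this, sum_Ico_sub _ hab]
  rw [h2] at h1
  have hb : 0 ≤ w b := by
    have : 0 ≤ ∑ n ∈ Ico a b, |w (n + 1) - w n| := sum_nonneg fun _ _ => abs_nonneg _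
    linarith
  have h3 := abs_sub_abs_le_abs_sub (∑ n ∈ Icc a b, w n * d n) (w b * ∑ n ∈ Icc a b, d n)
  rw [abs_mul, abs_of_nonneg hb] at h3
  have := mul_le_mul_of_nonneg_left (h b hab le_rfl) hb
  have hP : 0 ≤ P := (abs_nonneg _).trans (h b hab le_rfl)
  nlinarith

lemma logpow_le (m : ℕ) (ε : ℝ) (hε : 0 < ε) :
    ∃ M : ℝ, 0 < M ∧ ∀ x : ℝ, 1 ≤ x → (1 + Real.log x) ^ m ≤ M * x ^ ε := by
  set e := ε / (m + 1) with he
  have he0 : 0 < e := by positivity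
  refine ⟨(1 + 1 / e) ^ m, by positivity, fun x hx => ?_⟩
  have h1 := Real.log_le_rpow_div (by linarith : 0 ≤ x) he0
  have h2 : 1 ≤ x ^ e := Real.one_le_rpow hx he0.le
  have h3 : 1 + Real.log x ≤ (1 + 1 / e) * x ^ e := by
    have : (1 + 1 / e) * x ^ e = x ^ e + x ^ e / e := by ring
    linarith
  have h0 : 0 ≤ Real.log x := Real.log_nonneg hx
  calc (1 + Real.log x) ^ m ≤ ((1 + 1 / e) * x ^ e) ^ m := by gcongr
    _ = (1 + 1 / e) ^ m * x ^ (e * m) := by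
      rw [mul_pow, ← Real.rpow_natCast (x ^ e), ← Real.rpow_mul (by linarith)]
    _ ≤ _ := by
      gcongr
      rw [he, div_mul_eq_mul_div, div_le_iff₀ (by positivity)]; nlinarith

lemma logpow_le_self (m : ℕ) : ∃ M : ℝ, 0 < M ∧ ∀ x : ℝ, 1 ≤ x → (1 + Real.log x) ^ m ≤ M * x := by
  obtain ⟨M, h0, h⟩ := logpow_le m 1 one_pos
  exact ⟨M, h0, fun x hx => by simpa using h x hx⟩

lemma mem_Icc_floor {x : ℝ} (hx : 0 ≤ x) {n : ℕ} (h : n ∈ Icc 1 ⌊x⌋₊) : (1:ℝ) ≤ n ∧ (n:ℝ) ≤ x := by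
  rw [mem_Icc] at h
  exact ⟨by exact_mod_cast h.1, (Nat.le_floor_iff hx).1 h.2⟩

lemma desmooth (c : ℕ → ℝ) (A : ℝ) (hA0 : 0 ≤ A) (hA : ∀ n : ℕ, 1 ≤ n → |c n| ≤ A * (1 + Real.log n))
    (k j : ℕ) (hkj : k + 1 = 2 * j) (C : ℝ) (hC0 : 0 ≤ C)
    (hC : ∀ x : ℝ, 1 ≤ x → |∑ n ∈ Icc 1 ⌊x⌋₊, c n * Real.log n ^ k * Real.log (x / n)| ≤ C * x) :
    ∃ C' : ℝ, 0 ≤ C' ∧ ∀ x : ℝ, 1 ≤ x → |∑ n ∈ Icc 1 ⌊x⌋₊, c n * Real.log n ^ k| ≤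
      C' * x * (1 + Real.log x) ^ j := by
  obtain ⟨M, hM0, hM⟩ := logpow_le_self (k + 1)
  refine ⟨4 * C + 2 * A * 2 ^ (k + 1) + A * 2 ^ (k + 1) * M, by positivity, fun x hx => ?_⟩
  have hx0 : 0 < x := by linarith
  have hlx : 0 ≤ Real.log x := Real.log_nonneg hx
  set L := 1 + Real.log x with hL
  have hL1 : 1 ≤ L := by linarith
  set δ := (L ^ j)⁻¹ with hδ
  have hδ0 : 0 < δ := by positivity
  have hδ1 : δ ≤ 1 := inv_le_one_of_one_le₀ (one_le_pow₀ hL1)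
  have hδL : δ * L ^ j = 1 := inv_mul_cancel₀ (by positivity)
  set y := x * Real.exp δ with hy
  have he1 : 1 ≤ Real.exp δ := Real.one_le_exp hδ0.le
  have he2 : Real.exp δ ≤ 1 + 2 * δ := by
    have := Real.abs_exp_sub_one_le (x := δ) (by rw [abs_of_pos hδ0]; exact hδ1)
    rw [abs_of_pos hδ0] at this
    linarith [le_abs_self (Real.exp δ - 1)]
  have hxy : x ≤ y := by rw [hy]; nlinarith
  have hy3 : y ≤ 3 * x := by rw [hy]; nlinarith
  have hfl : ⌊x⌋₊ ≤ ⌊y⌋₊ := Nat.floor_mono hxy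
  have hly : Real.log y = Real.log x + δ := by
    rw [hy, Real.log_mul (by linarith) (by positivity), Real.log_exp]
  set b : ℕ → ℝ := fun n => c n * Real.log n ^ k with hb
  have split : ∑ n ∈ Icc 1 ⌊y⌋₊, b n * Real.log (y / n) =
      ∑ n ∈ Icc 1 ⌊x⌋₊, b n * Real.log (x / n) + δ * ∑ n ∈ Icc 1 ⌊x⌋₊, b n
        + ∑ n ∈ Ioc ⌊x⌋₊ ⌊y⌋₊, b n * Real.log (y / n) := by
    rw [mul_sum, ← sum_add_distrib]
    have hd : Icc 1 ⌊y⌋₊ = Icc 1 ⌊x⌋₊ ∪ Ioc ⌊x⌋₊ ⌊y⌋₊ := by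
      ext n; simp only [mem_union, mem_Icc, mem_Ioc]; omega
    rw [hd, sum_union]
    · congr 1
      refine sum_congr rfl fun n hn => ?_
      have hn' := mem_Icc_floor hx0.le hn
      rw [Real.log_div (by linarith) (by linarith), Real.log_div (by linarith) (by linarith), hly]
      ring
    · rw [Finset.disjoint_left]; intro n; simp only [mem_Icc, mem_Ioc]; omega
  have tail : |∑ n ∈ Ioc ⌊x⌋₊ ⌊y⌋₊, b n * Real.log (y / n)| ≤
      (2 * δ * x + 1) * (A * (2 * L) ^ (k + 1) * δ) := by
    have hterm : ∀ n ∈ Ioc ⌊x⌋₊ ⌊y⌋₊, |b n * Real.log (y / n)| ≤ A * (2 * L) ^ (k + 1) * δ := by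
      intro n hn
      rw [mem_Ioc] at hn
      have hnx : x < n := (Nat.floor_lt hx0.le).1 hn.1
      have hny : (n : ℝ) ≤ y := (Nat.le_floor_iff (by linarith)).1 hn.2
      have hn0 : (0:ℝ) < n := by linarith
      have hln0 : 0 ≤ Real.log n := Real.log_nonneg (by linarith)
      have l1 : Real.log n ≤ Real.log x + δ := by rw [← hly]; exact Real.log_le_log hn0 hny
      have l2 : Real.log x ≤ Real.log n := Real.log_le_log hx0 hnx.le
      have l3 : Real.log (y / n) = Real.log x + δ - Real.log n := by
        rw [Real.log_div (by linarith) (by linarith), hly]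
      have hn1 : 1 ≤ n := by exact_mod_cast hn0
      rw [abs_mul, l3, abs_of_nonneg (by linarith : 0 ≤ Real.log x + δ - Real.log n), hb]
      simp only
      rw [abs_mul, abs_of_nonneg (pow_nonneg hln0 k)]
      calc _ ≤ A * (1 + Real.log n) * Real.log n ^ k * δ := by
            gcongr
            · exact hA n hn1
            · linarith
        _ ≤ A * (2 * L) * (2 * L) ^ k * δ := by gcongr <;> linarith
        _ = _ := by ring
    refine (abs_sum_le_sum_abs _ _).trans ((sum_le_card_nsmul _ _ _ hterm).trans ?_)
    rw [nsmul_eq_mul, Nat.card_Ioc]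
    gcongr
    rw [Nat.cast_sub hfl]
    have f1 := Nat.floor_le (by linarith : 0 ≤ y)
    have f2 := Nat.lt_floor_add_one x
    have : y ≤ x + 2 * δ * x := by rw [hy]; nlinarith
    linarith
  have a1 := hC x hx
  have a2 := hC y (hx.trans hxy)
  change |∑ n ∈ Icc 1 ⌊x⌋₊, b n * Real.log (x / n)| ≤ C * x at a1
  change |∑ n ∈ Icc 1 ⌊y⌋₊, b n * Real.log (y / n)| ≤ C * y at a2
  change |∑ n ∈ Icc 1 ⌊x⌋₊, b n| ≤ _
  set D := ∑ n ∈ Icc 1 ⌊x⌋₊, b n with hD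
  have hmain : δ * |D| ≤ 4 * C * x + (2 * δ * x + 1) * (A * (2 * L) ^ (k + 1) * δ) := by
    have e : δ * D = ∑ n ∈ Icc 1 ⌊y⌋₊, b n * Real.log (y / n) - ∑ n ∈ Icc 1 ⌊x⌋₊, b n * Real.log (x / n)
        - ∑ n ∈ Ioc ⌊x⌋₊ ⌊y⌋₊, b n * Real.log (y / n) := by rw [split]; ring
    have : |δ * D| = δ * |D| := by rw [abs_mul, abs_of_pos hδ0]
    rw [← this, e]
    refine (abs_sub _ _).trans ?_
    have := abs_sub (∑ n ∈ Icc 1 ⌊y⌋₊, b n * Real.log (y / n)) (∑ n ∈ Icc 1 ⌊x⌋₊, b n * Real.log (x / n))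
    nlinarith
  have hfin : |D| ≤ 4 * C * x * L ^ j + (2 * δ * x + 1) * (A * (2 * L) ^ (k + 1)) := by
    have := mul_le_mul_of_nonneg_left hmain (by positivity : 0 ≤ L ^ j)
    calc |D| = L ^ j * (δ * |D|) := by rw [← mul_assoc, mul_comm (L ^ j), hδL, one_mul]
      _ ≤ _ := this
      _ = 4 * C * x * L ^ j + (2 * δ * x + 1) * (A * (2 * L) ^ (k + 1)) * (δ * L ^ j) := by ring
      _ = _ := by rw [hδL, mul_one]
  refine hfin.trans ?_
  have hLk : L ^ (k + 1) = L ^ j * L ^ j := by rw [hkj, two_mul, pow_add]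
  have hLM := hM x hx
  have hLj : 1 ≤ L ^ j := one_le_pow₀ hL1
  have e : (2 * δ * x + 1) * (A * (2 * L) ^ (k + 1)) =
      2 * A * 2 ^ (k + 1) * x * L ^ j * (δ * L ^ j) + A * 2 ^ (k + 1) * L ^ (k + 1) := by
    rw [mul_pow, hLk]; ring
  rw [e, hδL]
  have : A * 2 ^ (k + 1) * L ^ (k + 1) ≤ A * 2 ^ (k + 1) * (M * x) * L ^ j := by
    calc _ ≤ A * 2 ^ (k + 1) * (M * x) := by gcongr
      _ ≤ _ := le_mul_of_one_le_right (by positivity) hLj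
  nlinarith

lemma transfer (c : ℕ → ℝ) (A : ℝ) (hA0 : 0 ≤ A) (hA : ∀ n : ℕ, 1 ≤ n → |c n| ≤ A * (1 + Real.log n))
    (hC : ∀ k : ℕ, ∃ C : ℝ, 0 ≤ C ∧ ∀ x : ℝ, 1 ≤ x →
      |∑ n ∈ Icc 1 ⌊x⌋₊, c n * Real.log n ^ k * Real.log (x / n)| ≤ C * x) (B : ℕ) :
    ∃ C : ℝ, 0 ≤ C ∧ ∀ x : ℝ, 1 ≤ x → |∑ n ∈ Icc 1 ⌊x⌋₊, c n| ≤ C * x / (1 + Real.log x) ^ B := by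
  set k := 2 * B + 1 with hk
  obtain ⟨C0, hC00, hC0⟩ := hC k
  obtain ⟨C, hC1, hD⟩ := desmooth c A hA0 hA k (B + 1) (by omega) C0 hC00 hC0
  obtain ⟨M, hM0, hM⟩ := logpow_le (B + 1) (1/2) (by norm_num)
  -- trivial bound
  have triv : ∀ x : ℝ, 1 ≤ x → ∀ y : ℝ, 1 ≤ y → y ≤ x → |∑ n ∈ Icc 1 ⌊y⌋₊, c n| ≤ y * (A * (1 + Real.log x)) := by
    intro x hx y hy1 hyx
    have hlx : 0 ≤ Real.log x := Real.log_nonneg hx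
    have : ∀ n ∈ Icc 1 ⌊y⌋₊, |c n| ≤ A * (1 + Real.log x) := by
      intro n hn
      have hn' := mem_Icc_floor (by linarith) hn
      refine (hA n (mem_Icc.1 hn).1).trans ?_
      have := Real.log_le_log (by linarith) (hn'.2.trans hyx)
      gcongr
    refine (abs_sum_le_sum_abs _ _).trans ((sum_le_card_nsmul _ _ _ this).trans ?_)
    rw [nsmul_eq_mul, Nat.card_Icc]
    gcongr
    simp
    exact Nat.floor_le (by linarith)
  refine ⟨A * 2 ^ (B + 1) + A * M + 4 ^ k * (2 * C), by positivity, fun x hx => ?_⟩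
  have hx0 : 0 < x := by linarith
  have hlx : 0 ≤ Real.log x := Real.log_nonneg hx
  have hMx := hM x hx
  set L := 1 + Real.log x with hL
  have hL1 : 1 ≤ L := by linarith
  have hLp : 0 < L ^ B := by positivity
  rw [le_div_iff₀ hLp]
  by_cases hxe : Real.log x < 1
  · have := triv x hx x hx le_rfl
    calc _ ≤ (x * (A * L)) * L ^ B := by gcongr
      _ = A * L ^ (B + 1) * x := by ring
      _ ≤ A * 2 ^ (B + 1) * x := by gcongr; linarith
      _ ≤ _ := by gcongr; have : 0 ≤ A * M + 4 ^ k * (2 * C) := by positivity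
                  linarith
  · push Not at hxe
    set y := x ^ (1/2 : ℝ) with hy
    have hy1 : 1 ≤ y := Real.one_le_rpow hx (by norm_num)
    have hyy : y * y = x := by rw [hy, ← Real.rpow_add hx0]; norm_num
    have hyx : y ≤ x := by nlinarith
    have hly : Real.log y = Real.log x / 2 := by rw [hy, Real.log_rpow hx0]; ring
    have hfl : ⌊y⌋₊ ≤ ⌊x⌋₊ := Nat.floor_mono hyx
    have hd : ∑ n ∈ Icc 1 ⌊x⌋₊, c n = ∑ n ∈ Icc 1 ⌊y⌋₊, c n + ∑ n ∈ Icc (⌊y⌋₊ + 1) ⌊x⌋₊, c n := by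
      have hd : Icc 1 ⌊x⌋₊ = Icc 1 ⌊y⌋₊ ∪ Icc (⌊y⌋₊ + 1) ⌊x⌋₊ := by
        ext n; simp only [mem_union, mem_Icc]; omega
      rw [hd, sum_union]
      rw [Finset.disjoint_left]; intro n; simp only [mem_Icc]; omega
    have hfy : 1 ≤ ⌊y⌋₊ := (Nat.one_le_floor_iff _).2 hy1
    have p1 := triv x hx y hy1 hyx
    have p2 : |∑ n ∈ Icc (⌊y⌋₊ + 1) ⌊x⌋₊, c n| ≤ (Real.log x / 2)⁻¹ ^ k * (2 * (C * x * L ^ (B + 1))) := by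
      rcases Nat.lt_or_ge ⌊x⌋₊ (⌊y⌋₊ + 1) with hlt | hge
      · rw [Icc_eq_empty (by omega)]; simp; positivity
      · have e : ∑ n ∈ Icc (⌊y⌋₊ + 1) ⌊x⌋₊, c n =
            ∑ n ∈ Icc (⌊y⌋₊ + 1) ⌊x⌋₊, ((Real.log n)⁻¹ ^ k) * (c n * Real.log n ^ k) := by
          refine sum_congr rfl fun n hn => ?_
          rw [mem_Icc] at hn
          have : 0 < Real.log n := Real.log_pos (by exact_mod_cast (by omega : 1 < n))
          rw [inv_pow]; field_simp
        rw [e]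
        have hbd : ∀ m : ℕ, 1 ≤ m → m ≤ ⌊x⌋₊ → |∑ n ∈ Icc 1 m, c n * Real.log n ^ k| ≤ C * x * L ^ (B + 1) := by
          intro m h1 h2
          have h3 : (1:ℝ) ≤ m := by exact_mod_cast h1
          have h4 : (m:ℝ) ≤ x := (Nat.le_floor_iff hx0.le).1 h2
          have := hD m h3
          rw [Nat.floor_natCast] at this
          refine this.trans ?_
          have := Real.log_nonneg h3
          have := Real.log_le_log (by linarith) h4
          gcongr
          linarith
        refine (abel_anti (fun n => (Real.log n)⁻¹ ^ k) (fun n => c n * Real.log n ^ k)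
          (2 * (C * x * L ^ (B + 1))) (⌊y⌋₊ + 1) ⌊x⌋₊ hge ?_ ?_ ?_).trans ?_
        · intro m h1 h2
          have h3 := hbd m (by omega) h2
          have h4 := hbd ⌊y⌋₊ hfy hfl
          have hd : Icc 1 m = Icc 1 ⌊y⌋₊ ∪ Icc (⌊y⌋₊ + 1) m := by
            ext n; simp only [mem_union, mem_Icc]; omega
          rw [hd, sum_union (by rw [Finset.disjoint_left]; intro n; simp only [mem_Icc]; omega)] at h3
          rw [abs_le] at h3 h4 ⊢
          constructor <;> linarith
        · intro n h1 _
          have : 0 < Real.log n := Real.log_pos (by exact_mod_cast (by omega : 1 < n))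
          have : Real.log n ≤ Real.log (n + 1 : ℕ) := Real.log_le_log (by exact_mod_cast (by omega : 0 < n)) (by push_cast; linarith)
          gcongr
        · have : 0 ≤ Real.log ⌊x⌋₊ := Real.log_natCast_nonneg _
          positivity
        · have h1 : y ≤ (⌊y⌋₊ + 1 : ℕ) := by push_cast; exact (Nat.lt_floor_add_one y).le
          have h2 := Real.log_le_log (by linarith) h1
          rw [hly] at h2
          gcongr
    rw [hd]
    have q1 : y * (A * L) * L ^ B ≤ A * M * x := by
      calc _ = A * y * L ^ (B + 1) := by ring
        _ ≤ A * y * (M * y) := by gcongr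
        _ = A * M * (y * y) := by ring
        _ = _ := by rw [hyy]
    have q2 : (Real.log x / 2)⁻¹ ^ k * (2 * (C * x * L ^ (B + 1))) * L ^ B ≤ 4 ^ k * (2 * C) * x := by
      have hLk : L ^ (B + 1) * L ^ B = L ^ k := by rw [← pow_add]; congr 1; omega
      have : (Real.log x / 2)⁻¹ * L ≤ 4 := by
        rw [inv_mul_le_iff₀ (by linarith)]; linarith
      calc _ = ((Real.log x / 2)⁻¹) ^ k * (L ^ (B + 1) * L ^ B) * (2 * C) * x := by ring
        _ = ((Real.log x / 2)⁻¹ * L) ^ k * (2 * C) * x := by rw [hLk, mul_pow]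
        _ ≤ _ := by gcongr
    calc _ ≤ (y * (A * L) + (Real.log x / 2)⁻¹ ^ k * (2 * (C * x * L ^ (B + 1)))) * L ^ B := by
          gcongr; exact (abs_add_le _ _).trans (add_le_add p1 p2)
      _ ≤ A * M * x + 4 ^ k * (2 * C) * x := by rw [add_mul]; exact add_le_add q1 q2
      _ ≤ _ := by
        have : 0 ≤ A * 2 ^ (B + 1) * x := by positivity
        linarith

lemma logMul_iter (c : ℕ → ℂ) (k n : ℕ) : (LSeries.logMul^[k] c) n = Complex.log n ^ k * c n := by
  induction k with
  | zero => simp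
  | succ k ih => rw [Function.iterate_succ', Function.comp, LSeries.logMul, ih]; ring

lemma pnt_gen (c : ℕ → ℝ) (A : ℝ) (hA0 : 0 ≤ A) (hA : ∀ n : ℕ, 1 ≤ n → |c n| ≤ A * (1 + Real.log n))
    (F : ℂ → ℂ) (hF : ∀ k, TBn k F)
    (hab : LSeries.abscissaOfAbsConv (fun n => (c n : ℂ)) ≤ 1)
    (heq : ∀ s : ℂ, 1 < s.re → F s = LSeries (fun n => (c n : ℂ)) s) (B : ℕ) :
    ∃ C : ℝ, 0 ≤ C ∧ ∀ x : ℝ, 1 ≤ x → |∑ n ∈ Icc 1 ⌊x⌋₊, c n| ≤ C * x / (1 + Real.log x) ^ B := by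
  refine transfer c A hA0 hA (fun k => ?_) B
  have hT := (hF k).lseries hab (fun s h _ => heq s h)
  obtain ⟨C, h0, h⟩ := perron_bound _ (by rw [LSeries.absicssaOfAbsConv_logPowMul]; exact hab) hT
  refine ⟨C, h0, fun x hx => ?_⟩
  have := h x hx
  have e : ∑ n ∈ Icc 1 ⌊x⌋₊, (LSeries.logMul^[k] fun n => (c n : ℂ)) n * (Real.log (x / n) : ℂ) =
      ((∑ n ∈ Icc 1 ⌊x⌋₊, c n * Real.log n ^ k * Real.log (x / n) : ℝ) : ℂ) := by
    push_cast
    refine sum_congr rfl fun n _ => ?_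
    rw [logMul_iter, ← Complex.natCast_log]; ring
  rw [e, Complex.norm_real, Real.norm_eq_abs] at this
  exact this

lemma moebius_sum (B : ℕ) : ∃ C : ℝ, 0 ≤ C ∧ ∀ x : ℝ, 1 ≤ x →
    |∑ n ∈ Icc 1 ⌊x⌋₊, (ArithmeticFunction.moebius n : ℝ)| ≤ C * x / (1 + Real.log x) ^ B := by
  have hc : (fun n => (((ArithmeticFunction.moebius n : ℝ)) : ℂ)) = fun n => (ArithmeticFunction.moebius n : ℂ) := by
    ext n; push_cast; rfl
  refine pnt_gen _ 1 zero_le_one (fun n hn => ?_) _ inv_zeta_TBn ?_ (fun s hs => ?_) B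
  · have : 0 ≤ Real.log n := Real.log_natCast_nonneg n
    have h1 : |((ArithmeticFunction.moebius n : ℤ) : ℝ)| ≤ 1 := by
      exact_mod_cast ArithmeticFunction.abs_moebius_le_one
    linarith
  · rw [hc]; exact ArithmeticFunction.abscissaOfAbsConv_moebius.le
  · rw [inv_zeta_eq s hs, hc]
    have := ArithmeticFunction.LSeries_zeta_mul_Lseries_moebius hs
    rw [ArithmeticFunction.LSeries_zeta_eq_riemannZeta hs] at this
    rw [inv_eq_of_mul_eq_one_right this]

lemma psi_sum (B : ℕ) : ∃ C : ℝ, 0 ≤ C ∧ ∀ x : ℝ, 1 ≤ x →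
    |∑ n ∈ Icc 1 ⌊x⌋₊, (ArithmeticFunction.vonMangoldt n - 1)| ≤ C * x / (1 + Real.log x) ^ B := by
  have hc : (fun n => (((ArithmeticFunction.vonMangoldt n - 1 : ℝ)) : ℂ)) =
      (fun n => (ArithmeticFunction.vonMangoldt n : ℂ)) - 1 := by
    ext n; simp
  refine pnt_gen _ 1 zero_le_one (fun n hn => ?_) _ psi_TBn ?_ (fun s hs => ?_) B
  · have h1 : 0 ≤ ArithmeticFunction.vonMangoldt n := ArithmeticFunction.vonMangoldt_nonneg
    have h2 := ArithmeticFunction.vonMangoldt_le_log (n := n)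
    rw [abs_le]; constructor <;> linarith [Real.log_natCast_nonneg n]
  · rw [hc]
    refine LSeries.abscissaOfAbsConv_le_of_forall_lt_LSeriesSummable fun y hy => ?_
    have : 1 < (y : ℂ).re := by simpa using hy
    exact (ArithmeticFunction.LSeriesSummable_vonMangoldt this).sub (LSeriesSummable_one_iff.2 this)
  · rw [psi_eq s hs, hc, LSeries_sub (ArithmeticFunction.LSeriesSummable_vonMangoldt hs) (LSeriesSummable_one_iff.2 hs),
      LSeries_one_eq_riemannZeta hs, ← ArithmeticFunction.LSeries_vonMangoldt_eq_deriv_riemannZeta_div hs]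

lemma maj_pos (f e : ℕ → ℝ) (N : ℕ) (hf : ∀ n, 1 ≤ n → n < N → f (n + 1) ≤ f n)
    (h : ∀ m, m ≤ N → 0 ≤ ∑ n ∈ Icc 1 m, e n) : f N * ∑ n ∈ Icc 1 N, e n ≤ ∑ n ∈ Icc 1 N, f n * e n := by
  induction N with
  | zero => simp
  | succ N ih =>
    have ih' := ih (fun n h1 h2 => hf n h1 (by omega)) (fun m hm => h m (by omega))
    rw [sum_Icc_succ_top (by omega), sum_Icc_succ_top (by omega)]
    rcases Nat.eq_zero_or_pos N with rfl | hN
    · simp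
    · have := mul_le_mul_of_nonneg_right (hf N hN (by omega)) (h N (by omega))
      linarith

lemma majorant (f d γ : ℕ → ℝ) (N : ℕ) (hf : ∀ n, 1 ≤ n → n < N → f (n + 1) ≤ f n) (hN : 0 ≤ f N)
    (h : ∀ m, m ≤ N → |∑ n ∈ Icc 1 m, d n| ≤ ∑ n ∈ Icc 1 m, γ n) :
    |∑ n ∈ Icc 1 N, f n * d n| ≤ ∑ n ∈ Icc 1 N, f n * γ n := by
  have p1 := maj_pos f (fun n => γ n - d n) N hf (fun m hm => by
    rw [sum_sub_distrib]; linarith [(abs_le.1 (h m hm)).2])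
  have p2 := maj_pos f (fun n => γ n + d n) N hf (fun m hm => by
    rw [sum_add_distrib]; linarith [(abs_le.1 (h m hm)).1])
  have q1 : 0 ≤ f N * ∑ n ∈ Icc 1 N, (γ n - d n) := mul_nonneg hN (by
    rw [sum_sub_distrib]; linarith [(abs_le.1 (h N le_rfl)).2])
  have q2 : 0 ≤ f N * ∑ n ∈ Icc 1 N, (γ n + d n) := mul_nonneg hN (by
    rw [sum_add_distrib]; linarith [(abs_le.1 (h N le_rfl)).1])
  simp only [mul_sub, mul_add, sum_sub_distrib, sum_add_distrib] at p1 p2 q1 q2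
  rw [abs_le]; constructor <;> linarith

noncomputable def dl (n : ℕ) : ℝ := Real.log n - Real.log ((n:ℝ) - 1)

lemma dl_one : dl 1 = 0 := by simp [dl]

lemma dl_ge {n : ℕ} (hn : 2 ≤ n) : 1 / (n:ℝ) ≤ dl n := by
  have h2 : (2:ℝ) ≤ n := by exact_mod_cast hn
  have := Real.log_le_sub_one_of_pos (x := ((n:ℝ) - 1) / n) (by apply div_pos <;> linarith)
  rw [Real.log_div (by linarith) (by linarith)] at this
  have e : ((n:ℝ) - 1) / n - 1 = - (1 / n) := by field_simp; ring
  unfold dl; linarith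

lemma dl_nonneg (n : ℕ) (hn : 1 ≤ n) : 0 ≤ dl n := by
  rcases Nat.lt_or_ge n 2 with h | h
  · have : n = 1 := by omega
    rw [this, dl_one]
  · exact le_trans (by positivity) (dl_ge h)

lemma dl_le_one {n : ℕ} (hn : 1 ≤ n) : dl n ≤ 1 := by
  rcases Nat.lt_or_ge n 2 with h | h
  · have : n = 1 := by omega
    rw [this, dl_one]; norm_num
  · have h2 : (2:ℝ) ≤ n := by exact_mod_cast h
    unfold dl
    rw [← Real.log_div (by linarith) (by linarith)]
    have := Real.log_le_sub_one_of_pos (x := (n:ℝ) / (n - 1)) (by apply div_pos <;> linarith)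
    have e : (n:ℝ) / (n - 1) ≤ 2 := by rw [div_le_iff₀ (by linarith)]; linarith
    linarith

lemma dl_sum (m : ℕ) : ∑ n ∈ Icc 1 m, dl n = Real.log m := by
  induction m with
  | zero => simp
  | succ m ih => rw [sum_Icc_succ_top (by omega), ih, dl]; push_cast; ring_nf

lemma sum_inv_le {x : ℝ} (hx : 1 ≤ x) : ∑ n ∈ Icc 1 ⌊x⌋₊, 1 / (n:ℝ) ≤ 1 + Real.log x := by
  have h1 : 1 ≤ ⌊x⌋₊ := Nat.le_floor (by simpa using hx)
  rw [← sum_erase_add _ _ (mem_Icc.2 ⟨le_rfl, h1⟩)]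
  have : ∑ n ∈ (Icc 1 ⌊x⌋₊).erase 1, 1 / (n:ℝ) ≤ ∑ n ∈ (Icc 1 ⌊x⌋₊).erase 1, dl n := by
    refine sum_le_sum fun n hn => dl_ge ?_
    simp only [mem_erase, mem_Icc] at hn; omega
  have h2 := dl_sum ⌊x⌋₊
  rw [← sum_erase_add _ _ (mem_Icc.2 ⟨le_rfl, h1⟩), dl_one] at h2
  have h3 : Real.log ⌊x⌋₊ ≤ Real.log x := Real.log_le_log (by exact_mod_cast h1) (Nat.floor_le (by linarith))
  norm_num at *; linarith

lemma sum_inv_sub (m : ℕ) : |∑ n ∈ Icc 1 m, (1 / (n:ℝ) - dl n)| ≤ 1 := by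
  rcases Nat.eq_zero_or_pos m with rfl | hm
  · simp
  have hm' : (1:ℝ) ≤ m := by exact_mod_cast hm
  have h1 := sum_inv_le hm'
  rw [Nat.floor_natCast] at h1
  have h2 : Real.log m ≤ ∑ n ∈ Icc 1 m, 1 / (n:ℝ) := by
    have := log_add_one_le_harmonic m
    rw [harmonic_eq_sum_Icc] at this
    push_cast at this
    have h3 : Real.log m ≤ Real.log (m + 1) := Real.log_le_log (by linarith) (by linarith)
    simp only [one_div]; linarith
  rw [sum_sub_distrib, dl_sum, abs_le]; constructor <;> linarith

/-- sum of 1/(n (1+log n)^2) -/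
lemma sum_inv_log (m : ℕ) : ∑ n ∈ Icc 1 m, 1 / (n:ℝ) * (1 / (1 + Real.log n) ^ 2) ≤ 2 := by
  rcases Nat.eq_zero_or_pos m with rfl | hm
  · simp
  have : ∑ n ∈ Icc 1 m, 1 / (n:ℝ) * (1 / (1 + Real.log n) ^ 2) ≤ 2 - 1 / (1 + Real.log m) := by
    induction m, hm using Nat.le_induction with
    | base => norm_num
    | succ m hm ih =>
      rw [sum_Icc_succ_top (by omega)]
      have h := dl_ge (n := m + 1) (by omega)
      have hm1 : (1:ℝ) ≤ m := by exact_mod_cast hm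
      have hl : 0 ≤ Real.log m := Real.log_nonneg hm1
      have hl2 : Real.log m ≤ Real.log (m + 1 : ℕ) := Real.log_le_log (by linarith) (by push_cast; linarith)
      have hd : dl (m + 1) = Real.log (m + 1 : ℕ) - Real.log m := by unfold dl; push_cast; ring_nf
      rw [hd] at h
      set a := Real.log (m + 1 : ℕ)
      set b := Real.log m
      have : 1 / ((m + 1 : ℕ):ℝ) * (1 / (1 + a) ^ 2) ≤ 1 / (1 + b) - 1 / (1 + a) := by
        calc _ ≤ (a - b) * (1 / (1 + a) ^ 2) := by gcongr
          _ ≤ (a - b) * (1 / ((1 + a) * (1 + b))) := by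
            have : (1 + a) * (1 + b) ≤ (1 + a) ^ 2 := by nlinarith
            gcongr
          _ = _ := by
            have : 0 < 1 + a := by linarith
            have : 0 < 1 + b := by linarith
            field_simp; ring
      linarith
  have h0 : 0 ≤ 1 / (1 + Real.log m) := by
    have := Real.log_natCast_nonneg m; positivity
  linarith

def PS (c : ℕ → ℝ) : Prop := ∃ C : ℝ, 0 ≤ C ∧ ∀ x : ℝ, 1 ≤ x →
  |∑ n ∈ Icc 1 ⌊x⌋₊, (c n - 1)| ≤ C * x / (1 + Real.log x) ^ 2

def Mert (c : ℕ → ℝ) : Prop := ∃ C : ℝ, 0 ≤ C ∧ ∀ m : ℕ, |∑ n ∈ Icc 1 m, (c n / n - dl n)| ≤ C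

lemma PS.mert {c : ℕ → ℝ} (h : PS c) : Mert c := by
  obtain ⟨C, hC, h⟩ := h
  refine ⟨C * 2 + 1, by positivity, fun m => ?_⟩
  have e : ∀ n : ℕ, c n / n - dl n = 1 / (n:ℝ) * (c n - 1) + (1 / n - dl n) := fun n => by ring
  simp only [e]
  rw [sum_add_distrib]
  refine (abs_add_le _ _).trans (add_le_add ?_ (sum_inv_sub m))
  refine (majorant (fun n => 1 / (n:ℝ)) (fun n => c n - 1) (fun n => C * (1 / (1 + Real.log n) ^ 2)) m
    (fun n h1 _ => ?_) (by positivity) (fun j hj => ?_)).trans ?_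
  · have : (0:ℝ) < n := by exact_mod_cast h1
    exact one_div_le_one_div_of_le this (by push_cast; linarith)
  · rcases Nat.eq_zero_or_pos j with rfl | hj0
    · simp
    · have hj1 : (1:ℝ) ≤ j := by exact_mod_cast hj0
      have := h j hj1
      rw [Nat.floor_natCast] at this
      refine this.trans ?_
      rw [← mul_sum, mul_div_assoc]
      gcongr
      have : ∑ n ∈ Icc 1 j, 1 / (1 + Real.log j) ^ 2 ≤ ∑ n ∈ Icc 1 j, 1 / (1 + Real.log n) ^ 2 := by
        refine sum_le_sum fun n hn => ?_
        rw [mem_Icc] at hn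
        have h0 := Real.log_natCast_nonneg n
        have : Real.log n ≤ Real.log j := Real.log_le_log (by exact_mod_cast hn.1) (by exact_mod_cast hn.2)
        gcongr
      refine le_trans (le_of_eq ?_) this
      simp; ring
  · have : ∀ n : ℕ, 1 / (n:ℝ) * (C * (1 / (1 + Real.log n) ^ 2)) = C * (1 / (n:ℝ) * (1 / (1 + Real.log n) ^ 2)) :=
      fun n => by ring
    simp only [this, ← mul_sum]
    gcongr
    exact sum_inv_log m

lemma PS.one : PS (fun _ => 1) := ⟨0, le_rfl, fun x _ => by simp⟩

lemma PS.vM : PS (fun n => ArithmeticFunction.vonMangoldt n) := psi_sum 2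

lemma pow_step (i : ℕ) {a b : ℝ} (hb : 0 ≤ b) (hab : b ≤ a) :
    a ^ (i + 1) - b ^ (i + 1) ≤ (i + 1) * a ^ i * (a - b) ∧
    (i + 1) * b ^ i * (a - b) ≤ a ^ (i + 1) - b ^ (i + 1) := by
  have ha : 0 ≤ a := hb.trans hab
  induction i with
  | zero => simp
  | succ i ih =>
    obtain ⟨h1, h2⟩ := ih
    have hp : b ^ (i + 1) ≤ a ^ (i + 1) := by gcongr
    push_cast
    constructor
    · have : a ^ (i + 1 + 1) - b ^ (i + 1 + 1) = a * (a ^ (i + 1) - b ^ (i + 1)) + (a - b) * b ^ (i + 1) := by ring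
      rw [this]
      have q1 := mul_le_mul_of_nonneg_left h1 ha
      have q2 := mul_le_mul_of_nonneg_left hp (sub_nonneg.2 hab)
      calc _ ≤ a * ((i + 1) * a ^ i * (a - b)) + (a - b) * a ^ (i + 1) := add_le_add q1 q2
        _ = _ := by ring
    · have : a ^ (i + 1 + 1) - b ^ (i + 1 + 1) = b * (a ^ (i + 1) - b ^ (i + 1)) + (a - b) * a ^ (i + 1) := by ring
      rw [this]
      have q1 := mul_le_mul_of_nonneg_left h2 hb
      have q2 := mul_le_mul_of_nonneg_left hp (sub_nonneg.2 hab)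
      calc _ = b * ((i + 1) * b ^ i * (a - b)) + (a - b) * b ^ (i + 1) := by ring
        _ ≤ _ := add_le_add q1 q2

lemma mert_log {c : ℕ → ℝ} (h : Mert c) (i : ℕ) : ∃ C : ℝ, 0 ≤ C ∧ ∀ m : ℕ, 1 ≤ m →
    |∑ n ∈ Icc 1 m, c n / n * Real.log n ^ i - Real.log m ^ (i + 1) / (i + 1)| ≤ C * (1 + Real.log m) ^ i := by
  obtain ⟨C, hC, h⟩ := h
  refine ⟨2 * C + 1, by positivity, fun m hm => ?_⟩
  have h1 := abel_mono (fun n => Real.log n ^ i) (fun n => c n / n - dl n) C 1 m hm (fun j _ _ => h j)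
    (fun n h1 _ => by
      have : (1:ℝ) ≤ n := by exact_mod_cast h1
      have := Real.log_nonneg this
      have : Real.log n ≤ Real.log (n + 1 : ℕ) := Real.log_le_log (by linarith) (by push_cast; linarith)
      gcongr) (by simp)
  have h2 : |∑ n ∈ Icc 1 m, (i + 1) * (Real.log n ^ i * dl n) - Real.log m ^ (i + 1)| ≤ (i + 1) * Real.log m ^ i := by
    have : 0 ≤ ∑ n ∈ Icc 1 m, (i + 1) * (Real.log n ^ i * dl n) - Real.log m ^ (i + 1) ∧
      ∑ n ∈ Icc 1 m, (i + 1) * (Real.log n ^ i * dl n) - Real.log m ^ (i + 1) ≤ (i + 1) * Real.log m ^ i := by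
      induction m, hm using Nat.le_induction with
      | base => simp [dl_one]; positivity
      | succ m hm ih =>
        rw [sum_Icc_succ_top (by omega)]
        have ih := ih (abel_mono (fun n => Real.log n ^ i) (fun n => c n / n - dl n) C 1 m hm (fun j _ _ => h j)
          (fun n h1 _ => by
            have : (1:ℝ) ≤ n := by exact_mod_cast h1
            have := Real.log_nonneg this
            have : Real.log n ≤ Real.log (n + 1 : ℕ) := Real.log_le_log (by linarith) (by push_cast; linarith)
            gcongr) (by simp))
        have hm1 : (1:ℝ) ≤ m := by exact_mod_cast hm
        have hl : 0 ≤ Real.log m := Real.log_nonneg hm1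
        have hl2 : Real.log m ≤ Real.log (m + 1 : ℕ) := Real.log_le_log (by linarith) (by push_cast; linarith)
        have hd : dl (m + 1) = Real.log (m + 1 : ℕ) - Real.log m := by unfold dl; push_cast; ring_nf
        have hd1 := dl_le_one (n := m + 1) (by omega)
        rw [hd] at hd1 ⊢
        have hs := pow_step i hl hl2
        set a := Real.log (m + 1 : ℕ)
        set b := Real.log m
        have hp : b ^ i ≤ a ^ i := by gcongr
        have : (a - b) * (a ^ i - b ^ i) ≤ 1 * (a ^ i - b ^ i) :=
          mul_le_mul_of_nonneg_right hd1 (sub_nonneg.2 hp)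
        have := mul_le_mul_of_nonneg_left this (by positivity : (0:ℝ) ≤ i + 1)
        constructor
        · linarith [hs.1]
        · linarith [hs.2]
    rw [abs_of_nonneg this.1]; exact this.2
  have hl0 := Real.log_natCast_nonneg m
  have hle : Real.log m ^ i ≤ (1 + Real.log m) ^ i := by gcongr; linarith
  have e : ∑ n ∈ Icc 1 m, c n / n * Real.log n ^ i - Real.log m ^ (i + 1) / (i + 1) =
      ∑ n ∈ Icc 1 m, Real.log n ^ i * (c n / n - dl n) +
      (∑ n ∈ Icc 1 m, (i + 1) * (Real.log n ^ i * dl n) - Real.log m ^ (i + 1)) / (i + 1) := by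
    rw [sub_div, ← mul_sum, mul_div_cancel_left₀ _ (by positivity), ← add_sub_assoc, ← sum_add_distrib]
    congr 1
    exact sum_congr rfl fun n _ => by ring
  rw [e]
  refine (abs_add_le _ _).trans ?_
  rw [abs_div, abs_of_pos (by positivity : (0:ℝ) < i + 1)]
  have : |∑ n ∈ Icc 1 m, (i + 1) * (Real.log n ^ i * dl n) - Real.log m ^ (i + 1)| / (i + 1) ≤ Real.log m ^ i := by
    rw [div_le_iff₀ (by positivity)]; linarith
  nlinarith

lemma log_quot_step {x : ℝ} (hx : 0 < x) {m : ℕ} (hm : 1 ≤ m) :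
    dl (m + 1) = Real.log (x / m) - Real.log (x / (m + 1 : ℕ)) := by
  have : (0:ℝ) < m := by exact_mod_cast hm
  rw [Real.log_div (by positivity) (by positivity), Real.log_div (by positivity) (by positivity)]
  unfold dl; push_cast; ring_nf

lemma floor_log {x : ℝ} (hx : 1 ≤ x) : 0 ≤ Real.log (x / ⌊x⌋₊) ∧ Real.log (x / ⌊x⌋₊) ≤ 1 := by
  have h1 : 1 ≤ ⌊x⌋₊ := Nat.le_floor (by simpa using hx)
  have h1' : (1:ℝ) ≤ ⌊x⌋₊ := by exact_mod_cast h1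
  have h2 := Nat.floor_le (by linarith : 0 ≤ x)
  have h3 := Nat.lt_floor_add_one x
  have h4 : x / ⌊x⌋₊ ≤ 2 := by rw [div_le_iff₀ (by linarith)]; linarith
  refine ⟨Real.log_nonneg (by rw [le_div_iff₀ (by linarith)]; linarith), ?_⟩
  have := Real.log_le_sub_one_of_pos (x := x / ⌊x⌋₊) (by positivity)
  linarith

lemma quot_ge_one {x : ℝ} {n : ℕ} (h1 : 1 ≤ n) (hn : n ≤ ⌊x⌋₊) (hx : 0 ≤ x) : 1 ≤ x / n := by
  have : (0:ℝ) < n := by exact_mod_cast h1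
  rw [le_div_iff₀ this, one_mul]; exact (Nat.le_floor_iff hx).1 hn

lemma mert_logquot {c : ℕ → ℝ} (h : Mert c) (i : ℕ) : ∃ C : ℝ, 0 ≤ C ∧ ∀ x : ℝ, 1 ≤ x →
    |∑ n ∈ Icc 1 ⌊x⌋₊, c n / n * Real.log (x / n) ^ i - Real.log x ^ (i + 1) / (i + 1)| ≤ C * (1 + Real.log x) ^ i := by
  obtain ⟨C, hC, h⟩ := h
  refine ⟨C + 2, by positivity, fun x hx => ?_⟩
  have hx0 : 0 < x := by linarith
  have hm : 1 ≤ ⌊x⌋₊ := Nat.le_floor (by simpa using hx)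
  have hfl := floor_log hx
  have h1 := abel_anti (fun n => Real.log (x / n) ^ i) (fun n => c n / n - dl n) C 1 ⌊x⌋₊ hm (fun j _ _ => h j)
    (fun n h1 h2 => by
      have h3 := quot_ge_one (by omega : 1 ≤ n + 1) h2 hx0.le
      have := Real.log_nonneg h3
      have := log_quot_step hx0 h1
      have := dl_nonneg (n + 1) (by omega)
      gcongr ?_ ^ i; linarith) (by exact pow_nonneg hfl.1 i)
  have h2 : ∀ m : ℕ, 1 ≤ m → m ≤ ⌊x⌋₊ → 
      0 ≤ (Real.log x ^ (i + 1) - Real.log (x / m) ^ (i + 1)) - ∑ n ∈ Icc 1 m, (i + 1) * (Real.log (x / n) ^ i * dl n) ∧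
      (Real.log x ^ (i + 1) - Real.log (x / m) ^ (i + 1)) - ∑ n ∈ Icc 1 m, (i + 1) * (Real.log (x / n) ^ i * dl n) 
        ≤ (i + 1) * (Real.log x ^ i - Real.log (x / m) ^ i) := by
    intro m hm
    induction m, hm using Nat.le_induction with
    | base => simp [dl_one]
    | succ m hm ih =>
      intro hmx
      have ih := ih (by omega)
      rw [sum_Icc_succ_top (by omega)]
      have hl : 0 ≤ Real.log (x / (m + 1 : ℕ)) := Real.log_nonneg (quot_ge_one (by omega) hmx hx0.le)
      have hd := log_quot_step hx0 hm
      have hd1 := dl_le_one (n := m + 1) (by omega)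
      have hd0 := dl_nonneg (m + 1) (by omega)
      rw [hd] at hd1 hd0 ⊢
      have hs := pow_step i hl (by linarith : _ ≤ Real.log (x / m))
      set a := Real.log (x / m)
      set b := Real.log (x / (m + 1 : ℕ))
      have hp : b ^ i ≤ a ^ i := by gcongr; linarith
      have : (a - b) * (a ^ i - b ^ i) ≤ 1 * (a ^ i - b ^ i) :=
        mul_le_mul_of_nonneg_right hd1 (sub_nonneg.2 hp)
      have := mul_le_mul_of_nonneg_left this (by positivity : (0:ℝ) ≤ i + 1)
      constructor
      · linarith [hs.2]
      · linarith [hs.1]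
  have h3 := h2 _ hm le_rfl
  have e : ∑ n ∈ Icc 1 ⌊x⌋₊, c n / n * Real.log (x / n) ^ i - Real.log x ^ (i + 1) / (i + 1) =
      ∑ n ∈ Icc 1 ⌊x⌋₊, Real.log (x / n) ^ i * (c n / n - dl n) -
      ((Real.log x ^ (i + 1) - Real.log (x / ⌊x⌋₊) ^ (i + 1)) - 
        ∑ n ∈ Icc 1 ⌊x⌋₊, (i + 1) * (Real.log (x / n) ^ i * dl n)) / (i + 1) -
      Real.log (x / ⌊x⌋₊) ^ (i + 1) / (i + 1) := by
    rw [sub_div, ← mul_sum, mul_div_cancel_left₀ _ (by positivity)]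
    have : ∑ n ∈ Icc 1 ⌊x⌋₊, Real.log (x / n) ^ i * (c n / n - dl n) = ∑ n ∈ Icc 1 ⌊x⌋₊, c n / n * Real.log (x / n) ^ i
      - ∑ n ∈ Icc 1 ⌊x⌋₊, Real.log (x / n) ^ i * dl n := by
      rw [← sum_sub_distrib]
      exact sum_congr rfl fun n _ => by ring
    rw [this]; ring
  rw [e]
  have hl0 := Real.log_nonneg hx
  have hle : Real.log x ^ i ≤ (1 + Real.log x) ^ i := by gcongr; linarith
  have hle1 : 1 ≤ (1 + Real.log x) ^ i := one_le_pow₀ (by linarith)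
  have hf1 : 0 ≤ Real.log (x / ⌊x⌋₊) ^ i := pow_nonneg hfl.1 _
  refine (abs_sub _ _).trans ?_
  refine (add_le_add (abs_sub _ _) le_rfl).trans ?_
  rw [abs_div, abs_div, abs_of_pos (by positivity : (0:ℝ) < i + 1), abs_of_nonneg h3.1, abs_of_nonneg (pow_nonneg hfl.1 _)]
  have q1 : (Real.log x ^ (i + 1) - Real.log (x / ⌊x⌋₊) ^ (i + 1) - ∑ n ∈ Icc 1 ⌊x⌋₊, (i + 1) * (Real.log (x / n) ^ i * dl n)) / (i + 1)
     ≤ Real.log x ^ i := by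
    rw [div_le_iff₀ (by positivity)]; nlinarith [h3.2, (by positivity : (0:ℝ) ≤ i)]
  have q2 : Real.log (x / ⌊x⌋₊) ^ (i + 1) / (i + 1) ≤ 1 := by
    rw [div_le_one (by positivity)]
    have := pow_le_one₀ hfl.1 hfl.2 (n := i + 1)
    have : (0:ℝ) ≤ i := by positivity
    linarith
  have h1' : |∑ n ∈ Icc 1 ⌊x⌋₊, Real.log (x / n) ^ i * (c n / n - dl n)| ≤ Real.log x ^ i * C := by simpa using h1
  nlinarith

lemma mert_inv {c : ℕ → ℝ} (h : Mert c) : ∃ C : ℝ, 0 ≤ C ∧ ∀ x : ℝ, 1 ≤ x →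
    ∑ n ∈ Icc 1 ⌊x⌋₊, c n / n * (1 / (1 + Real.log (x / n)) ^ 2) ≤ C := by
  obtain ⟨C, hC, h⟩ := h
  refine ⟨2 * C + 2, by positivity, fun x hx => ?_⟩
  have hx0 : 0 < x := by linarith
  have hm : 1 ≤ ⌊x⌋₊ := Nat.le_floor (by simpa using hx)
  have hfl := floor_log hx
  have h1 := abel_mono (fun n => 1 / (1 + Real.log (x / n)) ^ 2) (fun n => c n / n - dl n) C 1 ⌊x⌋₊ hm (fun j _ _ => h j)
    (fun n h1 h2 => by
      have h3 := quot_ge_one (by omega : 1 ≤ n + 1) h2 hx0.le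
      have := Real.log_nonneg h3
      have := log_quot_step hx0 h1
      have := dl_nonneg (n + 1) (by omega)
      gcongr 1 / (1 + ?_) ^ 2; linarith) (by positivity)
  have h2 : ∀ m : ℕ, 1 ≤ m → m ≤ ⌊x⌋₊ → 
      ∑ n ∈ Icc 1 m, dl n * (1 / (1 + Real.log (x / n)) ^ 2) ≤ 2 * (1 / (1 + Real.log (x / m)) - 1 / (1 + Real.log x)) := by
    intro m hm
    induction m, hm using Nat.le_induction with
    | base => simp [dl_one]
    | succ m hm ih =>
      intro hmx
      have ih := ih (by omega)
      rw [sum_Icc_succ_top (by omega)]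
      have hl : 0 ≤ Real.log (x / (m + 1 : ℕ)) := Real.log_nonneg (quot_ge_one (by omega) hmx hx0.le)
      have hd := log_quot_step hx0 hm
      have hd1 := dl_le_one (n := m + 1) (by omega)
      have hd0 := dl_nonneg (m + 1) (by omega)
      rw [hd] at hd1 hd0 ⊢
      set a := Real.log (x / m)
      set b := Real.log (x / (m + 1 : ℕ))
      have : (a - b) * (1 / (1 + b) ^ 2) ≤ 2 * (1 / (1 + b) - 1 / (1 + a)) := by
        have ha : 0 < 1 + a := by linarith
        have hb : 0 < 1 + b := by linarith
        have e : 2 * (1 / (1 + b) - 1 / (1 + a)) = (a - b) * (2 / ((1 + a) * (1 + b))) := by field_simp; ring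
        rw [e]
        refine mul_le_mul_of_nonneg_left ?_ hd0
        rw [div_le_div_iff₀ (by positivity) (by positivity)]
        nlinarith
      linarith
  have h3 := h2 _ hm le_rfl
  have hl0 := Real.log_nonneg hx
  have q1 : 1 / (1 + Real.log (x / ⌊x⌋₊)) ≤ 1 := by rw [div_le_one] <;> linarith
  have q0 : 0 ≤ 1 / (1 + Real.log (x / ⌊x⌋₊)) := by
    have := hfl.1
    positivity
  have q2 : 0 ≤ 1 / (1 + Real.log x) := by positivity
  have e : ∑ n ∈ Icc 1 ⌊x⌋₊, c n / n * (1 / (1 + Real.log (x / n)) ^ 2) =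
     ∑ n ∈ Icc 1 ⌊x⌋₊, (1 / (1 + Real.log (x / n)) ^ 2) * (c n / n - dl n) + 
     ∑ n ∈ Icc 1 ⌊x⌋₊, dl n * (1 / (1 + Real.log (x / n)) ^ 2) := by
    rw [← sum_add_distrib]; exact sum_congr rfl fun n _ => by ring
  rw [e]
  have q3 := le_abs_self (∑ n ∈ Icc 1 ⌊x⌋₊, (1 / (1 + Real.log (x / n)) ^ 2) * (c n / n - dl n))
  have q4 : 1 / (1 + Real.log (x / ⌊x⌋₊)) ^ 2 ≤ 1 := by
    rw [div_le_one (by have := hfl.1; positivity)]; exact one_le_pow₀ (by linarith)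
  nlinarith

noncomputable def lam : ArithmeticFunction ℝ := (ArithmeticFunction.liouville : ArithmeticFunction ℝ)

lemma lam_apply {n : ℕ} (h : n ≠ 0) : lam n = (-1) ^ (ArithmeticFunction.cardFactors n) := by
  simp [lam, ArithmeticFunction.liouville_apply h]

lemma lam_mul (m n : ℕ) : lam (m * n) = lam m * lam n := by
  rcases eq_or_ne m 0 with rfl | hm
  · simp
  rcases eq_or_ne n 0 with rfl | hn
  · simp
  rw [lam_apply (mul_ne_zero hm hn), lam_apply hm, lam_apply hn, ArithmeticFunction.cardFactors_mul hm hn, pow_add]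

lemma lam_one : lam 1 = 1 := by rw [lam_apply one_ne_zero]; simp

lemma lam_prime {p : ℕ} (hp : p.Prime) : lam p = -1 := by
  rw [lam_apply hp.ne_zero, ArithmeticFunction.cardFactors_apply_prime hp]; simp

lemma lam_abs {n : ℕ} (hn : n ≠ 0) : |lam n| = 1 := by rw [lam_apply hn]; simp

lemma lam_abs_le (n : ℕ) : |lam n| ≤ 1 := by
  rcases eq_or_ne n 0 with rfl | hn
  · simp
  · exact (lam_abs hn).le

lemma lam_isMult : ArithmeticFunction.IsMultiplicative lam := by
  exact ⟨lam_one, fun {m n} _ => lam_mul m n⟩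

lemma sum_conv (f g : ArithmeticFunction ℝ) (x : ℝ) : ∑ n ∈ Icc 1 ⌊x⌋₊, (f * g) n =
    ∑ n ∈ Icc 1 ⌊x⌋₊, f n * ∑ m ∈ Icc 1 ⌊x / n⌋₊, g m := by
  have := ArithmeticFunction.sum_Ioc_mul_eq_sum_sum f g ⌊x⌋₊
  simp only [Nat.floor_div_natCast]
  exact this

/-- pointwise multiplication by log -/
noncomputable def Dl (f : ArithmeticFunction ℝ) : ArithmeticFunction ℝ := ⟨fun n => f n * Real.log n, by simp⟩

@[simp] lemma Dl_apply (f : ArithmeticFunction ℝ) (n : ℕ) : Dl f n = f n * Real.log n := rfl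

lemma Dl_mul (f g : ArithmeticFunction ℝ) : Dl (f * g) = Dl f * g + f * Dl g := by
  ext n
  simp only [Dl_apply, ArithmeticFunction.add_apply, ArithmeticFunction.mul_apply, sum_mul, ← sum_add_distrib]
  refine sum_congr rfl fun p hp => ?_
  rw [Nat.mem_divisorsAntidiagonal] at hp
  have h1 : (p.1:ℝ) ≠ 0 := by rintro h; apply hp.2; rw [← hp.1, Nat.cast_eq_zero.1 h, zero_mul]
  have h2 : (p.2:ℝ) ≠ 0 := by rintro h; apply hp.2; rw [← hp.1, Nat.cast_eq_zero.1 h, mul_zero]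
  rw [← hp.1, Nat.cast_mul, Real.log_mul h1 h2]; ring

noncomputable def mm : ArithmeticFunction ℝ := (ArithmeticFunction.moebius : ArithmeticFunction ℝ)
noncomputable def zz : ArithmeticFunction ℝ := (ArithmeticFunction.zeta : ArithmeticFunction ℝ)

lemma mm_zz : mm * zz = 1 := ArithmeticFunction.coe_moebius_mul_coe_zeta

lemma mm_apply (n : ℕ) : mm n = (ArithmeticFunction.moebius n : ℝ) := by simp [mm]
lemma zz_apply {n : ℕ} (hn : n ≠ 0) : zz n = 1 := by simp [zz, hn]

lemma Dl_one : Dl 1 = 0 := by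
  ext n
  rcases eq_or_ne n 1 with rfl | h
  · simp
  · simp [ArithmeticFunction.one_apply_ne h]

lemma Dl_zz : Dl zz = zz * ArithmeticFunction.vonMangoldt := by
  have : zz * ArithmeticFunction.vonMangoldt = ArithmeticFunction.log := by
    rw [mul_comm]; exact ArithmeticFunction.vonMangoldt_mul_zeta
  rw [this]
  ext n
  rcases eq_or_ne n 0 with rfl | h
  · simp
  · simp [zz_apply h, ArithmeticFunction.log_apply]

lemma Dl_mm : Dl mm + ArithmeticFunction.vonMangoldt * mm = 0 := by
  have h := Dl_mul mm zz
  rw [mm_zz, Dl_one, Dl_zz, ← mul_assoc, mm_zz, one_mul] at h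
  have h2 : (Dl mm * zz + ArithmeticFunction.vonMangoldt) * mm = 0 := by rw [← h, zero_mul]
  rwa [add_mul, mul_assoc, mul_comm zz, mm_zz, mul_one] at h2

noncomputable def lgk (k : ℕ) : ArithmeticFunction ℝ := Dl^[k] zz

lemma lgk_succ (k : ℕ) : lgk (k + 1) = Dl (lgk k) := by rw [lgk, Function.iterate_succ']; rfl

lemma lgk_apply (k : ℕ) {n : ℕ} (hn : n ≠ 0) : lgk k n = Real.log n ^ k := by
  induction k with
  | zero => simp [lgk, zz_apply hn]
  | succ k ih => rw [lgk_succ, Dl_apply, ih, pow_succ]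

noncomputable def Lk (k : ℕ) : ArithmeticFunction ℝ := mm * lgk k

lemma Lambdak_eq (k n : ℕ) : Lambdak k n = Lk k n := by
  unfold Lambdak Lk
  rw [ArithmeticFunction.mul_apply, Nat.sum_divisorsAntidiagonal (f := fun i j => mm i * lgk k j)]
  refine sum_congr rfl fun d hd => ?_
  have hn := Nat.ne_zero_of_mem_divisors hd
  have hd' := Nat.dvd_of_mem_divisors hd
  rw [mm_apply, lgk_apply, Nat.cast_div hd' (by
    have := Nat.pos_of_mem_divisors hd
    positivity)]
  exact (Nat.div_pos (Nat.le_of_dvd (Nat.pos_of_ne_zero hn) hd') (Nat.pos_of_mem_divisors hd)).ne'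

lemma Lk_zero : Lk 0 = 1 := mm_zz

lemma Lk_succ (k : ℕ) : Lk (k + 1) = Dl (Lk k) + ArithmeticFunction.vonMangoldt * Lk k := by
  unfold Lk
  rw [lgk_succ, Dl_mul, ← mul_assoc, add_right_comm, ← add_mul, Dl_mm, zero_mul, zero_add]

lemma Lk_one : Lk 1 = ArithmeticFunction.vonMangoldt := by
  rw [Lk_succ, Lk_zero, Dl_one, mul_one, zero_add]

lemma Lk_mul_zz (k : ℕ) : Lk k * zz = lgk k := by
  unfold Lk; rw [mul_assoc, mul_comm (lgk k), ← mul_assoc, mm_zz, one_mul]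

lemma Lk_nonneg (k n : ℕ) : 0 ≤ Lk k n := by
  induction k generalizing n with
  | zero => rw [Lk_zero, ArithmeticFunction.one_apply]; split_ifs <;> norm_num
  | succ k ih =>
    rw [Lk_succ, ArithmeticFunction.add_apply, Dl_apply, ArithmeticFunction.mul_apply]
    exact add_nonneg (mul_nonneg (ih n) (Real.log_natCast_nonneg n))
      (sum_nonneg fun p _ => mul_nonneg ArithmeticFunction.vonMangoldt_nonneg (ih _))

lemma Lk_sum (k : ℕ) {n : ℕ} (hn : n ≠ 0) : ∑ d ∈ n.divisors, Lk k d = Real.log n ^ k := by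
  rw [← lgk_apply k hn, ← Lk_mul_zz, zz, ArithmeticFunction.coe_mul_zeta_apply]

lemma Lk_le (k : ℕ) {n : ℕ} (hn : n ≠ 0) : Lk k n ≤ Real.log n ^ k := by
  rw [← Lk_sum k hn]
  exact single_le_sum (f := fun d => Lk k d) (fun d _ => Lk_nonneg k d) (Nat.mem_divisors_self n hn)

lemma lam_pmul_mul (f g : ArithmeticFunction ℝ) :
    lam.pmul (f * g) = lam.pmul f * lam.pmul g := by
  ext n
  simp only [ArithmeticFunction.pmul_apply, ArithmeticFunction.mul_apply, mul_sum]
  refine sum_congr rfl fun p hp => ?_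
  rw [Nat.mem_divisorsAntidiagonal] at hp
  rw [← hp.1, lam_mul]; ring

noncomputable def sqi : ArithmeticFunction ℝ := ⟨fun n => if n ≠ 0 ∧ IsSquare n then 1 else 0, by simp⟩

lemma sqi_apply (n : ℕ) : sqi n = if n ≠ 0 ∧ IsSquare n then 1 else 0 := rfl

lemma sqi_mult : ArithmeticFunction.IsMultiplicative sqi := by
  rw [ArithmeticFunction.IsMultiplicative.iff_ne_zero]
  refine ⟨by simp [sqi_apply], fun {m n} hm hn hmn => ?_⟩
  have key : IsSquare (m * n) ↔ IsSquare m ∧ IsSquare n := by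
    constructor
    · rintro ⟨c, hc⟩
      rw [← sq] at hc
      have hu : IsUnit (gcd m n) := by rw [Nat.isUnit_iff]; exact hmn
      obtain ⟨d, hd⟩ := exists_eq_pow_of_mul_eq_pow hu hc
      have hu' : IsUnit (gcd n m) := by rw [Nat.isUnit_iff]; exact hmn.symm
      obtain ⟨e, he⟩ := exists_eq_pow_of_mul_eq_pow hu' ((mul_comm n m).trans hc)
      exact ⟨⟨d, by rw [hd, sq]⟩, ⟨e, by rw [he, sq]⟩⟩
    · rintro ⟨h1, h2⟩; exact h1.mul h2
  simp only [sqi_apply, key]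
  by_cases h1 : IsSquare m <;> by_cases h2 : IsSquare n <;> simp [h1, h2, hm, hn]

lemma isSquare_prime_pow {p : ℕ} (hp : p.Prime) (i : ℕ) : IsSquare (p ^ i) ↔ Even i := by
  constructor
  · rintro ⟨c, hc⟩
    have h1 : c ∣ p ^ i := ⟨c, hc⟩
    obtain ⟨j, _, rfl⟩ := (Nat.dvd_prime_pow hp).1 h1
    rw [← pow_add] at hc
    exact ⟨j, Nat.pow_right_injective hp.two_le hc⟩
  · rintro ⟨j, rfl⟩; exact ⟨p ^ j, by rw [pow_add]⟩

lemma lam_mul_zz : lam * zz = sqi := by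
  have hz : ArithmeticFunction.IsMultiplicative zz := ArithmeticFunction.isMultiplicative_zeta.natCast
  rw [ArithmeticFunction.IsMultiplicative.eq_iff_eq_on_prime_powers _ (lam_isMult.mul hz) _ sqi_mult]
  intro p i hp
  rw [zz, ArithmeticFunction.coe_mul_zeta_apply, Nat.sum_divisors_prime_pow hp, sqi_apply]
  have e : ∀ j : ℕ, lam (p ^ j) = (-1) ^ j := fun j => by
    rw [lam_apply (pow_ne_zero _ hp.ne_zero), ArithmeticFunction.cardFactors_apply_prime_pow hp]
  simp only [isSquare_prime_pow hp, e, neg_one_geom_sum, pow_ne_zero i hp.ne_zero, ne_eq, not_false_eq_true, true_and]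
  by_cases h : Even i <;> simp [h, Nat.even_add_one]

lemma lam_eq : lam = sqi * mm := by
  rw [← lam_mul_zz, mul_assoc, mul_comm zz, mm_zz, mul_one]

lemma lamLk (k : ℕ) : lam.pmul (Lk k) = lam.pmul mm * lam.pmul (lgk k) := by
  rw [Lk, lam_pmul_mul]

lemma mm_abs (n : ℕ) : |mm n| ≤ 1 := by
  rw [mm_apply]; exact_mod_cast ArithmeticFunction.abs_moebius_le_one

/-- Λ_k(pm) -/
lemma Lk_prime_mul (k : ℕ) {p : ℕ} (hp : p.Prime) {m : ℕ} (hm : m ≠ 0) :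
    Lk k (p * m) = ∑ j ∈ range k, (k.choose j : ℝ) * Real.log p ^ (k - j) * Lk j m +
      if p ∣ m then Lk k m else 0 := by
  set h : ArithmeticFunction ℝ := ⟨fun m => Lk k (p * m) - if p ∣ m then Lk k m else 0, by simp⟩ with hh
  set q : ArithmeticFunction ℝ := ⟨fun m => ∑ j ∈ range k, (k.choose j : ℝ) * Real.log p ^ (k - j) * Lk j m, by simp⟩ with hq
  have key : h * zz = q * zz := by
    ext m
    rcases eq_or_ne m 0 with rfl | hm
    · simp
    rw [zz, ArithmeticFunction.coe_mul_zeta_apply, ArithmeticFunction.coe_mul_zeta_apply]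
    have hpm : p * m ≠ 0 := mul_ne_zero hp.ne_zero hm
    have e1 : ∑ d ∈ m.divisors, q d = Real.log (p * m : ℕ) ^ k - Real.log m ^ k := by
      simp only [hq, ArithmeticFunction.coe_mk]
      rw [sum_comm]
      simp only [← mul_sum, Lk_sum _ hm]
      push_cast
      rw [Real.log_mul (by exact_mod_cast hp.ne_zero) (by exact_mod_cast hm), add_comm (Real.log p), add_pow, sum_range_succ]
      simp only [Nat.sub_self, pow_zero, mul_one, Nat.choose_self, Nat.cast_one]
      rw [add_sub_cancel_right]
      exact sum_congr rfl fun j _ => by ring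
    have e2 : ∑ d ∈ m.divisors, h d = Real.log (p * m : ℕ) ^ k - Real.log m ^ k := by
      simp only [hh, ArithmeticFunction.coe_mk]
      rw [sum_sub_distrib, ← Lk_sum k hpm, ← Lk_sum k hm, ← sum_filter_add_sum_filter_not (p * m).divisors (fun d => p ∣ d),
        ← sum_filter_add_sum_filter_not m.divisors (fun d => p ∣ d) (fun d => Lk k d)]
      have s1 : ∑ d ∈ (p * m).divisors with p ∣ d, Lk k d = ∑ d ∈ m.divisors, Lk k (p * d) := by
        have : (p * m).divisors.filter (fun d => p ∣ d) = m.divisors.image (fun d => p * d) := by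
          ext d
          simp only [mem_filter, Nat.mem_divisors, mem_image]
          constructor
          · rintro ⟨⟨h1, _⟩, ⟨e, rfl⟩⟩
            exact ⟨e, ⟨Nat.dvd_of_mul_dvd_mul_left hp.pos h1, hm⟩, rfl⟩
          · rintro ⟨e, ⟨h1, _⟩, rfl⟩
            exact ⟨⟨Nat.mul_dvd_mul_left p h1, hpm⟩, ⟨e, rfl⟩⟩
        rw [this, sum_image]
        intro a _ b _ hab
        exact Nat.eq_of_mul_eq_mul_left hp.pos hab
      have s2 : (p * m).divisors.filter (fun d => ¬ p ∣ d) = m.divisors.filter (fun d => ¬ p ∣ d) := by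
        ext d
        simp only [mem_filter, Nat.mem_divisors]
        constructor
        · rintro ⟨⟨h1, _⟩, h2⟩
          exact ⟨⟨(Nat.Coprime.dvd_mul_left (((Nat.Prime.coprime_iff_not_dvd hp).2 h2).symm)).1 h1, hm⟩, h2⟩
        · rintro ⟨⟨h1, _⟩, h2⟩
          exact ⟨⟨h1.mul_left p, hpm⟩, h2⟩
      rw [s1, s2, sum_filter (fun d => p ∣ d)]
      ring
    rw [e1, e2]
  have : h = q := by
    have := congrArg (fun f => f * mm) key
    simpa only [mul_assoc, mul_comm zz mm, mm_zz, mul_one] using this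
  have := congrArg (fun f : ArithmeticFunction ℝ => f m) this
  simp only [hh, hq, ArithmeticFunction.coe_mk] at this
  linarith

lemma log_split (B : ℕ) {u v : ℝ} (hu : 1 ≤ u) (hv : 1 ≤ v) :
    1 / (1 + Real.log u) ^ B ≤ (1 + Real.log v) ^ B / (1 + Real.log (u * v)) ^ B := by
  have h1 := Real.log_nonneg hu
  have h2 := Real.log_nonneg hv
  rw [Real.log_mul (by linarith) (by linarith), div_le_div_iff₀ (by positivity) (by positivity), one_mul, ← mul_pow]
  gcongr
  nlinarith

lemma mono_up (B : ℕ) : ∃ K : ℝ, 0 < K ∧ ∀ m y : ℝ, 1 ≤ m → m ≤ y →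
    m / (1 + Real.log m) ^ B ≤ K * y / (1 + Real.log y) ^ B := by
  obtain ⟨K, hK, h⟩ := logpow_le_self B
  refine ⟨K, hK, fun m y hm hmy => ?_⟩
  have hq : 1 ≤ y / m := by rw [le_div_iff₀] <;> linarith
  have h1 := log_split B hm hq
  rw [mul_div_cancel₀ _ (by linarith : m ≠ 0)] at h1
  have hy := Real.log_nonneg (hm.trans hmy)
  calc m / (1 + Real.log m) ^ B = m * (1 / (1 + Real.log m) ^ B) := by ring
    _ ≤ m * ((1 + Real.log (y / m)) ^ B / (1 + Real.log y) ^ B) := by gcongr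
    _ ≤ m * (K * (y / m) / (1 + Real.log y) ^ B) := by gcongr; exact h _ hq
    _ = _ := by field_simp

lemma sqi_sum (F : ℕ → ℝ) (hF : ∀ n, 0 ≤ F n) (N : ℕ) :
    ∑ m ∈ Icc 1 N, sqi m * F m ≤ ∑ d ∈ Icc 1 N, F (d ^ 2) := by
  have e : ∑ m ∈ Icc 1 N, sqi m * F m = ∑ m ∈ Icc 1 N with IsSquare m, F m := by
    rw [sum_filter]
    refine sum_congr rfl fun m hm => ?_
    rw [mem_Icc] at hm
    rw [sqi_apply]
    have h0 : m ≠ 0 := by omega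
    by_cases h : IsSquare m
    · simp [h, h0]
    · simp [h]
  rw [e, ← sum_image (f := F) (g := fun d => d ^ 2) (s := Icc 1 N)]
  · refine sum_le_sum_of_subset_of_nonneg ?_ fun i _ _ => hF i
    intro m hm
    rw [mem_filter, mem_Icc] at hm
    obtain ⟨⟨h1, h2⟩, c, hc⟩ := hm
    have hc0 : 1 ≤ c := by
      rcases Nat.eq_zero_or_pos c with rfl | h
      · omega
      · exact h
    exact mem_image.2 ⟨c, mem_Icc.2 ⟨hc0, by nlinarith⟩, by rw [hc, sq]⟩
  · intro a _ b _ hab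
    exact Nat.pow_left_injective (n := 2) (by norm_num) hab

lemma sq_log_sum (B : ℕ) : ∃ K : ℝ, 0 ≤ K ∧ ∀ N : ℕ,
    ∑ d ∈ Icc 1 N, (1 + Real.log (d ^ 2 : ℕ)) ^ B / ((d ^ 2 : ℕ) : ℝ) ≤ K := by
  obtain ⟨M, hM, h⟩ := logpow_le B (1 / 4) (by norm_num)
  have hs : Summable fun n : ℕ => M * (1 / (n:ℝ) ^ (3 / 2 : ℝ)) :=
    (Real.summable_one_div_nat_rpow.2 (by norm_num)).mul_left M
  refine ⟨∑' n : ℕ, M * (1 / (n:ℝ) ^ (3 / 2 : ℝ)), tsum_nonneg fun n => by positivity, fun N => ?_⟩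
  refine le_trans (sum_le_sum fun d hd => ?_) (hs.sum_le_tsum (Icc 1 N) fun n _ => by positivity)
  have hd1 : (1:ℝ) ≤ d := by exact_mod_cast (mem_Icc.1 hd).1
  have hd0 : (0:ℝ) < d := by linarith
  have := h ((d ^ 2 : ℕ) : ℝ) (by push_cast; exact one_le_pow₀ hd1)
  calc _ ≤ (M * ((d ^ 2 : ℕ) : ℝ) ^ (1 / 4 : ℝ)) / ((d ^ 2 : ℕ) : ℝ) := by gcongr
    _ = M * (1 / (d:ℝ) ^ (3 / 2 : ℝ)) := by
      push_cast
      rw [mul_div_assoc]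
      congr 1
      rw [← Real.rpow_natCast, ← Real.rpow_mul hd0.le, ← Real.rpow_sub hd0, one_div ((d:ℝ) ^ _), ← Real.rpow_neg hd0.le]
      norm_num

lemma lam_sum (B : ℕ) : ∃ C : ℝ, 0 ≤ C ∧ ∀ x : ℝ, 1 ≤ x →
    |∑ n ∈ Icc 1 ⌊x⌋₊, lam n| ≤ C * x / (1 + Real.log x) ^ B := by
  obtain ⟨C, hC, h⟩ := moebius_sum B
  obtain ⟨K, hK, hk⟩ := sq_log_sum B
  refine ⟨C * K, by positivity, fun x hx => ?_⟩
  have hl := Real.log_nonneg hx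
  rw [lam_eq, sum_conv]
  calc _ ≤ ∑ n ∈ Icc 1 ⌊x⌋₊, sqi n * ((C * x / (1 + Real.log x) ^ B) * ((1 + Real.log n) ^ B / n)) := by
        refine (abs_sum_le_sum_abs _ _).trans (sum_le_sum fun n hn => ?_)
        have hn' := mem_Icc_floor (by linarith) hn
        have h0 : 0 ≤ sqi n := by rw [sqi_apply]; split_ifs <;> norm_num
        rw [abs_mul, abs_of_nonneg h0]
        refine mul_le_mul_of_nonneg_left ?_ h0
        have hq : 1 ≤ x / n := by rw [le_div_iff₀] <;> linarith
        simp only [mm_apply]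
        refine (h _ hq).trans ?_
        have h1 := log_split B hq hn'.1
        rw [div_mul_cancel₀ _ (by linarith : (n:ℝ) ≠ 0)] at h1
        calc _ = C * (x / n) * (1 / (1 + Real.log (x / n)) ^ B) := by ring
          _ ≤ C * (x / n) * ((1 + Real.log n) ^ B / (1 + Real.log x) ^ B) := by gcongr
          _ = _ := by ring
    _ ≤ _ := by
        refine (sqi_sum _ (fun n => ?_) _).trans ?_
        · have := Real.log_natCast_nonneg n
          positivity
        · rw [← mul_sum]
          calc _ ≤ (C * x / (1 + Real.log x) ^ B) * K := by gcongr; exact hk _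
            _ = _ := by ring

lemma lamlog_sum (k : ℕ) : ∃ C : ℝ, 0 ≤ C ∧ ∀ x : ℝ, 1 ≤ x →
    |∑ n ∈ Icc 1 ⌊x⌋₊, lam.pmul (lgk k) n| ≤ C * x / (1 + Real.log x) ^ 2 := by
  obtain ⟨C, hC, h⟩ := lam_sum (k + 2)
  obtain ⟨K, hK, hk⟩ := mono_up (k + 2)
  refine ⟨2 * C * K, by positivity, fun x hx => ?_⟩
  have hl := Real.log_nonneg hx
  have hm : 1 ≤ ⌊x⌋₊ := Nat.le_floor (by simpa using hx)
  have h1 := abel_mono (fun n => Real.log n ^ k) (fun n => lam n) (C * (K * x / (1 + Real.log x) ^ (k + 2))) 1 ⌊x⌋₊ hm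
    (fun j h1 h2 => by
      have hj := mem_Icc_floor (by linarith) (mem_Icc.2 ⟨h1, h2⟩)
      have := h j hj.1
      rw [Nat.floor_natCast] at this
      refine this.trans ?_
      rw [mul_div_assoc]
      exact mul_le_mul_of_nonneg_left (hk _ _ hj.1 hj.2) hC)
    (fun n h1 _ => by
      have : (1:ℝ) ≤ n := by exact_mod_cast h1
      have := Real.log_nonneg this
      have : Real.log n ≤ Real.log (n + 1 : ℕ) := Real.log_le_log (by linarith) (by push_cast; linarith)
      gcongr) (by simp)
  have e : ∑ n ∈ Icc 1 ⌊x⌋₊, lam.pmul (lgk k) n = ∑ n ∈ Icc 1 ⌊x⌋₊, Real.log n ^ k * lam n := by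
    refine sum_congr rfl fun n hn => ?_
    rw [ArithmeticFunction.pmul_apply, lgk_apply k (by rw [mem_Icc] at hn; omega), mul_comm]
  rw [e]
  refine h1.trans ?_
  have hfl : Real.log ⌊x⌋₊ ≤ 1 + Real.log x := by
    have := Real.log_le_log (by exact_mod_cast hm) (Nat.floor_le (by linarith : 0 ≤ x))
    linarith
  have := Real.log_natCast_nonneg ⌊x⌋₊
  calc _ ≤ 2 * (1 + Real.log x) ^ k * (C * (K * x / (1 + Real.log x) ^ (k + 2))) := by gcongr
    _ = _ := by rw [pow_add]; field_simp

lemma lamLk_sum (k : ℕ) : ∃ C : ℝ, 0 ≤ C ∧ ∀ x : ℝ, 1 ≤ x →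
    |∑ n ∈ Icc 1 ⌊x⌋₊, lam n * Lk k n| ≤ C * x := by
  obtain ⟨C, hC, h⟩ := lamlog_sum k
  obtain ⟨K, hK, hk⟩ := mert_inv PS.one.mert
  refine ⟨C * K, by positivity, fun x hx => ?_⟩
  have e : ∑ n ∈ Icc 1 ⌊x⌋₊, lam n * Lk k n = ∑ n ∈ Icc 1 ⌊x⌋₊, (lam.pmul mm * lam.pmul (lgk k)) n := by
    rw [← lamLk]; rfl
  rw [e, sum_conv]
  calc _ ≤ ∑ n ∈ Icc 1 ⌊x⌋₊, C * x * (1 / (n:ℝ) * (1 / (1 + Real.log (x / n)) ^ 2)) := by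
        refine (abs_sum_le_sum_abs _ _).trans (sum_le_sum fun n hn => ?_)
        have hn' := mem_Icc_floor (by linarith) hn
        have hq : 1 ≤ x / n := by rw [le_div_iff₀] <;> linarith
        rw [abs_mul, ArithmeticFunction.pmul_apply, abs_mul]
        have := mul_le_one₀ (lam_abs_le n) (abs_nonneg _) (mm_abs n)
        refine (mul_le_mul this (h _ hq) (abs_nonneg _) zero_le_one).trans (le_of_eq ?_)
        ring
    _ ≤ _ := by
        rw [← mul_sum]
        have := hk x hx
        calc _ ≤ C * x * K := by gcongr
          _ = _ := by ring

noncomputable def lpr (n : ℕ) : ℝ := if n.Prime then Real.log n else 0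

lemma lpr_nonneg (n : ℕ) : 0 ≤ lpr n := by
  unfold lpr; split_ifs
  · exact Real.log_natCast_nonneg n
  · rfl

lemma lpr_le (n : ℕ) : lpr n ≤ ArithmeticFunction.vonMangoldt n := by
  unfold lpr; split_ifs with h
  · rw [ArithmeticFunction.vonMangoldt_apply_prime h]
  · exact ArithmeticFunction.vonMangoldt_nonneg

lemma lpr_prime {p : ℕ} (hp : p.Prime) : lpr p = Real.log p := by simp [lpr, hp]

lemma lam_lpr (n : ℕ) : lam n * lpr n = - lpr n := by
  unfold lpr; split_ifs with h
  · rw [lam_prime h]; ring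
  · simp

lemma vm_lpr_sum (x : ℝ) : ∑ n ∈ Icc 1 ⌊x⌋₊, (ArithmeticFunction.vonMangoldt n - lpr n) = Chebyshev.psi x - Chebyshev.theta x := by
  rw [sum_sub_distrib, Chebyshev.psi_eq_sum_Icc, Chebyshev.theta_eq_sum_Icc, sum_filter]
  have : Icc 0 ⌊x⌋₊ = insert 0 (Icc 1 ⌊x⌋₊) := by ext; simp; omega
  rw [this, sum_insert (by simp), sum_insert (by simp)]
  simp [lpr]

lemma vm_lpr_le (B : ℕ) : ∃ C : ℝ, 0 ≤ C ∧ ∀ x : ℝ, 1 ≤ x →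
    ∑ n ∈ Icc 1 ⌊x⌋₊, (ArithmeticFunction.vonMangoldt n - lpr n) ≤ C * x / (1 + Real.log x) ^ B := by
  obtain ⟨M, hM, h⟩ := logpow_le (B + 1) (1 / 2) (by norm_num)
  refine ⟨2 * M, by positivity, fun x hx => ?_⟩
  rw [vm_lpr_sum]
  refine (Chebyshev.psi_sub_theta_le hx).trans ?_
  have hl := Real.log_nonneg hx
  rw [le_div_iff₀ (by positivity)]
  have h1 := h x hx
  rw [← Real.sqrt_eq_rpow] at h1
  have h2 : Real.log x * (1 + Real.log x) ^ B ≤ (1 + Real.log x) ^ (B + 1) := by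
    rw [pow_succ']; gcongr; linarith
  calc _ = 2 * √x * (Real.log x * (1 + Real.log x) ^ B) := by ring
    _ ≤ 2 * √x * (M * √x) := mul_le_mul_of_nonneg_left (h2.trans h1) (by positivity)
    _ = 2 * M * (√x * √x) := by ring
    _ = _ := by rw [Real.mul_self_sqrt (by linarith)]

lemma PS.prm : PS lpr := by
  obtain ⟨C, hC, h⟩ := PS.vM
  obtain ⟨D, hD, h'⟩ := vm_lpr_le 2
  refine ⟨C + D, by positivity, fun x hx => ?_⟩
  have e : ∑ n ∈ Icc 1 ⌊x⌋₊, (lpr n - 1) = ∑ n ∈ Icc 1 ⌊x⌋₊, (ArithmeticFunction.vonMangoldt n - 1)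
    - ∑ n ∈ Icc 1 ⌊x⌋₊, (ArithmeticFunction.vonMangoldt n - lpr n) := by
    rw [← sum_sub_distrib]; exact sum_congr rfl fun n _ => by ring
  rw [e]
  refine (abs_sub _ _).trans ?_
  rw [abs_of_nonneg (sum_nonneg fun n _ => sub_nonneg.2 (lpr_le n) : 0 ≤ ∑ n ∈ Icc 1 ⌊x⌋₊, (ArithmeticFunction.vonMangoldt n - lpr n))]
  have := h x hx
  have := h' x hx
  rw [add_mul, add_div]; linarith

lemma sum_sub_one (c : ℕ → ℝ) (x : ℝ) : ∑ n ∈ Icc 1 ⌊x⌋₊, (c n - 1) = ∑ n ∈ Icc 1 ⌊x⌋₊, c n - ⌊x⌋₊ := by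
  rw [sum_sub_distrib]; simp

lemma PS.real {c : ℕ → ℝ} (h : PS c) : ∃ C : ℝ, 0 ≤ C ∧ ∀ x : ℝ, 1 ≤ x →
    |∑ n ∈ Icc 1 ⌊x⌋₊, c n - x| ≤ C * x / (1 + Real.log x) ^ 2 := by
  obtain ⟨C, hC, h⟩ := h
  obtain ⟨M, hM, hm⟩ := logpow_le_self 2
  refine ⟨C + M, by positivity, fun x hx => ?_⟩
  have h1 := h x hx
  rw [sum_sub_one] at h1
  have hl := Real.log_nonneg hx
  have h2 : 1 ≤ M * x / (1 + Real.log x) ^ 2 := by rw [le_div_iff₀ (by positivity), one_mul]; exact hm x hx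
  have f1 := Nat.floor_le (by linarith : 0 ≤ x)
  have f2 := Nat.lt_floor_add_one x
  rw [abs_le] at h1 ⊢
  rw [add_mul, add_div]
  constructor <;> linarith [h1.1, h1.2]

lemma PS.bound {c : ℕ → ℝ} (h : PS c) : ∃ C : ℝ, 0 ≤ C ∧ ∀ x : ℝ, 1 ≤ x →
    ∑ n ∈ Icc 1 ⌊x⌋₊, c n ≤ C * x := by
  obtain ⟨C, hC, h⟩ := h.real
  refine ⟨C + 1, by positivity, fun x hx => ?_⟩
  have hl := Real.log_nonneg hx
  have h1 := (abs_le.1 (h x hx)).2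
  have h2 : C * x / (1 + Real.log x) ^ 2 ≤ C * x :=
    div_le_self (by positivity) (one_le_pow₀ (by linarith))
  linarith

lemma lamvM_sum : ∃ C : ℝ, 0 ≤ C ∧ ∀ x : ℝ, 1 ≤ x →
    |∑ n ∈ Icc 1 ⌊x⌋₊, lam n * ArithmeticFunction.vonMangoldt n + x| ≤ C * x / (1 + Real.log x) ^ 2 := by
  obtain ⟨C, hC, h⟩ := PS.prm.real
  obtain ⟨D, hD, h'⟩ := vm_lpr_le 2
  refine ⟨C + D, by positivity, fun x hx => ?_⟩
  have e : ∑ n ∈ Icc 1 ⌊x⌋₊, lam n * ArithmeticFunction.vonMangoldt n + x =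
     ∑ n ∈ Icc 1 ⌊x⌋₊, lam n * (ArithmeticFunction.vonMangoldt n - lpr n) - (∑ n ∈ Icc 1 ⌊x⌋₊, lpr n - x) := by
    have : ∑ n ∈ Icc 1 ⌊x⌋₊, lam n * (ArithmeticFunction.vonMangoldt n - lpr n) = 
      ∑ n ∈ Icc 1 ⌊x⌋₊, lam n * ArithmeticFunction.vonMangoldt n + ∑ n ∈ Icc 1 ⌊x⌋₊, lpr n := by
      rw [← sum_add_distrib]
      refine sum_congr rfl fun n _ => ?_
      rw [mul_sub, lam_lpr]; ring
    rw [this]; ring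
  rw [e]
  refine (abs_sub _ _).trans ?_
  have q : |∑ n ∈ Icc 1 ⌊x⌋₊, lam n * (ArithmeticFunction.vonMangoldt n - lpr n)| ≤ 
      ∑ n ∈ Icc 1 ⌊x⌋₊, (ArithmeticFunction.vonMangoldt n - lpr n) := by
    refine (abs_sum_le_sum_abs _ _).trans (sum_le_sum fun n _ => ?_)
    have := sub_nonneg.2 (lpr_le n)
    rw [abs_mul, abs_of_nonneg this]
    exact mul_le_of_le_one_left this (lam_abs_le n)
  have := h x hx
  have := h' x hx
  rw [add_mul, add_div]; linarith

lemma sum_log_quot {x : ℝ} (hx : 1 ≤ x) : ∑ n ∈ Icc 1 ⌊x⌋₊, Real.log (x / n) ≤ 2 * x := by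
  have h : ∀ N : ℕ, N * Real.log N - ∑ n ∈ Icc 1 N, Real.log n ≤ N := by
    intro N
    induction N with
    | zero => simp
    | succ N ih =>
      rw [sum_Icc_succ_top (by omega)]
      rcases Nat.eq_zero_or_pos N with rfl | hN
      · simp
      have hN : (0:ℝ) < N := by exact_mod_cast hN
      have := Real.log_le_sub_one_of_pos (x := ((N + 1 : ℕ) : ℝ) / N) (by positivity)
      rw [Real.log_div (by positivity) (by positivity)] at this
      have e : ((N + 1 : ℕ) : ℝ) / N - 1 = 1 / N := by push_cast; field_simp; ring
      rw [e, le_div_iff₀ hN] at this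
      push_cast at *
      nlinarith
  have e : ∑ n ∈ Icc 1 ⌊x⌋₊, Real.log (x / n) = ⌊x⌋₊ * Real.log x - ∑ n ∈ Icc 1 ⌊x⌋₊, Real.log n := by
    have : ∑ n ∈ Icc 1 ⌊x⌋₊, Real.log (x / n) = ∑ n ∈ Icc 1 ⌊x⌋₊, (Real.log x - Real.log n) := by
      refine sum_congr rfl fun n hn => ?_
      have := mem_Icc_floor (by linarith) hn
      rw [Real.log_div (by linarith) (by linarith)]
    rw [this, sum_sub_distrib]; simp
  have h1 := h ⌊x⌋₊
  have hm : 1 ≤ ⌊x⌋₊ := Nat.le_floor (by simpa using hx)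
  have hm' : (1:ℝ) ≤ ⌊x⌋₊ := by exact_mod_cast hm
  have h2 := (floor_log hx).2
  rw [Real.log_div (by linarith) (by linarith)] at h2
  have f1 := Nat.floor_le (by linarith : 0 ≤ x)
  rw [e]
  nlinarith

lemma Tlog (c : ℕ → ℝ) (j : ℕ) (C : ℝ) (hC : 0 ≤ C)
    (h : ∀ x : ℝ, 1 ≤ x → |∑ n ∈ Icc 1 ⌊x⌋₊, c n| ≤ C * x * (1 + Real.log x) ^ j) (x : ℝ) (hx : 1 ≤ x) :
    |∑ n ∈ Icc 1 ⌊x⌋₊, c n * Real.log (x / n)| ≤ 2 * C * x * (1 + Real.log x) ^ j := by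
  have hx0 : 0 < x := by linarith
  have hl := Real.log_nonneg hx
  have := majorant (fun n => Real.log (x / n)) c (fun _ => C * (1 + Real.log x) ^ j) ⌊x⌋₊
    (fun n h1 h2 => by
      have := log_quot_step hx0 h1
      have := dl_nonneg (n + 1) (by omega)
      linarith) (floor_log hx).1
    (fun m hm => by
      rcases Nat.eq_zero_or_pos m with rfl | hm0
      · simp
      have hm' := mem_Icc_floor hx0.le (mem_Icc.2 ⟨hm0, hm⟩)
      have h1 := h m hm'.1
      rw [Nat.floor_natCast] at h1
      refine h1.trans ?_
      have hlm := Real.log_nonneg hm'.1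
      have := Real.log_le_log (by linarith) hm'.2
      calc _ ≤ C * m * (1 + Real.log x) ^ j := by gcongr
        _ = _ := by simp; ring)
  simp only [mul_comm (c _)]
  refine this.trans ?_
  rw [← sum_mul]
  calc _ ≤ 2 * x * (C * (1 + Real.log x) ^ j) := by gcongr; exact sum_log_quot hx
    _ = _ := by ring

noncomputable def SL (k : ℕ) (x : ℝ) : ℝ := ∑ n ∈ Icc 1 ⌊x⌋₊, Lk k n

lemma SL_rec (k : ℕ) (x : ℝ) (hx : 1 ≤ x) : SL (k + 1) x = Real.log x * SL k x -
    ∑ n ∈ Icc 1 ⌊x⌋₊, Lk k n * Real.log (x / n) + ∑ n ∈ Icc 1 ⌊x⌋₊, ArithmeticFunction.vonMangoldt n * SL k (x / n) := by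
  unfold SL
  rw [← sum_conv, mul_sum, ← sum_sub_distrib, ← sum_add_distrib]
  refine sum_congr rfl fun n hn => ?_
  have := mem_Icc_floor (by linarith) hn
  rw [Lk_succ, ArithmeticFunction.add_apply, Dl_apply, Real.log_div (by linarith) (by linarith)]
  ring

lemma SL_step (j : ℕ) (e : ℝ → ℝ) (C K : ℝ) (hC : 0 ≤ C) (hK : 0 ≤ K)
    (he0 : ∀ y : ℝ, 1 ≤ y → 0 ≤ e y) (he : ∀ y : ℝ, 1 ≤ y → e y * (1 + Real.log y) ≤ (1 + Real.log y) ^ j)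
    (h : ∀ y : ℝ, 1 ≤ y → |SL (j + 1) y - (j + 1) * y * Real.log y ^ j| ≤ C * y * e y)
    (hk : ∀ x : ℝ, 1 ≤ x → ∑ n ∈ Icc 1 ⌊x⌋₊, ArithmeticFunction.vonMangoldt n / n * e (x / n) ≤ K * (1 + Real.log x) ^ j) :
    ∃ C' : ℝ, 0 ≤ C' ∧ ∀ x : ℝ, 1 ≤ x →
      |SL (j + 2) x - (j + 2) * x * Real.log x ^ (j + 1)| ≤ C' * x * (1 + Real.log x) ^ j := by
  obtain ⟨D, hD, hd⟩ := mert_logquot PS.vM.mert j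
  refine ⟨C + 2 * (C + (j + 1)) + (j + 1) * D + C * K, by positivity, fun x hx => ?_⟩
  have hl := Real.log_nonneg hx
  have hx0 : 0 < x := by linarith
  set L := 1 + Real.log x with hL
  have hj := Tlog (fun n => Lk (j + 1) n) j (C + (j + 1)) (by positivity) (fun y hy => by
    have hly := Real.log_nonneg hy
    have h1 := h y hy
    have h2 : e y ≤ (1 + Real.log y) ^ j := (le_mul_of_one_le_right (he0 y hy) (by linarith)).trans (he y hy)
    have h3 := abs_sub_abs_le_abs_sub (SL (j + 1) y) ((j + 1) * y * Real.log y ^ j)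
    rw [abs_of_nonneg (by positivity : 0 ≤ (j + 1) * y * Real.log y ^ j)] at h3
    have h4 : Real.log y ^ j ≤ (1 + Real.log y) ^ j := by gcongr; linarith
    change |SL (j + 1) y| ≤ _
    calc |SL (j + 1) y| ≤ C * y * e y + (j + 1) * y * Real.log y ^ j := by linarith
      _ ≤ C * y * (1 + Real.log y) ^ j + (j + 1) * y * (1 + Real.log y) ^ j := by gcongr
      _ = _ := by ring) x hx
  have t1 : |Real.log x * (SL (j + 1) x - (j + 1) * x * Real.log x ^ j)| ≤ C * x * L ^ j := by
    rw [abs_mul, abs_of_nonneg hl]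
    have h1 := h x hx
    have h2 := he x hx
    have h3 : Real.log x * e x ≤ L ^ j := by
      have := he0 x hx
      nlinarith
    calc _ ≤ Real.log x * (C * x * e x) := by gcongr
      _ = C * x * (Real.log x * e x) := by ring
      _ ≤ _ := by gcongr
  have t2 : |∑ n ∈ Icc 1 ⌊x⌋₊, ArithmeticFunction.vonMangoldt n * SL (j + 1) (x / n) - x * Real.log x ^ (j + 1)|
      ≤ ((j + 1) * D + C * K) * x * L ^ j := by
    have e1 : ∑ n ∈ Icc 1 ⌊x⌋₊, ArithmeticFunction.vonMangoldt n * SL (j + 1) (x / n) - x * Real.log x ^ (j + 1) =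
       ∑ n ∈ Icc 1 ⌊x⌋₊, ArithmeticFunction.vonMangoldt n * (SL (j + 1) (x / n) - (j + 1) * (x / n) * Real.log (x / n) ^ j)
       + (j + 1) * x * (∑ n ∈ Icc 1 ⌊x⌋₊, ArithmeticFunction.vonMangoldt n / n * Real.log (x / n) ^ j - Real.log x ^ (j + 1) / (j + 1)) := by
      simp only [mul_sub, sum_sub_distrib, mul_sum]
      have a1 : (j + 1) * x * (Real.log x ^ (j + 1) / (j + 1)) = x * Real.log x ^ (j + 1) := by field_simp
      have a2 : ∀ n : ℕ, ArithmeticFunction.vonMangoldt n * ((j + 1) * (x / n) * Real.log (x / n) ^ j) =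
        (j + 1) * x * (ArithmeticFunction.vonMangoldt n / n * Real.log (x / n) ^ j) := fun n => by ring
      simp only [a1, a2]; ring
    rw [e1]
    refine (abs_add_le _ _).trans ?_
    have b1 : |∑ n ∈ Icc 1 ⌊x⌋₊, ArithmeticFunction.vonMangoldt n * (SL (j + 1) (x / n) - (j + 1) * (x / n) * Real.log (x / n) ^ j)|
       ≤ C * x * (K * L ^ j) := by
      calc _ ≤ ∑ n ∈ Icc 1 ⌊x⌋₊, C * x * (ArithmeticFunction.vonMangoldt n / n * e (x / n)) := by
            refine (abs_sum_le_sum_abs _ _).trans (sum_le_sum fun n hn => ?_)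
            rw [mem_Icc] at hn
            have hq := quot_ge_one hn.1 hn.2 hx0.le
            rw [abs_mul, abs_of_nonneg ArithmeticFunction.vonMangoldt_nonneg]
            calc _ ≤ ArithmeticFunction.vonMangoldt n * (C * (x / n) * e (x / n)) :=
                  mul_le_mul_of_nonneg_left (h _ hq) ArithmeticFunction.vonMangoldt_nonneg
              _ = _ := by ring
        _ ≤ _ := by
            rw [← mul_sum]
            exact mul_le_mul_of_nonneg_left (hk x hx) (by positivity)
    have b2 := hd x hx
    rw [abs_mul, abs_of_nonneg (by positivity : 0 ≤ (j + 1) * x)]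
    calc _ ≤ C * x * (K * L ^ j) + (j + 1) * x * (D * L ^ j) := by gcongr
      _ = _ := by ring
  rw [SL_rec _ _ hx]
  have e2 : Real.log x * SL (j + 1) x - ∑ n ∈ Icc 1 ⌊x⌋₊, Lk (j + 1) n * Real.log (x / n) +
      ∑ n ∈ Icc 1 ⌊x⌋₊, ArithmeticFunction.vonMangoldt n * SL (j + 1) (x / n) - (j + 2) * x * Real.log x ^ (j + 1) =
      Real.log x * (SL (j + 1) x - (j + 1) * x * Real.log x ^ j) - ∑ n ∈ Icc 1 ⌊x⌋₊, Lk (j + 1) n * Real.log (x / n)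
      + (∑ n ∈ Icc 1 ⌊x⌋₊, ArithmeticFunction.vonMangoldt n * SL (j + 1) (x / n) - x * Real.log x ^ (j + 1)) := by ring
  rw [e2]
  refine (abs_add_le _ _).trans ((add_le_add (abs_sub _ _) le_rfl).trans ?_)
  linarith

lemma SL_one : ∃ C : ℝ, 0 ≤ C ∧ ∀ x : ℝ, 1 ≤ x → |SL 1 x - x| ≤ C * x * (1 / (1 + Real.log x) ^ 2) := by
  obtain ⟨C, hC, h⟩ := PS.vM.real
  refine ⟨C, hC, fun x hx => ?_⟩
  have := h x hx
  rw [SL, Lk_one, mul_one_div]; exact this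

lemma SL_asymp (j : ℕ) : ∃ C : ℝ, 0 ≤ C ∧ ∀ x : ℝ, 1 ≤ x →
      |SL (j + 2) x - (j + 2) * x * Real.log x ^ (j + 1)| ≤ C * x * (1 + Real.log x) ^ j := by
  induction j with
  | zero =>
    obtain ⟨C, hC, h⟩ := SL_one
    obtain ⟨K, hK, hk⟩ := mert_inv PS.vM.mert
    have := SL_step 0 (fun x => 1 / (1 + Real.log x) ^ 2) C K hC hK (fun y hy => by positivity)
      (fun y hy => by
        have := Real.log_nonneg hy
        rw [pow_zero, div_mul_eq_mul_div, one_mul, div_le_one (by positivity)]; nlinarith)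
      (fun y hy => by simpa using h y hy) (fun x hx => by simpa using hk x hx)
    simpa using this
  | succ j ih =>
    obtain ⟨C, hC, h⟩ := ih
    obtain ⟨K, hK, hk⟩ := mert_logquot PS.vM.mert 0
    refine SL_step (j + 1) (fun x => (1 + Real.log x) ^ j) C (K + 1) hC (by positivity)
      (fun y hy => by have := Real.log_nonneg hy; positivity) (fun y hy => by rw [pow_succ])
      (fun y hy => by
        have := h y hy
        push_cast
        have e : (j:ℝ) + 1 + 1 = j + 2 := by ring
        rw [e]; exact this) (fun x hx => ?_)
    have hl := Real.log_nonneg hx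
    have h1 := (abs_le.1 (hk x hx)).2
    simp only [pow_zero, mul_one, zero_add, pow_one, CharP.cast_eq_zero, div_one] at h1
    calc _ ≤ ∑ n ∈ Icc 1 ⌊x⌋₊, ArithmeticFunction.vonMangoldt n / n * (1 + Real.log x) ^ j := by
          refine sum_le_sum fun n hn => ?_
          have hn' := mem_Icc_floor (by linarith) hn
          have hq : 1 ≤ x / n := by rw [le_div_iff₀] <;> linarith
          have := Real.log_nonneg hq
          have : Real.log (x / n) ≤ Real.log x := Real.log_le_log (by linarith) (div_le_self (by linarith) hn'.1)
          have := ArithmeticFunction.vonMangoldt_nonneg (n := n)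
          gcongr
      _ ≤ (K + 1) * (1 + Real.log x) * (1 + Real.log x) ^ j := by
          rw [← sum_mul]
          gcongr
          nlinarith
      _ = _ := by ring

/-- upper bound -/
lemma SL_le (j : ℕ) : ∃ C : ℝ, 0 ≤ C ∧ ∀ x : ℝ, 1 ≤ x → |SL (j + 1) x| ≤ C * x * (1 + Real.log x) ^ j := by
  rcases j with _ | j
  · obtain ⟨C, hC, h⟩ := PS.vM.bound
    refine ⟨C, hC, fun x hx => ?_⟩
    rw [SL, abs_of_nonneg (sum_nonneg fun n _ => Lk_nonneg _ n), zero_add, Lk_one, pow_zero, mul_one]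
    exact h x hx
  · obtain ⟨C, hC, h⟩ := SL_asymp j
    refine ⟨C + (j + 2), by positivity, fun x hx => ?_⟩
    have hl := Real.log_nonneg hx
    have h3 := abs_sub_abs_le_abs_sub (SL (j + 2) x) ((j + 2) * x * Real.log x ^ (j + 1))
    rw [abs_of_nonneg (by positivity : 0 ≤ (j + 2) * x * Real.log x ^ (j + 1))] at h3
    have h4 : Real.log x ^ (j + 1) ≤ (1 + Real.log x) ^ (j + 1) := by gcongr; linarith
    have h5 : (1 + Real.log x) ^ j ≤ (1 + Real.log x) ^ (j + 1) := pow_le_pow_right₀ (by linarith) (by omega)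
    calc |SL (j + 2) x| ≤ C * x * (1 + Real.log x) ^ j + (j + 2) * x * Real.log x ^ (j + 1) := by linarith [h x hx]
      _ ≤ C * x * (1 + Real.log x) ^ (j + 1) + (j + 2) * x * (1 + Real.log x) ^ (j + 1) := by gcongr
      _ = _ := by ring

lemma sum_dvd (f : ℕ → ℝ) (D t : ℕ) (hD : 1 ≤ D) :
    ∑ n ∈ Icc 1 t, (if D ∣ n then f n else 0) = ∑ m ∈ Icc 1 (t / D), f (D * m) := by
  rw [← sum_filter]
  symm
  refine sum_bij (fun m _ => D * m) ?_ ?_ ?_ ?_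
  · intro m hm
    rw [mem_Icc] at hm
    rw [mem_filter, mem_Icc]
    have h1 : D * m ≤ t := by
      have := (Nat.le_div_iff_mul_le hD).1 hm.2
      rwa [mul_comm] at this
    exact ⟨⟨Nat.mul_pos hD hm.1, h1⟩, dvd_mul_right _ _⟩
  · intro a _ b _ h
    exact Nat.eq_of_mul_eq_mul_left hD h
  · intro n hn
    rw [mem_filter, mem_Icc] at hn
    obtain ⟨⟨h1, h2⟩, m, rfl⟩ := hn
    refine ⟨m, ?_, rfl⟩
    rw [mem_Icc, Nat.le_div_iff_mul_le hD, mul_comm m]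
    exact ⟨Nat.pos_of_mul_pos_left h1, h2⟩
  · intro m _; rfl

lemma lam_dvd_sum (B : ℕ) (κ : ℝ) (h0 : 0 < κ) (h1 : κ ≤ 1) : ∃ K : ℝ, 0 ≤ K ∧ ∀ (x : ℝ) (D t : ℕ), 1 ≤ x → 1 ≤ D →
    (D:ℝ) ≤ x ^ (1 - κ) → t ≤ ⌊x⌋₊ →
    |∑ n ∈ Icc 1 t, (if D ∣ n then lam n else 0)| ≤ K * (x / D) / (1 + Real.log x) ^ B := by
  obtain ⟨C, hC, h⟩ := lam_sum B
  obtain ⟨K, hK, hk⟩ := mono_up B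
  refine ⟨C * K / κ ^ B, by positivity, fun x D t hx hD hDx ht => ?_⟩
  have hx0 : 0 < x := by linarith
  have hl := Real.log_nonneg hx
  have hD0 : (0:ℝ) < D := by exact_mod_cast hD
  rw [sum_dvd _ _ _ hD]
  simp only [lam_mul]
  rw [← mul_sum, abs_mul, lam_abs (by omega), one_mul]
  rcases Nat.eq_zero_or_pos (t / D) with e | e
  · rw [e]; simp; positivity
  have e1 : t / D = ⌊((t / D : ℕ):ℝ)⌋₊ := by simp
  have ht1 : (1:ℝ) ≤ ((t / D : ℕ):ℝ) := by exact_mod_cast e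
  have ht2 : ((t / D : ℕ):ℝ) ≤ x / D := by
    refine Nat.cast_div_le.trans ?_
    gcongr
    exact (Nat.le_floor_iff hx0.le).1 ht
  have h2 := h _ ht1
  rw [← e1] at h2
  refine h2.trans ?_
  have hq : 1 ≤ x / D := ht1.trans ht2
  have hlq : κ * (1 + Real.log x) ≤ 1 + Real.log (x / D) := by
    rw [Real.log_div hx0.ne' hD0.ne']
    have := Real.log_le_log hD0 hDx
    rw [Real.log_rpow hx0] at this
    nlinarith
  calc C * ((t / D : ℕ):ℝ) / (1 + Real.log ((t / D : ℕ):ℝ)) ^ B = C * (((t / D : ℕ):ℝ) / (1 + Real.log ((t / D : ℕ):ℝ)) ^ B) := by ring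
    _ ≤ C * (K * (x / D) / (1 + Real.log (x / D)) ^ B) := mul_le_mul_of_nonneg_left (hk _ _ ht1 ht2) hC
    _ ≤ C * (K * (x / D) / (κ * (1 + Real.log x)) ^ B) := by gcongr
    _ = _ := by rw [mul_pow]; field_simp

/-- G -/
noncomputable def GG (N n : ℕ) : ℝ := ∑ p ∈ n.divisors, if p ^ N ≤ n then lpr p else 0

lemma GG_nonneg (N n : ℕ) : 0 ≤ GG N n := sum_nonneg fun p _ => by
  split_ifs
  · exact lpr_nonneg p
  · rfl

lemma lpr_div_sum (n : ℕ) : ∑ p ∈ n.divisors, lpr p ≤ Real.log n := by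
  rw [← ArithmeticFunction.vonMangoldt_sum]
  exact sum_le_sum fun p _ => lpr_le p

lemma GG_le (N n : ℕ) : GG N n ≤ Real.log n := by
  refine le_trans (sum_le_sum fun p _ => ?_) (lpr_div_sum n)
  split_ifs
  · rfl
  · exact lpr_nonneg p

lemma gg_nonneg (N n : ℕ) : 0 ≤ GG N n / Real.log n := div_nonneg (GG_nonneg N n) (Real.log_natCast_nonneg n)

lemma gg_le (N n : ℕ) : GG N n / Real.log n ≤ 1 := div_le_one_of_le₀ (GG_le N n) (Real.log_natCast_nonneg n)

noncomputable def aseq (N n : ℕ) : ℝ := 1 - 1 / 2 * lam n * (1 - GG N n / Real.log n)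

lemma aseq_mem (N n : ℕ) : 0 ≤ aseq N n ∧ aseq N n ≤ 2 := by
  have h1 := gg_nonneg N n
  have h2 := gg_le N n
  have h3 : |1 / 2 * lam n * (1 - GG N n / Real.log n)| ≤ 1 := by
    rw [abs_mul, abs_mul, abs_of_nonneg (by linarith : 0 ≤ 1 - GG N n / Real.log n)]
    have := lam_abs_le n
    have := abs_nonneg (lam n)
    rw [abs_of_nonneg (by norm_num : (0:ℝ) ≤ 1 / 2)]
    nlinarith
  unfold aseq
  rw [abs_le] at h3
  constructor <;> linarith [h3.1, h3.2]

/-- G as a sum over all p ≤ P -/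
lemma GG_eq (N M P n : ℕ) (hN : 1 ≤ N) (hP : ∀ p, p ^ N ≤ M → p ≤ P) (hn : 1 ≤ n) (hnM : n ≤ M) :
    GG N n = ∑ p ∈ Icc 1 P, lpr p * (if p ∣ n ∧ p ^ N ≤ n then 1 else 0) := by
  unfold GG
  rw [← sum_filter]
  have : ∀ p, lpr p * (if p ∣ n ∧ p ^ N ≤ n then 1 else 0) = if p ∣ n ∧ p ^ N ≤ n then lpr p else 0 := fun p => by
    split_ifs <;> simp
  simp only [this]
  rw [← sum_filter]
  refine sum_congr ?_ fun _ _ => rfl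
  ext p
  simp only [mem_filter, Nat.mem_divisors, mem_Icc]
  constructor
  · rintro ⟨⟨h1, h2⟩, h3⟩
    exact ⟨⟨Nat.pos_of_dvd_of_pos h1 hn, hP p (h3.trans hnM)⟩, h1, h3⟩
  · rintro ⟨⟨h1, h2⟩, h3, h4⟩
    exact ⟨⟨h3, by omega⟩, h4⟩

lemma GG_sum (N M P : ℕ) (hN : 1 ≤ N) (hP : ∀ p, p ^ N ≤ M → p ≤ P) (hP' : P ^ N ≤ M) (f : ℕ → ℝ) :
    ∑ n ∈ Icc 1 M, f n * GG N n = ∑ p ∈ Icc 1 P, lpr p * ∑ n ∈ Icc (p ^ N) M, (if p ∣ n then f n else 0) := by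
  have e : ∑ n ∈ Icc 1 M, f n * GG N n = ∑ n ∈ Icc 1 M, ∑ p ∈ Icc 1 P, lpr p * (if p ∣ n ∧ p ^ N ≤ n then f n else 0) := by
    refine sum_congr rfl fun n hn => ?_
    rw [mem_Icc] at hn
    rw [GG_eq N M P n hN hP hn.1 hn.2, mul_sum]
    refine sum_congr rfl fun p _ => ?_
    split_ifs <;> ring
  rw [e, sum_comm]
  refine sum_congr rfl fun p hp => ?_
  rw [← mul_sum]
  congr 1
  rw [mem_Icc] at hp
  have h1 : 1 ≤ p ^ N := Nat.one_le_pow _ _ hp.1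
  have : Icc (p ^ N) M = (Icc 1 M).filter (fun n => p ^ N ≤ n) := by
    ext n; simp only [mem_Icc, mem_filter]; constructor
    · rintro ⟨a, b⟩; exact ⟨⟨h1.trans a, b⟩, a⟩
    · rintro ⟨⟨a, b⟩, c⟩; exact ⟨c, b⟩
  rw [this, sum_filter]
  refine sum_congr rfl fun n _ => ?_
  by_cases a : p ∣ n <;> by_cases b : p ^ N ≤ n <;> simp [a, b]

lemma root_iff {x : ℝ} (hx : 1 ≤ x) {N : ℕ} (hN : 1 ≤ N) (p : ℕ) : p ≤ ⌊x ^ ((N:ℝ)⁻¹)⌋₊ ↔ p ^ N ≤ ⌊x⌋₊ := by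
  rw [Nat.le_floor_iff (by positivity), Nat.le_floor_iff (by positivity),
    Real.le_rpow_inv_iff_of_pos (by positivity) (by positivity) (by positivity), Real.rpow_natCast]
  push_cast; rfl

lemma Icc_diff (f : ℕ → ℝ) (a m : ℕ) (ha : 1 ≤ a) (ham : a ≤ m) :
    ∑ n ∈ Icc a m, f n = ∑ n ∈ Icc 1 m, f n - ∑ n ∈ Icc 1 (a - 1), f n := by
  have : Icc 1 m = Icc 1 (a - 1) ∪ Icc a m := by ext; simp only [mem_union, mem_Icc]; omega
  rw [this, sum_union]
  · ring
  · rw [disjoint_left]; intro n; simp only [mem_Icc]; omega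

lemma inner_R (B : ℕ) (κ : ℝ) (h0 : 0 < κ) (h1 : κ ≤ 1) : ∃ K : ℝ, 0 ≤ K ∧ ∀ (x : ℝ) (N d p : ℕ), 1 ≤ x → 2 ≤ N → 1 ≤ d →
    p.Prime → p ^ N ≤ ⌊x⌋₊ → (d:ℝ) * p ≤ x ^ (1 - κ) →
    |∑ n ∈ Icc (p ^ N) ⌊x⌋₊, (if p ∣ n then (if d ∣ n then lam n / Real.log n else 0) else 0)| ≤
      K * (x / (d.lcm p : ℕ)) / (1 + Real.log x) ^ B := by
  obtain ⟨K, hK, hk⟩ := lam_dvd_sum B κ h0 h1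
  refine ⟨2 * K, by positivity, fun x N d p hx hN hd hp hpx hdp => ?_⟩
  have hp2 := hp.two_le
  have h4 : 4 ≤ p ^ N := by
    calc 4 = 2 ^ 2 := by norm_num
      _ ≤ p ^ 2 := Nat.pow_le_pow_left hp2 2
      _ ≤ p ^ N := Nat.pow_le_pow_right (by omega) hN
  have hlog4 : 1 ≤ Real.log ((p ^ N : ℕ):ℝ) := by
    have : Real.log 4 ≤ Real.log ((p ^ N : ℕ):ℝ) := Real.log_le_log (by norm_num) (by exact_mod_cast h4)
    have e : (4:ℝ) = 2 ^ 2 := by norm_num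
    rw [e, Real.log_pow] at this
    have := Real.log_two_gt_d9
    push_cast at *
    linarith
  set D := d.lcm p with hD
  have hD1 : 1 ≤ D := Nat.lcm_pos hd hp.pos
  have hDle : (D:ℝ) ≤ x ^ (1 - κ) := by
    refine le_trans ?_ hdp
    exact_mod_cast Nat.le_of_dvd (Nat.mul_pos hd hp.pos) (Nat.lcm_dvd_mul d p)
  have e : ∑ n ∈ Icc (p ^ N) ⌊x⌋₊, (if p ∣ n then (if d ∣ n then lam n / Real.log n else 0) else 0)
      = ∑ n ∈ Icc (p ^ N) ⌊x⌋₊, 1 / Real.log n * (if D ∣ n then lam n else 0) := by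
    refine sum_congr rfl fun n _ => ?_
    have : D ∣ n ↔ d ∣ n ∧ p ∣ n := Nat.lcm_dvd_iff
    by_cases a : p ∣ n <;> by_cases b : d ∣ n <;> simp [this, a, b]
    field_simp
  rw [e]
  have hL := Real.log_nonneg hx
  have hQ : 0 ≤ K * (x / D) / (1 + Real.log x) ^ B := by positivity
  have := abel_anti (fun n => 1 / Real.log n) (fun n => if D ∣ n then lam n else 0) (2 * (K * (x / D) / (1 + Real.log x) ^ B)) (p ^ N) ⌊x⌋₊ hpx
    (fun m hm hm' => by
      rw [Icc_diff _ _ _ (by omega) hm]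
      refine (abs_sub _ _).trans ?_
      have a1 := hk x D m hx hD1 hDle hm'
      have a2 := hk x D (p ^ N - 1) hx hD1 hDle (by omega)
      linarith)
    (fun n hn hn' => by
      have h5 : (4:ℝ) ≤ n := by exact_mod_cast h4.trans hn
      refine one_div_le_one_div_of_le (Real.log_pos (by linarith)) (Real.log_le_log (by linarith) (by push_cast; linarith)))
    (by have := Real.log_natCast_nonneg ⌊x⌋₊; positivity)
  refine this.trans ?_
  have h6 : 1 / Real.log ((p ^ N : ℕ):ℝ) ≤ 1 := by rw [div_le_one (by linarith)]; exact hlog4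
  calc _ ≤ 1 * (2 * (K * (x / D) / (1 + Real.log x) ^ B)) := mul_le_mul_of_nonneg_right h6 (by positivity)
    _ = _ := by ring

lemma lpr_mert : ∃ C : ℝ, 0 ≤ C ∧ ∀ m : ℕ, 1 ≤ m → ∑ p ∈ Icc 1 m, lpr p / p ≤ C * (1 + Real.log m) := by
  obtain ⟨C, hC, h⟩ := mert_log PS.prm.mert 0
  refine ⟨C + 1, by positivity, fun m hm => ?_⟩
  have := (abs_le.1 (h m hm)).2
  have := Real.log_natCast_nonneg m
  simp at *
  nlinarith

lemma inv_lcm_le (d p : ℕ) (hd : 1 ≤ d) (hp : p.Prime) :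
    1 / ((d.lcm p : ℕ):ℝ) ≤ 1 / d * (1 / p) + 1 / d * (if p ∣ d then 1 else 0) := by
  have hd0 : (0:ℝ) < d := by exact_mod_cast hd
  have hp0 : (0:ℝ) < p := by exact_mod_cast hp.pos
  split_ifs with h
  · rw [Nat.lcm_eq_left h]
    have : 0 ≤ 1 / (d:ℝ) * (1 / p) := by positivity
    linarith
  · have : Nat.Coprime d p := ((Nat.Prime.coprime_iff_not_dvd hp).2 h).symm
    rw [this.lcm_eq_mul]
    push_cast
    rw [mul_zero, add_zero, one_div_mul_one_div]

lemma lcm_sum : ∃ C : ℝ, 0 ≤ C ∧ ∀ (x : ℝ) (Q P : ℕ), 1 ≤ x → 1 ≤ P → (Q:ℝ) ≤ x → (P:ℝ) ≤ x →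
    ∑ d ∈ Icc 1 Q, ∑ p ∈ Icc 1 P, lpr p * (1 / ((d.lcm p : ℕ):ℝ)) ≤ C * (1 + Real.log x) ^ 2 := by
  obtain ⟨C, hC, h⟩ := lpr_mert
  refine ⟨C + 1, by positivity, fun x Q P hx hP hQx hPx => ?_⟩
  have hl := Real.log_nonneg hx
  have hP0 : (0:ℝ) < P := by exact_mod_cast hP
  have hin : ∀ d ∈ Icc 1 Q, ∑ p ∈ Icc 1 P, lpr p * (1 / ((d.lcm p : ℕ):ℝ)) ≤ 1 / d * ((C + 1) * (1 + Real.log x)) := by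
    intro d hd
    rw [mem_Icc] at hd
    have hd0 : (0:ℝ) < d := by exact_mod_cast hd.1
    calc ∑ p ∈ Icc 1 P, lpr p * (1 / ((d.lcm p : ℕ):ℝ))
        ≤ ∑ p ∈ Icc 1 P, (1 / d * (lpr p / p) + 1 / d * (if p ∣ d then lpr p else 0)) := by
          refine sum_le_sum fun p _ => ?_
          by_cases hp : p.Prime
          · have := mul_le_mul_of_nonneg_left (inv_lcm_le d p hd.1 hp) (lpr_nonneg p)
            refine this.trans (le_of_eq ?_)
            split_ifs <;> ring
          · simp [lpr, hp]
      _ = 1 / d * (∑ p ∈ Icc 1 P, lpr p / p + ∑ p ∈ Icc 1 P, if p ∣ d then lpr p else 0) := by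
          rw [sum_add_distrib, ← mul_sum, ← mul_sum]; ring
      _ ≤ _ := by
          have h2 : ∑ p ∈ Icc 1 P, (if p ∣ d then lpr p else 0) ≤ Real.log d := by
            rw [← sum_filter]
            refine le_trans (sum_le_sum_of_subset_of_nonneg ?_ fun p _ _ => lpr_nonneg p) (lpr_div_sum d)
            intro p hp
            rw [mem_filter] at hp
            rw [Nat.mem_divisors]
            exact ⟨hp.2, by omega⟩
          have h3 : Real.log d ≤ Real.log x := Real.log_le_log hd0 (le_trans (by exact_mod_cast hd.2) hQx)
          have h4 : Real.log P ≤ Real.log x := Real.log_le_log hP0 hPx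
          have h5 := h P hP
          gcongr
          nlinarith
  refine (sum_le_sum hin).trans ?_
  rw [← sum_mul]
  have h6 : ∑ d ∈ Icc 1 Q, 1 / (d:ℝ) ≤ 1 + Real.log x := by
    refine le_trans (sum_le_sum_of_subset_of_nonneg (Icc_subset_Icc_right ?_) fun d _ _ => by positivity) (sum_inv_le hx)
    exact Nat.le_floor hQx
  calc _ ≤ (1 + Real.log x) * ((C + 1) * (1 + Real.log x)) := by gcongr
    _ = _ := by ring

lemma aseq_R (ν : ℝ) (hν : ν ∈ Set.Ioo (0 : ℝ) 1) (N : ℕ) (hN2 : 2 ≤ N) (hN : (N:ℝ)⁻¹ ≤ (1 - ν) / 2) :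
    Rcond ν (aseq N) := by
  obtain ⟨hν0, hν1⟩ := hν
  intro B hB
  set b := ⌈B⌉₊ with hb
  set κ := (1 - ν) / 2 with hκ
  obtain ⟨K1, hK1, h1⟩ := lam_dvd_sum (b + 2) κ (by rw [hκ]; linarith) (by rw [hκ]; linarith)
  obtain ⟨K2, hK2, h2⟩ := inner_R (b + 2) κ (by rw [hκ]; linarith) (by rw [hκ]; linarith)
  obtain ⟨C, hC, h3⟩ := lcm_sum
  obtain ⟨M, hM, h4⟩ := logpow_le b (1 - ν) (by linarith)
  refine ⟨M + K1 + K2 * C, fun x hx2 => ?_⟩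
  have hx : 1 ≤ x := by linarith
  have hx0 : 0 < x := by linarith
  have hlog : 0 < Real.log x := Real.log_pos (by linarith)
  set L := 1 + Real.log x with hL
  have hL1 : 1 ≤ L := by linarith
  have hL0 : 0 < L := by linarith
  set P := ⌊x ^ ((N:ℝ)⁻¹)⌋₊ with hP
  have hroot := fun p => root_iff hx (by omega : 1 ≤ N) p
  have hP1 : 1 ≤ P := by rw [hroot, one_pow]; exact Nat.le_floor (by simpa using hx)
  have hN1 : (N:ℝ)⁻¹ ≤ 1 := by linarith
  have hPx : (P:ℝ) ≤ x ^ ((N:ℝ)⁻¹) := Nat.floor_le (by positivity)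
  have hPx' : (P:ℝ) ≤ x := hPx.trans (by simpa using Real.rpow_le_rpow_of_exponent_le hx hN1)
  set Q := ⌊x ^ ν⌋₊ with hQ
  have hQx : (Q:ℝ) ≤ x ^ ν := Nat.floor_le (by positivity)
  have hQx' : (Q:ℝ) ≤ x := hQx.trans (by simpa using Real.rpow_le_rpow_of_exponent_le hx hν1.le)
  have key : ∀ d ∈ Icc 1 Q, |(∑ n ∈ (Icc 1 ⌊x⌋₊).filter (fun n => d ∣ n), aseq N n) - x / d| ≤
      1 + K1 * (x / L ^ (b + 2)) * (1 / (d:ℝ)) + K2 * (x / L ^ (b + 2)) * ∑ p ∈ Icc 1 P, lpr p * (1 / ((d.lcm p : ℕ):ℝ)) := by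
    intro d hd
    rw [mem_Icc] at hd
    have hd0 : (0:ℝ) < d := by exact_mod_cast hd.1
    have hdx : (d:ℝ) ≤ x ^ ν := le_trans (by exact_mod_cast hd.2) hQx
    have e : (∑ n ∈ (Icc 1 ⌊x⌋₊).filter (fun n => d ∣ n), aseq N n) - x / d =
      (∑ n ∈ Icc 1 ⌊x⌋₊, (if d ∣ n then 1 else 0) - x / d) - 1 / 2 * ∑ n ∈ Icc 1 ⌊x⌋₊, (if d ∣ n then lam n else 0)
      + 1 / 2 * ∑ n ∈ Icc 1 ⌊x⌋₊, (if d ∣ n then lam n / Real.log n else 0) * GG N n := by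
      rw [sum_filter, mul_sum, mul_sum]
      have : ∀ n ∈ Icc 1 ⌊x⌋₊, (if d ∣ n then aseq N n else 0) = (if d ∣ n then 1 else 0) - 1 / 2 * (if d ∣ n then lam n else 0)
        + 1 / 2 * ((if d ∣ n then lam n / Real.log n else 0) * GG N n) := by
        intro n _
        unfold aseq
        split_ifs <;> ring
      rw [sum_congr rfl this, sum_add_distrib, sum_sub_distrib]; ring
    have a1 : |∑ n ∈ Icc 1 ⌊x⌋₊, (if d ∣ n then (1:ℝ) else 0) - x / d| ≤ 1 := by
      rw [sum_dvd (fun _ => (1:ℝ)) _ _ hd.1, ← Nat.floor_div_natCast]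
      simp only [sum_const, Nat.card_Icc, nsmul_eq_mul, mul_one, add_tsub_cancel_right]
      have f1 := Nat.floor_le (by positivity : 0 ≤ x / d)
      have f2 := Nat.lt_floor_add_one (x / d)
      rw [abs_le]; constructor <;> linarith
    have a2 := h1 x d ⌊x⌋₊ hx hd.1 (hdx.trans (Real.rpow_le_rpow_of_exponent_le hx (by rw [hκ]; linarith))) le_rfl
    have a3 : |∑ n ∈ Icc 1 ⌊x⌋₊, (if d ∣ n then lam n / Real.log n else 0) * GG N n| ≤
        K2 * (x / L ^ (b + 2)) * ∑ p ∈ Icc 1 P, lpr p * (1 / ((d.lcm p : ℕ):ℝ)) := by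
      rw [GG_sum N ⌊x⌋₊ P (by omega) (fun p hp => (hroot p).2 hp) ((hroot P).1 le_rfl), mul_sum]
      refine (abs_sum_le_sum_abs _ _).trans (sum_le_sum fun p hp => ?_)
      rw [abs_mul, abs_of_nonneg (lpr_nonneg p)]
      rw [mem_Icc] at hp
      by_cases hpp : p.Prime
      · have hpP : (p:ℝ) ≤ x ^ ((N:ℝ)⁻¹) := le_trans (by exact_mod_cast hp.2) hPx
        have := h2 x N d p hx hN2 hd.1 hpp ((hroot p).1 hp.2) (by
          calc (d:ℝ) * p ≤ x ^ ν * x ^ ((N:ℝ)⁻¹) := by gcongr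
            _ = x ^ (ν + (N:ℝ)⁻¹) := by rw [Real.rpow_add hx0]
            _ ≤ _ := Real.rpow_le_rpow_of_exponent_le hx (by linarith))
        refine (mul_le_mul_of_nonneg_left this (lpr_nonneg p)).trans (le_of_eq ?_)
        ring
      · simp [lpr, hpp]
    rw [e]
    refine (abs_add_le _ _).trans ?_
    refine (add_le_add (abs_sub _ _) le_rfl).trans ?_
    rw [abs_mul, abs_mul, abs_of_nonneg (by norm_num : (0:ℝ) ≤ 1 / 2)]
    have e2 : K1 * (x / d) / L ^ (b + 2) = K1 * (x / L ^ (b + 2)) * (1 / (d:ℝ)) := by ring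
    rw [e2] at a2
    have n2 := abs_nonneg (∑ n ∈ Icc 1 ⌊x⌋₊, (if d ∣ n then lam n else 0))
    have n3 := abs_nonneg (∑ n ∈ Icc 1 ⌊x⌋₊, (if d ∣ n then lam n / Real.log n else 0) * GG N n)
    linarith
  refine (sum_le_sum key).trans ?_
  rw [sum_add_distrib, sum_add_distrib, ← mul_sum, ← mul_sum]
  have s1 : ∑ d ∈ Icc 1 Q, (1:ℝ) ≤ M * (x / L ^ b) := by
    simp only [sum_const, Nat.card_Icc, nsmul_eq_mul, mul_one, add_tsub_cancel_right]
    refine hQx.trans ?_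
    rw [← mul_div_assoc, le_div_iff₀ (by positivity)]
    calc x ^ ν * L ^ b ≤ x ^ ν * (M * x ^ (1 - ν)) := mul_le_mul_of_nonneg_left (h4 x hx) (by positivity)
      _ = M * (x ^ ν * x ^ (1 - ν)) := by ring
      _ = M * x := by rw [← Real.rpow_add hx0]; simp
  have s2 : ∑ d ∈ Icc 1 Q, 1 / (d:ℝ) ≤ L ^ 2 := by
    refine le_trans (sum_le_sum_of_subset_of_nonneg (Icc_subset_Icc_right (Nat.le_floor hQx')) fun d _ _ => by positivity) ((sum_inv_le hx).trans ?_)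
    nlinarith
  have s3 := h3 x Q P hx hP1 hQx' hPx'
  have e3 : x / L ^ (b + 2) * L ^ 2 = x / L ^ b := by rw [pow_add]; field_simp
  have fin : x / L ^ b ≤ x * Real.log x ^ (-B) := by
    rw [div_eq_mul_inv]
    gcongr
    rw [← Real.rpow_natCast, ← Real.rpow_neg hL0.le]
    calc L ^ (-(b:ℝ)) ≤ L ^ (-B) := Real.rpow_le_rpow_of_exponent_le hL1 (by have := Nat.le_ceil B; linarith)
      _ ≤ _ := Real.rpow_le_rpow_of_nonpos hlog (by linarith) (by linarith)
  calc _ ≤ M * (x / L ^ b) + K1 * (x / L ^ (b + 2)) * L ^ 2 + K2 * (x / L ^ (b + 2)) * (C * L ^ 2) := by gcongr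
    _ = M * (x / L ^ b) + K1 * (x / L ^ (b + 2) * L ^ 2) + K2 * C * (x / L ^ (b + 2) * L ^ 2) := by ring
    _ = (M + K1 + K2 * C) * (x / L ^ b) := by rw [e3]; ring
    _ ≤ (M + K1 + K2 * C) * (x * Real.log x ^ (-B)) := by gcongr
    _ = _ := by ring

lemma E_est (j : ℕ) : ∃ C : ℝ, 0 ≤ C ∧ ∀ (y L : ℝ) (p : ℕ), 1 ≤ y → 1 + Real.log y ≤ L → 1 ≤ p →
    |∑ m ∈ Icc 1 ⌊y⌋₊, lam m * (if p ∣ m then Lk (j + 2) m else 0)| ≤ C * (y * √L ^ (2 * j + 3) / √p) := by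
  obtain ⟨C, hC, h⟩ := SL_le (j + 1)
  refine ⟨C + 1, by positivity, fun y L p hy hL hp => ?_⟩
  have hl := Real.log_nonneg hy
  have hL0 : 0 < L := by linarith
  have hp0 : (0:ℝ) < p := by exact_mod_cast hp
  have hs : 0 < √L := Real.sqrt_pos.2 hL0
  have hr : 0 < √(p:ℝ) := Real.sqrt_pos.2 hp0
  have hs2 : √L ^ 2 = L := Real.sq_sqrt hL0.le
  have hr2 : √(p:ℝ) ^ 2 = p := Real.sq_sqrt hp0.le
  have h1 : |∑ m ∈ Icc 1 ⌊y⌋₊, lam m * (if p ∣ m then Lk (j + 2) m else 0)| ≤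
      ∑ m ∈ Icc 1 ⌊y⌋₊, (if p ∣ m then Lk (j + 2) m else 0) := by
    refine (abs_sum_le_sum_abs _ _).trans (sum_le_sum fun m _ => ?_)
    have h0 : 0 ≤ (if p ∣ m then Lk (j + 2) m else 0) := by
      split_ifs
      · exact Lk_nonneg _ _
      · rfl
    rw [abs_mul, abs_of_nonneg h0]
    exact mul_le_of_le_one_left h0 (lam_abs_le m)
  refine h1.trans ?_
  have hA : ∑ m ∈ Icc 1 ⌊y⌋₊, (if p ∣ m then Lk (j + 2) m else 0) ≤ C * y * √L ^ (2 * j + 2) := by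
    have a : ∑ m ∈ Icc 1 ⌊y⌋₊, (if p ∣ m then Lk (j + 2) m else 0) ≤ SL (j + 2) y := by
      refine sum_le_sum fun m _ => ?_
      split_ifs
      · rfl
      · exact Lk_nonneg _ _
    refine a.trans ((le_abs_self _).trans ((h y hy).trans ?_))
    have : √L ^ (2 * j + 2) = L ^ (j + 1) := by
      rw [show 2 * j + 2 = 2 * (j + 1) by ring, pow_mul, hs2]
    rw [this]; gcongr
  have hB : ∑ m ∈ Icc 1 ⌊y⌋₊, (if p ∣ m then Lk (j + 2) m else 0) ≤ y / p * √L ^ (2 * j + 4) := by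
    have a : ∑ m ∈ Icc 1 ⌊y⌋₊, (if p ∣ m then Lk (j + 2) m else 0) ≤ ∑ m ∈ Icc 1 ⌊y⌋₊, (if p ∣ m then L ^ (j + 2) else 0) := by
      refine sum_le_sum fun m hm => ?_
      have hm' := mem_Icc_floor (by linarith) hm
      split_ifs
      · have hm0 : m ≠ 0 := by rw [mem_Icc] at hm; omega
        refine (Lk_le _ hm0).trans ?_
        have := Real.log_nonneg hm'.1
        have : Real.log m ≤ Real.log y := Real.log_le_log (by linarith) hm'.2
        gcongr; linarith
      · rfl
    refine a.trans ?_
    rw [sum_dvd (fun _ => L ^ (j + 2)) _ _ hp, ← Nat.floor_div_natCast]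
    simp only [sum_const, Nat.card_Icc, nsmul_eq_mul, add_tsub_cancel_right]
    have : √L ^ (2 * j + 4) = L ^ (j + 2) := by
      rw [show 2 * j + 4 = 2 * (j + 2) by ring, pow_mul, hs2]
    rw [this]
    gcongr
    exact Nat.floor_le (by positivity)
  have hT : 0 ≤ y * √L ^ (2 * j + 3) / √p := by positivity
  rcases le_total √(p:ℝ) √L with hc | hc
  · refine hA.trans ?_
    have : y * √L ^ (2 * j + 2) ≤ y * √L ^ (2 * j + 3) / √p := by
      rw [le_div_iff₀ hr, pow_succ _ (2 * j + 2), ← mul_assoc]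
      gcongr
    nlinarith
  · refine hB.trans ?_
    have : y / p * √L ^ (2 * j + 4) ≤ y * √L ^ (2 * j + 3) / √p := by
      rw [le_div_iff₀ hr, pow_succ _ (2 * j + 3)]
      calc y / p * (√L ^ (2 * j + 3) * √L) * √↑p ≤ y / p * (√L ^ (2 * j + 3) * √p) * √↑p := by gcongr
        _ = y / p * √L ^ (2 * j + 3) * √p ^ 2 := by ring
        _ = _ := by rw [hr2]; field_simp
    nlinarith

noncomputable def Wp (k p : ℕ) (t : ℕ) : ℝ := ∑ n ∈ Icc 1 t, if p ∣ n then lam n * Lk k n else 0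

lemma Wp_eq (k p t : ℕ) (hp : p.Prime) : Wp k p t = - ∑ m ∈ Icc 1 (t / p), lam m * Lk k (p * m) := by
  unfold Wp
  rw [sum_dvd _ _ _ hp.one_le, ← sum_neg_distrib]
  refine sum_congr rfl fun m _ => ?_
  rw [lam_mul, lam_prime hp]; ring

lemma W_est (j : ℕ) : ∃ C : ℝ, 0 ≤ C ∧ ∀ (x : ℝ) (p : ℕ), p.Prime → (p:ℝ) ≤ x →
    |Wp (j + 2) p ⌊x⌋₊ - (j + 2) * Real.log p ^ (j + 1) * (x / p)| ≤
    C * ((1 + Real.log x) ^ (j + 2) + x / p * (1 + Real.log x) ^ (j + 1) / (1 + Real.log (x / p))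
      + x / p * √(1 + Real.log x) ^ (2 * j + 3) / √p) := by
  obtain ⟨C1, hC1, h1⟩ := lamvM_sum
  obtain ⟨C2, hC2, h2⟩ := E_est j
  choose Cf hCf hf using lamLk_sum
  set S := ∑ i ∈ range j, ((j + 2).choose (i + 2) : ℝ) * Cf (i + 2) with hS
  have hS0 : 0 ≤ S := sum_nonneg fun i _ => mul_nonneg (by positivity) (hCf _)
  refine ⟨1 + (S + (j + 2) * C1) + C2, by positivity, fun x p hp hpx => ?_⟩
  have hp0 : (0:ℝ) < p := by exact_mod_cast hp.pos
  have hp1 : (1:ℝ) ≤ p := by exact_mod_cast hp.one_le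
  have hx0 : 0 < x := by linarith
  set y := x / p with hy
  have hy1 : 1 ≤ y := by rw [hy, le_div_iff₀ hp0]; linarith
  have hxy : x = p * y := by rw [hy]; field_simp
  set l := Real.log p with hl
  have hl0 : 0 ≤ l := Real.log_nonneg hp1
  have hly : 0 ≤ Real.log y := Real.log_nonneg hy1
  have hlx : Real.log x = l + Real.log y := by rw [hxy, Real.log_mul hp0.ne' (by linarith)]
  set L := 1 + Real.log x with hL
  have hL1 : 1 ≤ L := by linarith
  have hlL : l ≤ L := by linarith
  rw [Wp_eq _ _ _ hp, ← Nat.floor_div_natCast, ← hy]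
  have e1 : ∑ m ∈ Icc 1 ⌊y⌋₊, lam m * Lk (j + 2) (p * m) =
      (∑ i ∈ range j, ((j + 2).choose (i + 2) : ℝ) * l ^ (j - i) * ∑ m ∈ Icc 1 ⌊y⌋₊, lam m * Lk (i + 2) m)
      + (j + 2) * l ^ (j + 1) * ∑ m ∈ Icc 1 ⌊y⌋₊, lam m * Lk 1 m
      + l ^ (j + 2) * ∑ m ∈ Icc 1 ⌊y⌋₊, lam m * Lk 0 m
      + ∑ m ∈ Icc 1 ⌊y⌋₊, lam m * (if p ∣ m then Lk (j + 2) m else 0) := by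
    have : ∀ m ∈ Icc 1 ⌊y⌋₊, lam m * Lk (j + 2) (p * m) =
      (∑ i ∈ range (j + 2), ((j + 2).choose i : ℝ) * l ^ (j + 2 - i) * (lam m * Lk i m)) + lam m * (if p ∣ m then Lk (j + 2) m else 0) := by
      intro m hm
      rw [mem_Icc] at hm
      rw [Lk_prime_mul _ hp (by omega : m ≠ 0), mul_add, mul_sum]
      congr 1
      exact sum_congr rfl fun i _ => by ring
    rw [sum_congr rfl this, sum_add_distrib, sum_comm]
    simp only [← mul_sum]
    rw [sum_range_succ', sum_range_succ']
    simp only [Nat.choose_zero_right, zero_add, Nat.choose_one_right, Nat.add_sub_add_right]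
    congr 1
    simp [show j + 2 - 1 = j + 1 by omega, add_assoc, show (1 + 1 : ℕ) = 2 by rfl]
  have b0 : |l ^ (j + 2) * ∑ m ∈ Icc 1 ⌊y⌋₊, lam m * Lk 0 m| ≤ L ^ (j + 2) := by
    have : ∑ m ∈ Icc 1 ⌊y⌋₊, lam m * Lk 0 m = 1 := by
      rw [sum_eq_single 1]
      · rw [lam_one, Lk_zero]; simp
      · intro m _ hm; rw [Lk_zero, ArithmeticFunction.one_apply_ne hm, mul_zero]
      · intro hm; exfalso; apply hm; rw [mem_Icc]; exact ⟨le_rfl, Nat.le_floor (by simpa using hy1)⟩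
    rw [this, mul_one, abs_of_nonneg (by positivity)]
    gcongr
  set R := y * L ^ (j + 1) / (1 + Real.log y) with hR
  have hRj : y * L ^ j ≤ R := by
    rw [hR, le_div_iff₀ (by linarith), pow_succ, ← mul_assoc]
    gcongr; linarith
  have b1 : |(j + 2) * l ^ (j + 1) * (∑ m ∈ Icc 1 ⌊y⌋₊, lam m * Lk 1 m + y)| ≤ (j + 2) * C1 * R := by
    rw [Lk_one, abs_mul, abs_of_nonneg (by positivity)]
    have a := h1 y hy1
    have a2 : C1 * y / (1 + Real.log y) ^ 2 ≤ C1 * y / (1 + Real.log y) := by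
      gcongr
      nlinarith
    calc _ ≤ (j + 2) * L ^ (j + 1) * (C1 * y / (1 + Real.log y)) := by gcongr; exact a.trans a2
      _ = _ := by rw [hR]; ring
  have b2 : |∑ i ∈ range j, ((j + 2).choose (i + 2) : ℝ) * l ^ (j - i) * ∑ m ∈ Icc 1 ⌊y⌋₊, lam m * Lk (i + 2) m| ≤ S * R := by
    refine (abs_sum_le_sum_abs _ _).trans ?_
    rw [hS, sum_mul]
    refine sum_le_sum fun i hi => ?_
    rw [abs_mul, abs_of_nonneg (by positivity : 0 ≤ ((j + 2).choose (i + 2) : ℝ) * l ^ (j - i))]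
    have a : l ^ (j - i) ≤ L ^ j := (pow_le_pow_left₀ hl0 hlL _).trans (pow_le_pow_right₀ hL1 (by omega))
    have c0 := hCf (i + 2)
    calc _ ≤ ((j + 2).choose (i + 2) : ℝ) * L ^ j * (Cf (i + 2) * y) := by gcongr; exact hf _ y hy1
      _ = ((j + 2).choose (i + 2) : ℝ) * Cf (i + 2) * (y * L ^ j) := by ring
      _ ≤ _ := by gcongr
  have b3 := h2 y L p hy1 (by linarith) hp.one_le
  set F := y * √L ^ (2 * j + 3) / √p with hF
  have hF0 : 0 ≤ F := by positivity
  have hR0 : 0 ≤ R := by positivity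
  have hL0 : 0 ≤ L ^ (j + 2) := by positivity
  rw [e1]
  set T2 := ∑ i ∈ range j, ((j + 2).choose (i + 2) : ℝ) * l ^ (j - i) * ∑ m ∈ Icc 1 ⌊y⌋₊, lam m * Lk (i + 2) m
  set T1 := ∑ m ∈ Icc 1 ⌊y⌋₊, lam m * Lk 1 m
  set T0 := l ^ (j + 2) * ∑ m ∈ Icc 1 ⌊y⌋₊, lam m * Lk 0 m
  set T3 := ∑ m ∈ Icc 1 ⌊y⌋₊, lam m * (if p ∣ m then Lk (j + 2) m else 0)
  have e2 : -(T2 + (j + 2) * l ^ (j + 1) * T1 + T0 + T3) - (j + 2) * l ^ (j + 1) * y =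
    -(T2 + (j + 2) * l ^ (j + 1) * (T1 + y) + T0 + T3) := by ring
  rw [e2, abs_neg]
  have t := abs_add_le (T2 + (j + 2) * l ^ (j + 1) * (T1 + y) + T0) T3
  have t2 := abs_add_le (T2 + (j + 2) * l ^ (j + 1) * (T1 + y)) T0
  have t3 := abs_add_le T2 ((j + 2) * l ^ (j + 1) * (T1 + y))
  have : 0 ≤ ((j:ℝ) + 2) * C1 := by positivity
  have u1 : 0 ≤ (S + (j + 2) * C1 + C2) * L ^ (j + 2) := by positivity
  have u2 : 0 ≤ (1 + C2) * R := by positivity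
  have u3 : 0 ≤ (1 + (S + (j + 2) * C1)) * F := by positivity
  linarith

lemma lpr_conv : ∃ C : ℝ, 0 ≤ C ∧ ∀ m : ℕ, ∑ p ∈ Icc 1 m, lpr p * (1 / (p:ℝ) / √p) ≤ C := by
  have hs : Summable fun n : ℕ => (n:ℝ) ^ (-(5 / 4) : ℝ) := Real.summable_nat_rpow.2 (by norm_num)
  refine ⟨4 * ∑' n : ℕ, (n:ℝ) ^ (-(5 / 4) : ℝ), mul_nonneg (by norm_num) (tsum_nonneg fun n => by positivity), fun m => ?_⟩
  refine le_trans ?_ (mul_le_mul_of_nonneg_left (hs.sum_le_tsum (Icc 1 m) fun n _ => by positivity) (by norm_num))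
  rw [mul_sum]
  refine sum_le_sum fun p hp => ?_
  rw [mem_Icc] at hp
  have hp0 : (0:ℝ) < p := by exact_mod_cast hp.1
  have h1 : lpr p ≤ Real.log p := by
    unfold lpr; split_ifs
    · rfl
    · exact Real.log_natCast_nonneg p
  have h2 := Real.log_le_rpow_div hp0.le (by norm_num : (0:ℝ) < 1 / 4)
  calc lpr p * (1 / (p:ℝ) / √p) ≤ (p:ℝ) ^ (1 / 4 : ℝ) / (1 / 4) * (1 / (p:ℝ) / √p) := by
        gcongr; exact h1.trans h2
    _ = 4 * ((p:ℝ) ^ (1 / 4 : ℝ) * (p:ℝ) ^ (-1 : ℝ) * (p:ℝ) ^ (-(1 / 2) : ℝ)) := by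
        rw [Real.rpow_neg_one, Real.rpow_neg hp0.le, Real.sqrt_eq_rpow]; field_simp
    _ = _ := by rw [← Real.rpow_add hp0, ← Real.rpow_add hp0]; norm_num

lemma lpr_bound : ∃ C : ℝ, 0 ≤ C ∧ ∀ m : ℕ, 1 ≤ m → ∑ p ∈ Icc 1 m, lpr p ≤ C * m := by
  obtain ⟨C, hC, h⟩ := PS.prm.bound
  refine ⟨C, hC, fun m hm => ?_⟩
  have := h m (by exact_mod_cast hm)
  simpa using this

/-- short-interval parts -/
lemma W_small (j : ℕ) : ∃ C : ℝ, 0 ≤ C ∧ ∀ (x : ℝ) (N p : ℕ), 1 ≤ x → 2 ≤ N → p.Prime → ((p ^ N : ℕ):ℝ) ≤ x →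
    |Wp (j + 2) p (p ^ N - 1)| ≤ C * ((1 + Real.log x) ^ (j + 2) + (p:ℝ) ^ (N - 1) * √(1 + Real.log x) ^ (2 * j + 3)) := by
  obtain ⟨C, hC, h⟩ := W_est j
  refine ⟨2 * C + (j + 2), by positivity, fun x N p hx hN hp hpx => ?_⟩
  have hp2 := hp.two_le
  have hp0 : (0:ℝ) < p := by exact_mod_cast hp.pos
  have hp1 : (1:ℝ) ≤ p := by exact_mod_cast hp.one_le
  have hlx := Real.log_nonneg hx
  set t := p ^ N - 1 with ht
  have hpN : p ^ 2 ≤ p ^ N := Nat.pow_le_pow_right (by omega) hN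
  have hpt : p ≤ t := by
    have : p + 1 ≤ p ^ 2 := by nlinarith
    omega
  have hpt' : (p:ℝ) ≤ t := by exact_mod_cast hpt
  have ht0 : (0:ℝ) < t := by linarith
  have htN : (t:ℝ) ≤ (p:ℝ) ^ N := by exact_mod_cast Nat.sub_le _ _
  have htx : (t:ℝ) ≤ x := htN.trans (by exact_mod_cast hpx)
  have hq1 : 1 ≤ (t:ℝ) / p := by rw [le_div_iff₀ hp0]; linarith
  have hq : (t:ℝ) / p ≤ (p:ℝ) ^ (N - 1) := by
    rw [div_le_iff₀ hp0, ← pow_succ, show N - 1 + 1 = N by omega]; exact htN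
  have hlt := Real.log_le_log ht0 htx
  have hlt0 : 0 ≤ Real.log t := Real.log_natCast_nonneg t
  have hlq := Real.log_nonneg hq1
  have h1 := h t p hp hpt'
  rw [Nat.floor_natCast] at h1
  set L := 1 + Real.log x with hL
  have hL1 : 1 ≤ L := by linarith
  have htL : 1 + Real.log t ≤ L := by linarith
  have hs1 : 1 ≤ √L := Real.one_le_sqrt.2 hL1
  have hsq : √(p:ℝ) ≥ 1 := Real.one_le_sqrt.2 hp1
  have hss : L ^ (j + 1) ≤ √L ^ (2 * j + 3) := by
    calc L ^ (j + 1) = √L ^ (2 * (j + 1)) := by rw [pow_mul, Real.sq_sqrt (by linarith)]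
      _ ≤ _ := pow_le_pow_right₀ hs1 (by omega)
  set U := (p:ℝ) ^ (N - 1) * √L ^ (2 * j + 3) with hU
  have hU0 : 0 ≤ U := by positivity
  have c1 : (1 + Real.log t) ^ (j + 2) ≤ L ^ (j + 2) := by gcongr
  have c2 : (t:ℝ) / p * (1 + Real.log t) ^ (j + 1) / (1 + Real.log (t / p)) ≤ U := by
    refine (div_le_self (by positivity) (by linarith)).trans ?_
    have : (1 + Real.log t) ^ (j + 1) ≤ L ^ (j + 1) := by gcongr
    exact mul_le_mul hq (this.trans hss) (by positivity) (by positivity)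
  have c3 : (t:ℝ) / p * √(1 + Real.log t) ^ (2 * j + 3) / √p ≤ U := by
    refine (div_le_self (by positivity) hsq).trans ?_
    rw [hU]
    gcongr
  have c4 : (j + 2) * Real.log p ^ (j + 1) * (t / p) ≤ (j + 2) * U := by
    have a : Real.log p ≤ L := by
      have := Real.log_le_log hp0 hpt'
      linarith
    have a0 := Real.log_nonneg hp1
    have b : Real.log p ^ (j + 1) ≤ √L ^ (2 * j + 3) := (pow_le_pow_left₀ a0 a _).trans hss
    calc _ ≤ (j + 2) * √L ^ (2 * j + 3) * (p:ℝ) ^ (N - 1) := by gcongr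
      _ = _ := by rw [hU]; ring
  have a0 := Real.log_nonneg hp1
  have h2 := abs_sub_abs_le_abs_sub (Wp (j + 2) p t) ((j + 2) * Real.log p ^ (j + 1) * (t / p))
  rw [abs_of_nonneg (by positivity : 0 ≤ (j + 2) * Real.log p ^ (j + 1) * (t / p : ℝ))] at h2
  have h3 : C * ((1 + Real.log t) ^ (j + 2) + (t:ℝ) / p * (1 + Real.log t) ^ (j + 1) / (1 + Real.log (t / p)) + (t:ℝ) / p * √(1 + Real.log t) ^ (2 * j + 3) / √p)
    ≤ C * (L ^ (j + 2) + U + U) := by gcongr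
  have h4 : 0 ≤ (C + (j + 2)) * L ^ (j + 2) := by positivity
  linarith

lemma W_main (j : ℕ) : ∃ C : ℝ, 0 ≤ C ∧ ∀ (x : ℝ) (p : ℕ), 1 ≤ x → p.Prime → (p:ℝ) ^ 2 ≤ x →
    |Wp (j + 2) p ⌊x⌋₊ - (j + 2) * Real.log p ^ (j + 1) * (x / p)| ≤
    C * ((1 + Real.log x) ^ (j + 2) + x * (1 + Real.log x) ^ j * (1 / p)
      + x * √(1 + Real.log x) ^ (2 * j + 3) * (1 / p / √p)) := by
  obtain ⟨C, hC, h⟩ := W_est j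
  refine ⟨2 * C, by positivity, fun x p hx hp hpx => ?_⟩
  have hp0 : (0:ℝ) < p := by exact_mod_cast hp.pos
  have hp1 : (1:ℝ) ≤ p := by exact_mod_cast hp.one_le
  have hx0 : 0 < x := by linarith
  have hlx := Real.log_nonneg hx
  have hpx' : (p:ℝ) ≤ x := by nlinarith
  refine (h x p hp hpx').trans ?_
  have h1 : 2 * Real.log p ≤ Real.log x := by
    have := Real.log_le_log (by positivity) hpx
    rw [Real.log_pow] at this
    exact_mod_cast this
  have hq : Real.log (x / p) = Real.log x - Real.log p := Real.log_div hx0.ne' hp0.ne'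
  have a0 := Real.log_nonneg hp1
  have h2 : x / p * (1 + Real.log x) ^ (j + 1) / (1 + Real.log (x / p)) ≤ 2 * (x * (1 + Real.log x) ^ j * (1 / p)) := by
    rw [div_le_iff₀ (by rw [hq]; linarith), pow_succ]
    calc x / p * ((1 + Real.log x) ^ j * (1 + Real.log x)) = x * (1 + Real.log x) ^ j * (1 / p) * (1 + Real.log x) := by ring
      _ ≤ x * (1 + Real.log x) ^ j * (1 / p) * (2 * (1 + Real.log (x / p))) := by gcongr; rw [hq]; linarith
      _ = _ := by ring
  have e : x / p * √(1 + Real.log x) ^ (2 * j + 3) / √p = x * √(1 + Real.log x) ^ (2 * j + 3) * (1 / p / √p) := by ring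
  rw [e]
  have n1 : 0 ≤ (1 + Real.log x) ^ (j + 2) := by positivity
  have n2 : 0 ≤ x * √(1 + Real.log x) ^ (2 * j + 3) * (1 / p / √p) := by positivity
  rw [mul_assoc 2 C, mul_left_comm]
  gcongr
  linarith

lemma lamG_sum (j N : ℕ) (hN : 2 ≤ N) : ∃ C : ℝ, 0 ≤ C ∧ ∀ x : ℝ, 1 ≤ x →
    |∑ n ∈ Icc 1 ⌊x⌋₊, lam n * Lk (j + 2) n * GG N n - x * (Real.log x / N) ^ (j + 2)| ≤
      C * (x * √(1 + Real.log x) ^ (2 * j + 3)) := by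
  obtain ⟨C1, hC1, h1⟩ := W_main j
  obtain ⟨C2, hC2, h2⟩ := W_small j
  obtain ⟨C3, hC3, h3⟩ := lpr_conv
  obtain ⟨C4, hC4, h4⟩ := lpr_bound
  obtain ⟨C5, hC5, h5⟩ := lpr_mert
  obtain ⟨C6, hC6, h6⟩ := mert_log PS.prm.mert (j + 1)
  obtain ⟨M, hM, h7⟩ := logpow_le (j + 2) (1 / 2) (by norm_num)
  refine ⟨C1 * (C4 * M + C5 + C3) + C2 * (C4 * M + C4) + (j + 2) * C6 + (j + 2), by positivity, fun x hx => ?_⟩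
  have hx0 : 0 < x := by linarith
  have hlx := Real.log_nonneg hx
  have hN0 : (0:ℝ) < N := by positivity
  set L := 1 + Real.log x with hL
  have hL1 : 1 ≤ L := by linarith
  have hs1 : 1 ≤ √L := Real.one_le_sqrt.2 hL1
  set z := x ^ ((N:ℝ)⁻¹) with hz
  have hz1 : 1 ≤ z := Real.one_le_rpow hx (by positivity)
  have hlz : Real.log z = Real.log x / N := by rw [hz, Real.log_rpow hx0]; ring
  set P := ⌊z⌋₊ with hP
  have hroot := fun p => root_iff hx (by omega : 1 ≤ N) p
  have hP1 : 1 ≤ P := Nat.le_floor (by simpa using hz1)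
  have hP0 : (0:ℝ) < P := by exact_mod_cast hP1
  have hPN : (P:ℝ) ^ N ≤ x := by
    have := (hroot P).1 le_rfl
    rw [Nat.le_floor_iff hx0.le] at this
    exact_mod_cast this
  have hpN : ∀ p ∈ Icc 1 P, (p:ℝ) ^ N ≤ x := fun p hp => by
    rw [mem_Icc] at hp
    refine le_trans ?_ hPN
    gcongr
    exact_mod_cast hp.2
  have hp2 : ∀ p ∈ Icc 1 P, (p:ℝ) ^ 2 ≤ x := fun p hp => by
    refine le_trans ?_ (hpN p hp)
    rw [mem_Icc] at hp
    exact pow_le_pow_right₀ (by exact_mod_cast hp.1) hN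
  have hPP : P ∈ Icc 1 P := mem_Icc.2 ⟨hP1, le_rfl⟩
  have hPs : (P:ℝ) ≤ x ^ (1 / 2 : ℝ) := by
    rw [← Real.sqrt_eq_rpow]; exact Real.le_sqrt_of_sq_le (hp2 P hPP)
  have hPx : (P:ℝ) ≤ x := by
    have := hp2 P hPP
    have : (1:ℝ) ≤ P := by exact_mod_cast hP1
    nlinarith
  have hlP : Real.log P ≤ Real.log x := Real.log_le_log hP0 hPx
  have hlP0 : 0 ≤ Real.log P := Real.log_natCast_nonneg P
  set s := √L ^ (2 * j + 3) with hs
  have hs11 : 1 ≤ s := one_le_pow₀ hs1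
  have hss : L ^ (j + 1) ≤ s := by
    calc L ^ (j + 1) = √L ^ (2 * (j + 1)) := by rw [pow_mul, Real.sq_sqrt (by linarith)]
      _ ≤ _ := pow_le_pow_right₀ hs1 (by omega)
  set X := x * s with hX
  have hxX : x ≤ X := by rw [hX]; nlinarith
  have hX0 : 0 ≤ X := by linarith
  -- theta(P) L^(j+2)
  have g1 : (∑ p ∈ Icc 1 P, lpr p) * L ^ (j + 2) ≤ C4 * M * X := by
    calc (∑ p ∈ Icc 1 P, lpr p) * L ^ (j + 2) ≤ (C4 * x ^ (1 / 2 : ℝ)) * (M * x ^ (1 / 2 : ℝ)) := by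
          gcongr
          · exact (h4 P hP1).trans (by gcongr)
          · exact h7 x hx
      _ = C4 * M * (x ^ (1 / 2 : ℝ) * x ^ (1 / 2 : ℝ)) := by ring
      _ = C4 * M * x := by rw [← Real.rpow_add hx0]; norm_num
      _ ≤ _ := by gcongr
  -- main terms
  have m1 : |∑ p ∈ Icc 1 P, lpr p * (Wp (j + 2) p ⌊x⌋₊ - (j + 2) * Real.log p ^ (j + 1) * (x / p))| ≤ C1 * (C4 * M + C5 + C3) * X := by
    refine (abs_sum_le_sum_abs _ _).trans ?_
    calc _ ≤ ∑ p ∈ Icc 1 P, lpr p * (C1 * (L ^ (j + 2) + x * L ^ j * (1 / p) + x * s * (1 / p / √p))) := by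
          refine sum_le_sum fun p hp => ?_
          rw [abs_mul, abs_of_nonneg (lpr_nonneg p)]
          by_cases hpp : p.Prime
          · exact mul_le_mul_of_nonneg_left (h1 x p hx hpp (hp2 p hp)) (lpr_nonneg p)
          · simp [lpr, hpp]
      _ = C1 * ((∑ p ∈ Icc 1 P, lpr p) * L ^ (j + 2) + x * L ^ j * ∑ p ∈ Icc 1 P, lpr p / p
            + X * ∑ p ∈ Icc 1 P, lpr p * (1 / (p:ℝ) / √p)) := by
          rw [sum_mul, mul_sum, mul_sum, ← sum_add_distrib, ← sum_add_distrib, mul_sum]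
          exact sum_congr rfl fun p _ => by rw [hX]; ring
      _ ≤ C1 * (C4 * M * X + C5 * X + X * C3) := by
          have a : x * L ^ j * ∑ p ∈ Icc 1 P, lpr p / p ≤ C5 * X := by
            calc _ ≤ x * L ^ j * (C5 * L) := by
                  gcongr
                  exact (h5 P hP1).trans (by gcongr; linarith)
              _ = C5 * (x * L ^ (j + 1)) := by ring
              _ ≤ _ := by rw [hX]; gcongr
          gcongr
          exact h3 P
      _ = _ := by ring
  have m2 : |∑ p ∈ Icc 1 P, lpr p * Wp (j + 2) p (p ^ N - 1)| ≤ C2 * (C4 * M + C4) * X := by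
    refine (abs_sum_le_sum_abs _ _).trans ?_
    calc _ ≤ ∑ p ∈ Icc 1 P, lpr p * (C2 * (L ^ (j + 2) + (P:ℝ) ^ (N - 1) * s)) := by
          refine sum_le_sum fun p hp => ?_
          rw [abs_mul, abs_of_nonneg (lpr_nonneg p)]
          by_cases hpp : p.Prime
          · refine mul_le_mul_of_nonneg_left ((h2 x N p hx hN hpp (by exact_mod_cast hpN p hp)).trans ?_) (lpr_nonneg p)
            rw [mem_Icc] at hp
            gcongr
            exact_mod_cast hp.2
          · simp [lpr, hpp]
      _ = C2 * ((∑ p ∈ Icc 1 P, lpr p) * L ^ (j + 2) + (∑ p ∈ Icc 1 P, lpr p) * (P:ℝ) ^ (N - 1) * s) := by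
          rw [← sum_mul]; ring
      _ ≤ C2 * (C4 * M * X + C4 * X) := by
          have a : (∑ p ∈ Icc 1 P, lpr p) * (P:ℝ) ^ (N - 1) * s ≤ C4 * X := by
            calc _ ≤ C4 * P * (P:ℝ) ^ (N - 1) * s := by gcongr; exact h4 P hP1
              _ = C4 * (P:ℝ) ^ (N - 1 + 1) * s := by rw [pow_succ]; ring
              _ ≤ C4 * x * s := by
                  rw [show N - 1 + 1 = N by omega]
                  gcongr
              _ = _ := by rw [hX]; ring
          gcongr
      _ = _ := by ring
  have m3 : |∑ p ∈ Icc 1 P, lpr p * ((j + 2) * Real.log p ^ (j + 1) * (x / p)) - x * Real.log P ^ (j + 2)| ≤ (j + 2) * C6 * X := by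
    have e : ∑ p ∈ Icc 1 P, lpr p * ((j + 2) * Real.log p ^ (j + 1) * (x / p)) = (j + 2) * x * ∑ p ∈ Icc 1 P, lpr p / p * Real.log p ^ (j + 1) := by
      rw [mul_sum]; exact sum_congr rfl fun p _ => by ring
    have e2 : x * Real.log P ^ (j + 2) = (j + 2) * x * (Real.log P ^ (j + 1 + 1) / ((j + 1 : ℕ) + 1)) := by
      push_cast
      rw [show (j:ℝ) + 1 + 1 = j + 2 by ring]
      field_simp
    rw [e, e2, ← mul_sub, abs_mul, abs_of_nonneg (by positivity)]
    calc _ ≤ (j + 2) * x * (C6 * L ^ (j + 1)) := by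
          gcongr
          exact (h6 P hP1).trans (by gcongr; linarith)
      _ ≤ (j + 2) * x * (C6 * s) := by gcongr
      _ = _ := by rw [hX]; ring
  have m4 : |x * Real.log P ^ (j + 2) - x * (Real.log x / N) ^ (j + 2)| ≤ (j + 2) * X := by
    rw [← hlz, ← mul_sub, abs_mul, abs_of_nonneg hx0.le]
    have f := floor_log hz1
    rw [← hP, Real.log_div (by linarith) hP0.ne'] at f
    have g := abs_pow_sub_pow_le (Real.log P) (Real.log z) (j + 2)
    have lz0 : 0 ≤ Real.log z := Real.log_nonneg hz1
    have lzL : Real.log z ≤ L := by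
      rw [hlz]
      have := div_le_self hlx (by exact_mod_cast (by omega : 1 ≤ N) : (1:ℝ) ≤ N)
      linarith
    have hmax : max |Real.log P| |Real.log z| ≤ L := by
      rw [abs_of_nonneg hlP0, abs_of_nonneg lz0]; exact max_le (by linarith) lzL
    have hd : |Real.log P - Real.log z| ≤ 1 := by rw [abs_le]; constructor <;> linarith [f.1, f.2]
    calc _ ≤ x * (1 * ((j + 2 : ℕ):ℝ) * L ^ (j + 1)) := by
          gcongr
          refine g.trans ?_
          rw [show j + 2 - 1 = j + 1 by omega]
          gcongr
      _ ≤ x * (1 * ((j + 2 : ℕ):ℝ) * s) := by gcongr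
      _ = _ := by rw [hX]; push_cast; ring
  have e0 : ∑ n ∈ Icc 1 ⌊x⌋₊, lam n * Lk (j + 2) n * GG N n =
      ∑ p ∈ Icc 1 P, lpr p * (Wp (j + 2) p ⌊x⌋₊ - (j + 2) * Real.log p ^ (j + 1) * (x / p))
      - ∑ p ∈ Icc 1 P, lpr p * Wp (j + 2) p (p ^ N - 1)
      + ∑ p ∈ Icc 1 P, lpr p * ((j + 2) * Real.log p ^ (j + 1) * (x / p)) := by
    rw [GG_sum N ⌊x⌋₊ P (by omega) (fun p hp => (hroot p).2 hp) ((hroot P).1 le_rfl) (fun n => lam n * Lk (j + 2) n),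
      ← sum_sub_distrib, ← sum_add_distrib]
    refine sum_congr rfl fun p hp => ?_
    rw [mem_Icc] at hp
    rw [Icc_diff _ _ _ (Nat.one_le_pow _ _ hp.1) ((hroot p).1 hp.2)]
    unfold Wp
    ring
  rw [e0]
  rw [abs_le] at *
  constructor <;> linarith [m1.1, m1.2, m2.1, m2.2, m3.1, m3.2, m4.1, m4.2]

lemma tq (a : ℕ → ℝ) (k : ℕ) (hk : 1 ≤ k) (ξ C : ℝ)
    (h : ∀ x : ℝ, 1 ≤ Real.log x → 1 ≤ x → |Ssum a k x - ξ * (k * x * Real.log x ^ (k - 1))| ≤ C * (x * Real.log x ^ (k - 1) / √(Real.log x))) :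
    Tendsto (fun x : ℝ => Tquot a k x) atTop (nhds ξ) := by
  rw [tendsto_iff_norm_sub_tendsto_zero]
  have hk0 : (0:ℝ) < k := by exact_mod_cast hk
  have h0 : Tendsto (fun x : ℝ => C / k * (1 / √(Real.log x))) atTop (nhds 0) := by
    have : Tendsto (fun x : ℝ => √(Real.log x)) atTop atTop := Real.tendsto_sqrt_atTop.comp Real.tendsto_log_atTop
    have := (this.inv_tendsto_atTop).const_mul (C / k)
    simpa using this
  refine squeeze_zero' (Eventually.of_forall fun x => norm_nonneg _) ?_ h0
  filter_upwards [Real.tendsto_log_atTop.eventually_ge_atTop 1, eventually_ge_atTop 1] with x h1 h2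
  have hx0 : 0 < x := by linarith
  have hl0 : 0 < Real.log x := by linarith
  have hs : 0 < √(Real.log x) := Real.sqrt_pos.2 hl0
  have hD : 0 < k * x * Real.log x ^ (k - 1) := by positivity
  have e : Tquot a k x - ξ = (Ssum a k x - ξ * (k * x * Real.log x ^ (k - 1))) / (k * x * Real.log x ^ (k - 1)) := by
    unfold Tquot; rw [sub_div, mul_div_cancel_right₀ _ hD.ne']
  rw [e, Real.norm_eq_abs, abs_div, abs_of_pos hD, div_le_iff₀ hD]
  refine (h x h1 h2).trans (le_of_eq ?_)
  field_simp

lemma Ssum_eq (N k : ℕ) (x : ℝ) : Ssum (aseq N) k x = SL k x - 1 / 2 * ∑ n ∈ Icc 1 ⌊x⌋₊, lam n * Lk k n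
    + 1 / 2 * ∑ n ∈ Icc 1 ⌊x⌋₊, lam n * Lk k n * (GG N n / Real.log n) := by
  unfold Ssum SL
  rw [mul_sum, mul_sum, ← sum_sub_distrib, ← sum_add_distrib]
  refine sum_congr rfl fun n _ => ?_
  rw [Lambdak_eq]; unfold aseq; ring

lemma lamg_sum (j N : ℕ) (hN : 2 ≤ N) : ∃ C : ℝ, 0 ≤ C ∧ ∀ x : ℝ, 1 ≤ Real.log x → 1 ≤ x →
    |∑ n ∈ Icc 1 ⌊x⌋₊, lam n * Lk (j + 2) n * (GG N n / Real.log n) - x * Real.log x ^ (j + 1) / (N:ℝ) ^ (j + 2)| ≤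
      C * (x * √(1 + Real.log x) ^ (2 * j + 3)) / Real.log x := by
  obtain ⟨C, hC, h⟩ := lamG_sum j N hN
  obtain ⟨D, hD, h'⟩ := SL_le (j + 1)
  refine ⟨C + 2 * D, by positivity, fun x hl1 hx => ?_⟩
  have hx0 : 0 < x := by linarith
  have hl0 : 0 < Real.log x := by linarith
  have hN0 : (0:ℝ) < N := by positivity
  set ℓ := Real.log x with hℓ
  have hL1 : 1 ≤ 1 + ℓ := by linarith
  have hs1 : 1 ≤ √(1 + ℓ) := Real.one_le_sqrt.2 hL1
  have hss : (1 + ℓ) ^ (j + 1) ≤ √(1 + ℓ) ^ (2 * j + 3) := by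
    calc (1 + ℓ) ^ (j + 1) = √(1 + ℓ) ^ (2 * (j + 1)) := by rw [pow_mul, Real.sq_sqrt (by linarith)]
      _ ≤ _ := pow_le_pow_right₀ hs1 (by omega)
  have hT := Tlog (fun n => Lk (j + 2) n) (j + 1) D hD h' x hx
  have e : ∑ n ∈ Icc 1 ⌊x⌋₊, lam n * Lk (j + 2) n * (GG N n / Real.log n) =
      (∑ n ∈ Icc 1 ⌊x⌋₊, lam n * Lk (j + 2) n * GG N n) / ℓ +
      (∑ n ∈ Icc 1 ⌊x⌋₊, lam n * (GG N n / Real.log n) * (Lk (j + 2) n * Real.log (x / n))) / ℓ := by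
    rw [← add_div, eq_div_iff hl0.ne', ← sum_add_distrib, sum_mul]
    refine sum_congr rfl fun n hn => ?_
    rw [mem_Icc] at hn
    have hn0 : (0:ℝ) < n := by exact_mod_cast hn.1
    rw [Real.log_div hx0.ne' hn0.ne', ← hℓ]
    have : GG N n = GG N n / Real.log n * Real.log n := by
      rcases eq_or_ne (Real.log n) 0 with h0 | h0
      · have a := GG_le N n
        have b := GG_nonneg N n
        rw [h0] at a ⊢
        simp; linarith
      · field_simp
    calc _ = lam n * Lk (j + 2) n * (GG N n / Real.log n * Real.log n) + lam n * (GG N n / Real.log n) * (Lk (j + 2) n * (ℓ - Real.log n)) := by ring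
      _ = _ := by rw [← this]
  have b2 : |∑ n ∈ Icc 1 ⌊x⌋₊, lam n * (GG N n / Real.log n) * (Lk (j + 2) n * Real.log (x / n))| ≤ 2 * D * (x * √(1 + ℓ) ^ (2 * j + 3)) := by
    refine (abs_sum_le_sum_abs _ _).trans ?_
    calc _ ≤ ∑ n ∈ Icc 1 ⌊x⌋₊, Lk (j + 2) n * Real.log (x / n) := by
          refine sum_le_sum fun n hn => ?_
          have hn' := mem_Icc_floor hx0.le hn
          have hq : 1 ≤ x / n := by rw [le_div_iff₀] <;> linarith
          have t0 : 0 ≤ Lk (j + 2) n * Real.log (x / n) := mul_nonneg (Lk_nonneg _ _) (Real.log_nonneg hq)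
          rw [abs_mul, abs_of_nonneg t0, abs_mul, abs_of_nonneg (gg_nonneg N n)]
          refine mul_le_of_le_one_left t0 ?_
          exact mul_le_one₀ (lam_abs_le n) (gg_nonneg N n) (gg_le N n)
      _ ≤ _ := le_abs_self _
      _ ≤ _ := hT
      _ ≤ 2 * D * x * √(1 + ℓ) ^ (2 * j + 3) := by gcongr
      _ = _ := by ring
  have b1 := h x hx
  rw [e]
  set A := ∑ n ∈ Icc 1 ⌊x⌋₊, lam n * Lk (j + 2) n * GG N n
  set A2 := ∑ n ∈ Icc 1 ⌊x⌋₊, lam n * (GG N n / Real.log n) * (Lk (j + 2) n * Real.log (x / n))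
  have e2 : A / ℓ + A2 / ℓ - x * ℓ ^ (j + 1) / (N:ℝ) ^ (j + 2) = ((A - x * (ℓ / N) ^ (j + 2)) + A2) / ℓ := by
    rw [div_pow]; field_simp; ring
  rw [e2, abs_div, abs_of_pos hl0]
  gcongr
  refine (abs_add_le _ _).trans ?_
  rw [add_mul]
  linarith

lemma lim_ge (j N : ℕ) (hN : 2 ≤ N) :
    Tendsto (fun x : ℝ => Tquot (aseq N) (j + 2) x) atTop (nhds (1 + 1 / (2 * (j + 2) * (N:ℝ) ^ (j + 2)))) := by
  obtain ⟨C1, hC1, h1⟩ := SL_asymp j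
  obtain ⟨C2, hC2, h2⟩ := lamLk_sum (j + 2)
  obtain ⟨C3, hC3, h3⟩ := lamg_sum j N hN
  refine tq _ _ (by omega) _ (C1 * 2 ^ j + C2 + C3 * 2 ^ (j + 2)) fun x hl hx => ?_
  have hN0 : (0:ℝ) < N := by positivity
  have hx0 : 0 < x := by linarith
  set ℓ := Real.log x with hℓ
  have hl0 : 0 < ℓ := by linarith
  have hs0 : 0 < √ℓ := Real.sqrt_pos.2 hl0
  have hs1 : 1 ≤ √ℓ := Real.one_le_sqrt.2 hl
  have hs2 : √ℓ * √ℓ = ℓ := Real.mul_self_sqrt hl0.le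
  have hsl : √ℓ ≤ ℓ := by nlinarith
  have hL : 1 + ℓ ≤ 2 * ℓ := by linarith
  have a1 := h1 x hx
  have a2 := h2 x hx
  have a3 := h3 x hl hx
  rw [← hℓ] at a1 a3
  set T := x * ℓ ^ (j + 1) / √ℓ with hT
  have hT0 : 0 ≤ T := by positivity
  have b1 : C1 * x * (1 + ℓ) ^ j ≤ C1 * 2 ^ j * T := by
    have : x * ℓ ^ j ≤ T := by
      rw [hT, le_div_iff₀ hs0, pow_succ, ← mul_assoc]; gcongr
    calc C1 * x * (1 + ℓ) ^ j ≤ C1 * x * (2 * ℓ) ^ j := by gcongr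
      _ = C1 * 2 ^ j * (x * ℓ ^ j) := by rw [mul_pow]; ring
      _ ≤ _ := by gcongr
  have b2 : C2 * x ≤ C2 * T := by
    gcongr
    rw [hT, le_div_iff₀ hs0]
    gcongr
    exact hsl.trans (le_self_pow₀ hl (by omega))
  have b3 : C3 * (x * √(1 + ℓ) ^ (2 * j + 3)) / ℓ ≤ C3 * 2 ^ (j + 2) * T := by
    have c : √(1 + ℓ) ^ (2 * j + 3) ≤ 2 ^ (j + 2) * ℓ ^ (j + 1) * √ℓ := by
      have c1 : √(1 + ℓ) ≤ 2 * √ℓ := by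
        rw [Real.sqrt_le_left (by positivity)]
        nlinarith
      calc √(1 + ℓ) ^ (2 * j + 3) = (√(1 + ℓ) ^ 2) ^ (j + 1) * √(1 + ℓ) := by rw [← pow_mul, ← pow_succ]; ring_nf
        _ = (1 + ℓ) ^ (j + 1) * √(1 + ℓ) := by rw [Real.sq_sqrt (by linarith)]
        _ ≤ (2 * ℓ) ^ (j + 1) * (2 * √ℓ) := by gcongr
        _ = _ := by rw [mul_pow]; ring
    rw [div_le_iff₀ hl0]
    calc _ ≤ C3 * (x * (2 ^ (j + 2) * ℓ ^ (j + 1) * √ℓ)) := by gcongr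
      _ = C3 * 2 ^ (j + 2) * (x * ℓ ^ (j + 1) / √ℓ) * (√ℓ * √ℓ) := by field_simp
      _ = _ := by rw [hs2]
  rw [Ssum_eq, show j + 2 - 1 = j + 1 by omega]
  have e : (1 + 1 / (2 * (j + 2) * (N:ℝ) ^ (j + 2))) * (((j + 2 : ℕ):ℝ) * x * ℓ ^ (j + 1)) =
    (j + 2) * x * ℓ ^ (j + 1) + 1 / 2 * (x * ℓ ^ (j + 1) / (N:ℝ) ^ (j + 2)) := by
    push_cast; field_simp
  rw [e]
  have b2' : 0 ≤ C2 * T := by positivity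
  have b3' : 0 ≤ C3 * 2 ^ (j + 2) * T := by positivity
  rw [abs_le] at *
  constructor <;> linarith [a1.1, a1.2, a2.1, a2.2, a3.1, a3.2]

lemma lim_one (N : ℕ) (hN : 2 ≤ N) :
    Tendsto (fun x : ℝ => Tquot (aseq N) 1 x) atTop (nhds (3 / 2)) := by
  obtain ⟨C1, hC1, h1⟩ := SL_one
  obtain ⟨C2, hC2, h2⟩ := lamvM_sum
  obtain ⟨C3, hC3, h3⟩ := vm_lpr_le 2
  refine tq _ _ le_rfl _ (C1 + C2 + C3) fun x hl hx => ?_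
  have hx0 : 0 < x := by linarith
  have a1 := h1 x hx
  have a2 := h2 x hx
  have a3 : |∑ n ∈ Icc 1 ⌊x⌋₊, lam n * Lk 1 n * (GG N n / Real.log n)| ≤ C3 * x / (1 + Real.log x) ^ 2 := by
    refine (abs_sum_le_sum_abs _ _).trans (le_trans (sum_le_sum fun n hn => ?_) (h3 x hx))
    rw [abs_mul, abs_mul, abs_of_nonneg (gg_nonneg N n), Lk_one, abs_of_nonneg ArithmeticFunction.vonMangoldt_nonneg]
    have hv : 0 ≤ ArithmeticFunction.vonMangoldt n := ArithmeticFunction.vonMangoldt_nonneg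
    by_cases hp : n.Prime
    · have : GG N n = 0 := by
        unfold GG
        refine sum_eq_zero fun p hp' => ?_
        rw [Nat.mem_divisors] at hp'
        split_ifs with hc
        · rcases (Nat.dvd_prime hp).1 hp'.1 with rfl | rfl
          · simp [lpr]
          · exfalso
            have := hp.two_le
            have : p ^ 2 ≤ p ^ N := Nat.pow_le_pow_right (by omega) hN
            nlinarith
        · rfl
      rw [this, zero_div, mul_zero]
      exact sub_nonneg.2 (lpr_le n)
    · have : lpr n = 0 := by simp [lpr, hp]
      rw [this, sub_zero]
      have := gg_le N n
      have := gg_nonneg N n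
      have := lam_abs_le n
      calc _ ≤ 1 * ArithmeticFunction.vonMangoldt n * 1 := by gcongr
        _ = _ := by ring
  rw [Ssum_eq]
  rw [Lk_one] at *
  set ℓ := Real.log x with hℓ
  have hl0 : 0 < ℓ := by linarith
  have hs0 : 0 < √ℓ := Real.sqrt_pos.2 hl0
  have hs2 : √ℓ * √ℓ = ℓ := Real.mul_self_sqrt hl0.le
  have hs1 : 1 ≤ √ℓ := Real.one_le_sqrt.2 hl
  set T := x / √ℓ with hT
  have hq : x / (1 + ℓ) ^ 2 ≤ T := by
    rw [hT]; gcongr; nlinarith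
  have hq0 : 0 ≤ x / (1 + ℓ) ^ 2 := by positivity
  simp only [Nat.sub_self, pow_zero, mul_one, Nat.cast_one, one_mul]
  rw [← hT]
  have c1 : C1 * x * (1 / (1 + ℓ) ^ 2) ≤ C1 * T := by
    calc _ = C1 * (x / (1 + ℓ) ^ 2) := by ring
      _ ≤ _ := by gcongr
  have c2 : C2 * x / (1 + ℓ) ^ 2 ≤ C2 * T := by rw [mul_div_assoc]; gcongr
  have c3 : C3 * x / (1 + ℓ) ^ 2 ≤ C3 * T := by rw [mul_div_assoc]; gcongr
  have hT0 : 0 ≤ T := by positivity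
  have d2 : 0 ≤ C2 * T := by positivity
  have d3 : 0 ≤ C3 * T := by positivity
  rw [abs_le] at *
  constructor <;> linarith [a1.1, a1.2, a2.1, a2.2, a3.1, a3.2]

theorem main' (ν : ℝ) (hν : ν ∈ Set.Ioo (0 : ℝ) 1) :
    ∃ (a : ℕ → ℝ) (ξ : ℕ → ℝ), (∀ n, 0 ≤ a n ∧ a n ≤ 2) ∧ Rcond ν a ∧
      (∀ k : ℕ, 1 ≤ k → 1 < ξ k) ∧
      ∀ k : ℕ, 1 ≤ k → Tendsto (fun x : ℝ => Tquot a k x) atTop (nhds (ξ k)) := by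
  obtain ⟨n, hn⟩ := exists_nat_gt (2 / (1 - ν))
  have h1 : 0 < 1 - ν := by linarith [hν.2]
  set N := max n 2 with hN
  have hN2 : 2 ≤ N := le_max_right _ _
  have hN0 : (0:ℝ) < N := by positivity
  have hNn : (N:ℝ)⁻¹ ≤ (1 - ν) / 2 := by
    have : (n:ℝ) ≤ N := by exact_mod_cast le_max_left _ _
    rw [inv_le_comm₀ hN0 (by linarith), inv_div]
    linarith
  refine ⟨aseq N, fun k => if k = 1 then 3 / 2 else 1 + 1 / (2 * k * (N:ℝ) ^ k), aseq_mem N, aseq_R ν hν N hN2 hNn, fun k hk => ?_, fun k hk => ?_⟩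
  · have hk0 : (0:ℝ) < k := by exact_mod_cast hk
    by_cases h : k = 1
    · simp only [h, if_true]; norm_num
    · simp only [h, if_false]
      have : 0 < 1 / (2 * k * (N:ℝ) ^ k) := by positivity
      linarith
  · by_cases h : k = 1
    · subst h; simp only [if_true]; exact lim_one N hN2
    · obtain ⟨j, rfl⟩ : ∃ j, k = j + 2 := ⟨k - 2, by omega⟩
      simp only [h, if_false]
      have := lim_ge j N hN2
      push_cast
      exact this

/-- Fix `ν ∈ (0,1)`.  There exist `(a_n)` with `0 ≤ a_n ≤ 2` satisfying
`R(ν)` and real constants `ξ_k > 1` such that `T_k(x) → ξ_k` as `x → ∞` for every `k ≥ 1`. -/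
theorem bombieri_sieve_stmt2 (ν : ℝ) (hν : ν ∈ Set.Ioo (0 : ℝ) 1) :
    ∃ (a : ℕ → ℝ) (ξ : ℕ → ℝ), (∀ n, 0 ≤ a n ∧ a n ≤ 2) ∧ Rcond ν a ∧
      (∀ k : ℕ, 1 ≤ k → 1 < ξ k) ∧
      ∀ k : ℕ, 1 ≤ k → Tendsto (fun x : ℝ => Tquot a k x) atTop (nhds (ξ k)) := by
  exact main' ν hν
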